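/- arXiv:2410.18343 — 2 statements merged into one kernel-verified Lean document; each statement's English description precedes it below -/
import Mathlib

section
/- Let T be a flagged-mixed tableau that is α-column-strict, β-row-strict, and (α,β)-sorted. Then jdt_GG(T) is obtained from T by a sequence of switches. -/
/-!
Common definitions: mixed tableaux, tableau switching, shuffling, GG-jdt,
hook-valued tableaux and the uncrowding algorithms.
Conventions: French notation, cells `(i, j)` with `i` the row index (counted
from the bottom) and `j` the column index, both `≥ 1`.
-/

open scoped Classical

abbrev Cell : Type := ℕ × ℕ

/-- The cell directly above `c`. -/
def upCell (c : Cell) : Cell := (c.1 + 1, c.2)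

/-- The cell directly to the right of `c`. -/
def rtCell (c : Cell) : Cell := (c.1, c.2 + 1)

/-- A (finite) partition shape: a finite lower-order ideal of cells in the
positive quadrant (1-indexed, French notation). -/
def IsPartitionShape (s : Set Cell) : Prop :=
  s.Finite ∧ (∀ c ∈ s, 1 ≤ c.1 ∧ 1 ≤ c.2) ∧
    ∀ i j i' j' : ℕ, (i, j) ∈ s → 1 ≤ i' → i' ≤ i → 1 ≤ j' → j' ≤ j → (i', j') ∈ s

/-- Entries of mixed tableaux: `al k` represents `α_k`, `be k` represents `β_k`. -/
inductive MEntry : Type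
  | al (k : ℤ)
  | be (k : ℤ)
  deriving DecidableEq

/-- The index of a mixed entry. -/
def MEntry.idx : MEntry → ℤ
  | .al k => k
  | .be k => k

def MEntry.isAlpha : MEntry → Prop
  | .al _ => True
  | .be _ => False

def MEntry.isBeta : MEntry → Prop
  | .al _ => False
  | .be _ => True

/-- A mixed tableau: a partial filling of cells with mixed entries. -/
abbrev MixedTableau : Type := Cell → Option MEntry

/-- The set of cells filled in a mixed tableau. -/
def mshape (T : MixedTableau) : Set Cell := {c | T c ≠ none}

/-- A legal mixed tableau: finitely many cells, all in the positive quadrant,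
and indices of `α` entries are positive. -/
def IsMixedTableau (T : MixedTableau) : Prop :=
  (mshape T).Finite ∧ (∀ c ∈ mshape T, 1 ≤ c.1 ∧ 1 ≤ c.2) ∧
    ∀ c k, T c = some (MEntry.al k) → 0 < k

/-- `T` is a filling of the skew shape `mu / lam`. -/
def HasSkewShape (T : MixedTableau) (lam mu : Set Cell) : Prop :=
  IsPartitionShape lam ∧ IsPartitionShape mu ∧ lam ⊆ mu ∧ mshape T = mu \ lam

/-- `γ`-column-strictness for the entries selected by `p`:
indices weakly decrease to the northeast, and no two selected entries in the
same column have equal indices. -/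
def ColumnStrictFor (p : MEntry → Prop) (T : MixedTableau) : Prop :=
  (∀ c c' e e', T c = some e → T c' = some e' → p e → p e' →
      c.1 ≤ c'.1 → c.2 ≤ c'.2 → MEntry.idx e' ≤ MEntry.idx e) ∧
  (∀ c c' e e', T c = some e → T c' = some e' → p e → p e' →
      c.2 = c'.2 → c ≠ c' → MEntry.idx e ≠ MEntry.idx e')

/-- `γ`-row-strictness for the entries selected by `p`. -/
def RowStrictFor (p : MEntry → Prop) (T : MixedTableau) : Prop :=
  (∀ c c' e e', T c = some e → T c' = some e' → p e → p e' →
      c.1 ≤ c'.1 → c.2 ≤ c'.2 → MEntry.idx e' ≤ MEntry.idx e) ∧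
  (∀ c c' e e', T c = some e → T c' = some e' → p e → p e' →
      c.1 = c'.1 → c ≠ c' → MEntry.idx e ≠ MEntry.idx e')

def AlphaColumnStrict (T : MixedTableau) : Prop := ColumnStrictFor MEntry.isAlpha T
def AlphaRowStrict (T : MixedTableau) : Prop := RowStrictFor MEntry.isAlpha T
def BetaColumnStrict (T : MixedTableau) : Prop := ColumnStrictFor MEntry.isBeta T
def BetaRowStrict (T : MixedTableau) : Prop := RowStrictFor MEntry.isBeta T

def alphaCells (T : MixedTableau) : Set Cell := {c | ∃ k, T c = some (MEntry.al k)}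
def betaCells (T : MixedTableau) : Set Cell := {c | ∃ k, T c = some (MEntry.be k)}

/-- `(α,β)`-sortedness relative to the skew shape `mu / lam`: the `α`-cells form
`nu / lam` and the `β`-cells form `mu / nu` for some partition `nu`. -/
def ABSortedShape (T : MixedTableau) (lam mu : Set Cell) : Prop :=
  ∃ nu : Set Cell, IsPartitionShape nu ∧ lam ⊆ nu ∧ nu ⊆ mu ∧
    alphaCells T = nu \ lam ∧ betaCells T = mu \ nu

/-- `(α,β)`-sorted. -/
def ABSorted (T : MixedTableau) : Prop :=
  ∃ lam mu : Set Cell, HasSkewShape T lam mu ∧ ABSortedShape T lam mu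

/-- `(β,α)`-sortedness relative to the skew shape `mu / lam`. -/
def BASortedShape (T : MixedTableau) (lam mu : Set Cell) : Prop :=
  ∃ nu : Set Cell, IsPartitionShape nu ∧ lam ⊆ nu ∧ nu ⊆ mu ∧
    betaCells T = nu \ lam ∧ alphaCells T = mu \ nu

/-- `(β,α)`-sorted. -/
def BASorted (T : MixedTableau) : Prop :=
  ∃ lam mu : Set Cell, HasSkewShape T lam mu ∧ BASortedShape T lam mu

/-- Interchange the contents of two cells. -/
def swapCells (T : MixedTableau) (c c' : Cell) : MixedTableau :=
  Function.update (Function.update T c (T c')) c' (T c)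

/-- A switch: interchange an `α_r` with a `β_s` directly to its right or
directly above it, provided both the source and the result are
`α`-column-strict and `β`-row-strict. -/
def Switch (T T' : MixedTableau) : Prop :=
  AlphaColumnStrict T ∧ BetaRowStrict T ∧
  ∃ c c' : Cell, (c' = rtCell c ∨ c' = upCell c) ∧
    (∃ r, T c = some (MEntry.al r)) ∧ (∃ s, T c' = some (MEntry.be s)) ∧
    T' = swapCells T c c' ∧ AlphaColumnStrict T' ∧ BetaRowStrict T'

/-- Fully switched: no switch is possible. -/
def FullySwitched (T : MixedTableau) : Prop := ¬ ∃ T', Switch T T'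

/-- The cell `c` contains a `β` entry. -/
def isBetaCell (T : MixedTableau) (c : Cell) : Prop := ∃ k, T c = some (MEntry.be k)

/-- One step of the switching process of the shuffle: the `α` entry at `c`
moves to the cell `c'` (above or to the right), following the tie-breaking
rule of the jeu de taquin shuffle. -/
def ShuffMoveTo (Q : MixedTableau) (c c' : Cell) (Q' : MixedTableau) : Prop :=
  (∃ i, Q c = some (MEntry.al i)) ∧ Q' = swapCells Q c c' ∧
  ((isBetaCell Q (rtCell c) ∧ ¬ isBetaCell Q (upCell c) ∧ c' = rtCell c) ∨
   (isBetaCell Q (upCell c) ∧ ¬ isBetaCell Q (rtCell c) ∧ c' = upCell c) ∨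
   (∃ k j, Q (upCell c) = some (MEntry.be k) ∧ Q (rtCell c) = some (MEntry.be j) ∧
      ((j < k ∧ c' = upCell c) ∨ (k ≤ j ∧ c' = rtCell c))))

/-- The `α` entry at `c` is settled: the cells above and to the right of it
contain `α` entries or are empty. -/
def ShuffSettled (Q : MixedTableau) (c : Cell) : Prop :=
  ¬ isBetaCell Q (upCell c) ∧ ¬ isBetaCell Q (rtCell c)

/-- The full switching process of a single chosen `α` entry, starting at cell `c`,
until it is settled. -/
inductive ShuffTrack : MixedTableau → Cell → MixedTableau → Prop
  | done : ∀ Q c, ShuffSettled Q c → ShuffTrack Q c Q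
  | step : ∀ Q c c' Q' R, ShuffMoveTo Q c c' Q' → ShuffTrack Q' c' R → ShuffTrack Q c R

/-- The cell `c` holds an `α` entry having a `β` entry directly above or
directly to its right. -/
def ShuffPending (Q : MixedTableau) (c : Cell) : Prop :=
  (∃ i, Q c = some (MEntry.al i)) ∧ (isBetaCell Q (upCell c) ∨ isBetaCell Q (rtCell c))

/-- Among the pending `α` entries, the rightmost one with the smallest index. -/
def ShuffChosen (Q : MixedTableau) (c : Cell) : Prop :=
  ShuffPending Q c ∧ ∃ i, Q c = some (MEntry.al i) ∧
    (∀ c' i', ShuffPending Q c' → Q c' = some (MEntry.al i') → i ≤ i') ∧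
    (∀ c', ShuffPending Q c' → Q c' = some (MEntry.al i) → c'.2 ≤ c.2)

/-- `ShuffRel Q R` means `R = shuff(Q)`, the jeu de taquin shuffle of `Q`. -/
inductive ShuffRel : MixedTableau → MixedTableau → Prop
  | done : ∀ Q, (∀ c, ¬ ShuffPending Q c) → ShuffRel Q Q
  | step : ∀ Q c Q' R, ShuffChosen Q c → ShuffTrack Q c Q' → ShuffRel Q' R → ShuffRel Q R

/-- The entry `α_r` at `c` is out of order via its right neighbour. -/
def OutOfOrderH (T : MixedTableau) (c : Cell) : Prop :=
  ∃ r s : ℤ, T c = some (MEntry.al r) ∧ T (rtCell c) = some (MEntry.be s) ∧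
    r < s + ((c.2 : ℤ) + 1) - (c.1 : ℤ)

/-- The entry `α_r` at `c` is out of order via its upper neighbour. -/
def OutOfOrderV (T : MixedTableau) (c : Cell) : Prop :=
  ∃ r t : ℤ, T c = some (MEntry.al r) ∧ T (upCell c) = some (MEntry.be t) ∧
    r ≤ t + (c.2 : ℤ) - ((c.1 : ℤ) + 1)

def OutOfOrder (T : MixedTableau) (c : Cell) : Prop := OutOfOrderH T c ∨ OutOfOrderV T c

/-- The GG-jdt slide at the cell `c`. -/
def GGSlide (T : MixedTableau) (c : Cell) (T' : MixedTableau) : Prop :=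
  (OutOfOrderH T c ∧ ¬ OutOfOrderV T c ∧ T' = swapCells T c (rtCell c)) ∨
  (OutOfOrderV T c ∧ ¬ OutOfOrderH T c ∧ T' = swapCells T c (upCell c)) ∨
  (OutOfOrderH T c ∧ OutOfOrderV T c ∧
    ∃ s t : ℤ, T (rtCell c) = some (MEntry.be s) ∧ T (upCell c) = some (MEntry.be t) ∧
      ((t ≤ s ∧ T' = swapCells T c (rtCell c)) ∨ (s < t ∧ T' = swapCells T c (upCell c))))

/-- The cell chosen by the GG-jdt map: the rightmost cell containing an
out-of-order `α_r` with `r` smallest. -/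
def GGChosen (T : MixedTableau) (c : Cell) : Prop :=
  ∃ r : ℤ, T c = some (MEntry.al r) ∧ OutOfOrder T c ∧
    (∀ c' r', T c' = some (MEntry.al r') → OutOfOrder T c' → r ≤ r') ∧
    (∀ c', T c' = some (MEntry.al r) → OutOfOrder T c' → c'.2 ≤ c.2)

/-- One iteration of the GG-jdt map. -/
def GGStep (T T' : MixedTableau) : Prop := ∃ c, GGChosen T c ∧ GGSlide T c T'

/-- `GGRel T R` means `R = jdt_GG(T)`. -/
def GGRel (T R : MixedTableau) : Prop :=
  Relation.ReflTransGen GGStep T R ∧ ∀ c, ¬ OutOfOrder R c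

/-- `c_β^+`: replace each `β_r` in a cell of content `c = j - i` by `β_{r+c}`. -/
def cBetaPlus (T : MixedTableau) : MixedTableau := fun c =>
  match T c with
  | some (MEntry.be r) => some (MEntry.be (r + ((c.2 : ℤ) - (c.1 : ℤ))))
  | o => o

/-- Totally column-strict: indices strictly decrease up columns and weakly
decrease along rows. -/
def TotallyColumnStrict (T : MixedTableau) : Prop :=
  (∀ c e e', T c = some e → T (upCell c) = some e' → MEntry.idx e' < MEntry.idx e) ∧
  (∀ c e e', T c = some e → T (rtCell c) = some e' → MEntry.idx e' ≤ MEntry.idx e)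

/-- Flagged-mixed tableau: `α_k` in column `j` forces `0 < k < j`, and
`β_k` in row `i` forces `0 < k < i`. -/
def IsFMT (T : MixedTableau) : Prop :=
  (∀ c k, T c = some (MEntry.al k) → 0 < k ∧ k < (c.2 : ℤ)) ∧
  (∀ c k, T c = some (MEntry.be k) → 0 < k ∧ k < (c.1 : ℤ))

/-- Exquisite tableau of shape `mu / lam`. -/
def IsEXQ (lam mu : Set Cell) (E : MixedTableau) : Prop :=
  IsMixedTableau E ∧ HasSkewShape E lam mu ∧ IsFMT E ∧
    TotallyColumnStrict (cBetaPlus E)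

/-- Biflagged tableau of shape `mu / lam`. -/
def IsBFT (lam mu : Set Cell) (Q : MixedTableau) : Prop :=
  IsMixedTableau Q ∧ HasSkewShape Q lam mu ∧
  AlphaColumnStrict Q ∧ BetaRowStrict Q ∧ ABSortedShape Q lam mu ∧
  IsFMT Q ∧ (∃ R, ShuffRel Q R) ∧ (∀ R, ShuffRel Q R → IsFMT R)

/-- Number of occurrences of the entry `e` in the mixed tableau `Q`:
the exponent of the corresponding variable in `wt(Q)`. -/
noncomputable def mcount (Q : MixedTableau) (e : MEntry) : ℕ :=
  Set.ncard {c | Q c = some e}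

/-! ### Hook-valued tableaux -/

/-- A hook: a hook entry, a list of leg entries and a list of arm entries. -/
structure Hook : Type where
  hk : ℕ
  legs : List ℕ
  arms : List ℕ
  deriving DecidableEq

/-- Valid hook: positive entries, `hk < L₁ < ⋯ < L_ℓ` and `hk ≤ A₁ ≤ ⋯ ≤ A_k`. -/
def Hook.Valid (H : Hook) : Prop :=
  1 ≤ H.hk ∧ H.legs.Chain' (· < ·) ∧ (∀ x ∈ H.legs, H.hk < x) ∧
  H.arms.Chain' (· ≤ ·) ∧ ∀ x ∈ H.arms, H.hk ≤ x

/-- The multiset of all entries of a hook. -/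
def Hook.entries (H : Hook) : Multiset ℕ :=
  H.hk ::ₘ ((H.legs : Multiset ℕ) + (H.arms : Multiset ℕ))

/-- A hook-valued filling. -/
abbrev HVTab : Type := Cell → Option Hook

def hshape (T : HVTab) : Set Cell := {c | T c ≠ none}

noncomputable def hsize (T : HVTab) : ℕ := (hshape T).ncard

def hentriesAt (T : HVTab) (c : Cell) : Multiset ℕ :=
  match T c with
  | some H => H.entries
  | none => 0

def armsAt (T : HVTab) (c : Cell) : List ℕ :=
  match T c with
  | some H => H.arms
  | none => []

def legsAt (T : HVTab) (c : Cell) : List ℕ :=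
  match T c with
  | some H => H.legs
  | none => []

/-- Hook-valued tableau: partition shape, valid hooks, rows weakly increasing
(entrywise) and columns strictly increasing (entrywise). -/
def IsHVT (T : HVTab) : Prop :=
  IsPartitionShape (hshape T) ∧
  (∀ c H, T c = some H → H.Valid) ∧
  (∀ c, ∀ x ∈ hentriesAt T c, ∀ y ∈ hentriesAt T (rtCell c), x ≤ y) ∧
  (∀ c, ∀ x ∈ hentriesAt T c, ∀ y ∈ hentriesAt T (upCell c), x < y)

def NoArms (T : HVTab) : Prop := ∀ c, armsAt T c = []
def NoLegs (T : HVTab) : Prop := ∀ c, legsAt T c = []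

/-- Insert into a sorted list. -/
def insSorted (x : ℕ) : List ℕ → List ℕ
  | [] => [x]
  | y :: ys => if x ≤ y then x :: y :: ys else y :: insSorted x ys

def insSortedAll (xs : List ℕ) (l : List ℕ) : List ℕ :=
  xs.foldl (fun acc x => insSorted x acc) l

/-- In arm-uncrowding, the receiving cell's hook: replace its entry `k`
(the smallest entry `≥ a`) by `a` and insert `k` as an arm entry. -/
def Hook.receiveArm (H : Hook) (a k : ℕ) : Hook :=
  if H.hk = k then ⟨a, H.legs, insSorted k H.arms⟩
  else if k ∈ H.legs then ⟨H.hk, insSorted a (H.legs.erase k), insSorted k H.arms⟩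
  else ⟨H.hk, H.legs, insSorted a H.arms⟩

/-- In leg-uncrowding, the receiving cell's hook: replace its entry `k`
(the smallest entry `> l`) by `l` and insert `k` as a leg entry. -/
def Hook.receiveLeg (H : Hook) (l k : ℕ) : Hook :=
  if H.hk = k then ⟨l, insSorted k H.legs, H.arms⟩
  else if k ∈ H.legs then ⟨H.hk, insSorted l H.legs, H.arms⟩
  else ⟨H.hk, insSorted k H.legs, insSorted l (H.arms.erase k)⟩

/-- Add the arm entries `xs` to the cell `c` of `T`. -/
def addArmsAt (T : HVTab) (c : Cell) (xs : List ℕ) : HVTab :=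
  if xs = [] then T
  else
    match T c with
    | some H => Function.update T c (some ⟨H.hk, H.legs, insSortedAll xs H.arms⟩)
    | none => Function.update T c (some ⟨xs.headI, [], xs.tail⟩)

/-- The arm entry selected by arm-uncrowding: `a` is the largest arm entry in
the rightmost column `c` containing an arm entry, located in cell `(r, c)`. -/
def SelectedArm (T : HVTab) (r c a : ℕ) : Prop :=
  a ∈ armsAt T (r, c) ∧
  (∀ r' x, x ∈ armsAt T (r', c) → x ≤ a) ∧
  (∀ r' c', c < c' → armsAt T (r', c') = [])

/-- The leg entry selected by leg-uncrowding: `l` is the largest leg entry in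
the topmost row `r` containing a leg entry, located in cell `(r, c)`. -/
def SelectedLeg (T : HVTab) (r c l : ℕ) : Prop :=
  l ∈ legsAt T (r, c) ∧
  (∀ c' x, x ∈ legsAt T (r, c') → x ≤ l) ∧
  (∀ r' c', r < r' → legsAt T (r', c') = [])

/-- `k` is the smallest entry `≥ a` in column `col`, located in row `rr`. -/
def SmallestGE (T : HVTab) (col a k rr : ℕ) : Prop :=
  k ∈ hentriesAt T (rr, col) ∧ a ≤ k ∧
  ∀ r' y, y ∈ hentriesAt T (r', col) → a ≤ y → k ≤ y

/-- `k` is the smallest entry `> l` in row `row`, located in column `cc`. -/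
def SmallestGT (T : HVTab) (row l k cc : ℕ) : Prop :=
  k ∈ hentriesAt T (row, cc) ∧ l < k ∧
  ∀ c' y, y ∈ hentriesAt T (row, c') → l < y → k ≤ y

/-- The arm-uncrowding bumping `A_b`. -/
def ArmBumpRel (T T' : HVTab) : Prop :=
  (NoArms T ∧ T' = T) ∨
  (∃ r c a H, T (r, c) = some H ∧ SelectedArm T r c a ∧
    ((∃ k rr HT, SmallestGE T (c + 1) a k rr ∧ T (rr, c + 1) = some HT ∧
        ((rr ≠ r ∧
            T' = Function.update (Function.update T (r, c)
                (some ⟨H.hk, H.legs, H.arms.erase a⟩)) (rr, c + 1)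
                (some (Hook.receiveArm HT a k))) ∨
         (rr = r ∧
            T' = Function.update (Function.update T (r, c)
                (some ⟨H.hk, H.legs.filter (fun x => decide (x ≤ a)), H.arms.erase a⟩))
                (r, c + 1)
                (some ⟨(Hook.receiveArm HT a k).hk,
                       insSortedAll (H.legs.filter (fun x => decide (a < x)))
                         (Hook.receiveArm HT a k).legs,
                       (Hook.receiveArm HT a k).arms⟩)))) ∨
     ((∀ r' y, y ∈ hentriesAt T (r', c + 1) → y < a) ∧
        ∃ t, 1 ≤ t ∧ (∀ r', (r', c + 1) ∈ hshape T ↔ 1 ≤ r' ∧ r' < t) ∧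
        ((t ≠ r ∧
            T' = Function.update (Function.update T (r, c)
                (some ⟨H.hk, H.legs, H.arms.erase a⟩)) (t, c + 1)
                (some ⟨a, [], []⟩)) ∨
         (t = r ∧
            T' = Function.update (Function.update T (r, c)
                (some ⟨H.hk, H.legs.filter (fun x => decide (x ≤ a)), H.arms.erase a⟩))
                (r, c + 1)
                (some ⟨a, H.legs.filter (fun x => decide (a < x)), []⟩))))))

/-- The leg-uncrowding bumping `L_b`. -/
def LegBumpRel (T T' : HVTab) : Prop :=
  (NoLegs T ∧ T' = T) ∨
  (∃ r c l H, T (r, c) = some H ∧ SelectedLeg T r c l ∧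
    ((∃ k cc HT, SmallestGT T (r + 1) l k cc ∧ T (r + 1, cc) = some HT ∧
        ((cc ≠ c ∧
            T' = Function.update (Function.update T (r, c)
                (some ⟨H.hk, H.legs.erase l, H.arms⟩)) (r + 1, cc)
                (some (Hook.receiveLeg HT l k))) ∨
         (cc = c ∧
            T' = addArmsAt
              (Function.update (Function.update T (r, c)
                  (some ⟨H.hk, H.legs.erase l, H.arms.filter (fun x => decide (l < x))⟩))
                  (r + 1, c) (some (Hook.receiveLeg HT l k)))
              (r, c + 1) (H.arms.filter (fun x => decide (x ≤ l)))))) ∨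
     ((∀ c' y, y ∈ hentriesAt T (r + 1, c') → y ≤ l) ∧
        ∃ t, 1 ≤ t ∧ (∀ c', (r + 1, c') ∈ hshape T ↔ 1 ≤ c' ∧ c' < t) ∧
        ((t ≠ c ∧
            T' = Function.update (Function.update T (r, c)
                (some ⟨H.hk, H.legs.erase l, H.arms⟩)) (r + 1, t)
                (some ⟨l, [], []⟩)) ∨
         (t = c ∧
            T' = Function.update (Function.update T (r, c)
                (some ⟨H.hk, H.legs.erase l, H.arms.filter (fun x => decide (l < x))⟩))
                (r + 1, c)
                (some ⟨l, [], H.arms.filter (fun x => decide (x ≤ l))⟩))))))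

/-- `n`-fold composition of a relation. -/
def RelPow {α : Type*} (R : α → α → Prop) : ℕ → α → α → Prop
  | 0, a, b => a = b
  | n + 1, a, b => ∃ x, R a x ∧ RelPow R n x b

/-- The single-arm-uncrowding map `𝒜`. -/
def ArmRel (T T' : HVTab) : Prop :=
  (NoArms T ∧ T' = T) ∨
  (¬ NoArms T ∧ ∃ m : ℕ, RelPow ArmBumpRel m T T' ∧ hsize T' = hsize T + 1 ∧
    ∀ m' U, m' < m → RelPow ArmBumpRel m' T U → hsize U = hsize T)

/-- The single-leg-uncrowding map `ℒ`. -/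
def LegRel (T T' : HVTab) : Prop :=
  (NoLegs T ∧ T' = T) ∨
  (¬ NoLegs T ∧ ∃ m : ℕ, RelPow LegBumpRel m T T' ∧ hsize T' = hsize T + 1 ∧
    ∀ m' U, m' < m → RelPow LegBumpRel m' T U → hsize U = hsize T)

/-- The two kinds of uncrowding operators. -/
inductive Bump : Type
  | A
  | L
  deriving DecidableEq

def BumpRel : Bump → HVTab → HVTab → Prop
  | .A => ArmBumpRel
  | .L => LegBumpRel

/-- `T` has type `f_k^{(ε_k)} ⋯ f_1^{(ε_1)}`; the word is given as the list
`[(f_1, ε_1), …, (f_k, ε_k)]` in order of application. -/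
def HasType : HVTab → List (Bump × ℕ) → Prop
  | _, [] => True
  | T, (f, e) :: w => ∃ T', BumpRel f T T' ∧ hsize T' = hsize T + e ∧ HasType T' w

def StepRel : Bump → HVTab → HVTab → Prop
  | .A => ArmRel
  | .L => LegRel

def SelectedArmCol (T : HVTab) (c : ℕ) : Prop := ∃ r a, SelectedArm T r c a
def SelectedLegRow (T : HVTab) (r : ℕ) : Prop := ∃ c l, SelectedLeg T r c l

/-- The recorded entry of one uncrowding step applied to `T`. -/
def StepEntry : Bump → HVTab → MEntry → Prop
  | .A, T, e => ∃ c : ℕ, SelectedArmCol T c ∧ e = MEntry.al (c : ℤ)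
  | .L, T, e => ∃ r : ℕ, SelectedLegRow T r ∧ e = MEntry.be (r : ℤ)

/-- `UncrowdRec w T P Q` means `𝒰_w(T) = (P, Q)`, where `w` is the word listed
in order of application. -/
def UncrowdRec : List Bump → HVTab → HVTab → MixedTableau → Prop
  | [], T, P, Q => P = T ∧ ∀ c, Q c = none
  | f :: w, T, P, Q => ∃ T' Q', StepRel f T T' ∧ UncrowdRec w T' P Q' ∧
      (∀ cell, cell ∈ hshape T' → cell ∉ hshape T →
        ∃ e, StepEntry f T e ∧ Q cell = some e) ∧
      (∀ cell, ¬ (cell ∈ hshape T' ∧ cell ∉ hshape T) → Q cell = Q' cell)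

/-- `𝒰_{ℒ^∞𝒜^∞}(T) = (P, Q)`. -/
def UncrowdLAinf (T P : HVTab) (Q : MixedTableau) : Prop :=
  ∃ M N : ℕ, UncrowdRec (List.replicate M Bump.A ++ List.replicate N Bump.L) T P Q ∧
    NoArms P ∧ NoLegs P

/-- `𝒰_{𝒜^∞ℒ^∞}(T) = (P, Q)`. -/
def UncrowdALinf (T P : HVTab) (Q : MixedTableau) : Prop :=
  ∃ M N : ℕ, UncrowdRec (List.replicate N Bump.L ++ List.replicate M Bump.A) T P Q ∧
    NoArms P ∧ NoLegs P

/-- A semistandard Young tableau, seen as a hook-valued tableau all of whose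
hooks have no arm and no leg entries. -/
def IsSSYT (P : HVTab) : Prop := IsHVT P ∧ NoArms P ∧ NoLegs P

/-- Number of arm entries in column `j` of `T`: the exponent of `α_j` in `wt(T)`. -/
noncomputable def armCountCol (T : HVTab) (j : ℕ) : ℕ := ∑ᶠ i : ℕ, (armsAt T (i, j)).length

/-- Number of leg entries in row `i` of `T`: the exponent of `β_i` in `wt(T)`. -/
noncomputable def legCountRow (T : HVTab) (i : ℕ) : ℕ := ∑ᶠ j : ℕ, (legsAt T (i, j)).length

/-- Number of entries of `T` equal to `v`: the exponent of `x_v` in `wt(T)`. -/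
noncomputable def entryCount (T : HVTab) (v : ℕ) : ℕ := ∑ᶠ c : Cell, (hentriesAt T c).count v

noncomputable def armCountColZ (T : HVTab) (k : ℤ) : ℕ :=
  if 0 ≤ k then armCountCol T k.toNat else 0

noncomputable def legCountRowZ (T : HVTab) (k : ℤ) : ℕ :=
  if 0 ≤ k then legCountRow T k.toNat else 0

/-- `wt(T) = wt(P) · wt(Q)` for a hook-valued tableau `T`, a semistandard
Young tableau `P` (as a hook-valued tableau) and a mixed tableau `Q`. -/
def WtEq (T P : HVTab) (Q : MixedTableau) : Prop :=
  (∀ j : ℕ, armCountCol T j = mcount Q (MEntry.al (j : ℤ))) ∧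
  (∀ i : ℕ, legCountRow T i = mcount Q (MEntry.be (i : ℤ))) ∧
  (∀ k : ℤ, k ≤ 0 → mcount Q (MEntry.al k) = 0 ∧ mcount Q (MEntry.be k) = 0) ∧
  (∀ v : ℕ, entryCount T v = entryCount P v)

/-! ### The GG-jdt map as a sequence of switches -/

/-- The content-shifted value of the entry in cell `c`: `α_k` has value `k`, and `β_s` in a
cell of content `d` has value `s + d`. -/
def HasVal (T : MixedTableau) (c : Cell) (v : ℤ) : Prop :=
  T c = some (MEntry.al v) ∨
    ∃ s, T c = some (MEntry.be s) ∧ v = s + (c.2 : ℤ) - (c.1 : ℤ)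

section SwapLemmas

variable {T : MixedTableau} {c c' d : Cell} {r s k v : ℤ}

theorem HasVal.ne_none (h : HasVal T c v) : T c ≠ none := by
  rcases h with h | ⟨s, h, -⟩ <;> simp [h]

theorem exists_hasVal (h : T c ≠ none) : ∃ v, HasVal T c v := by
  cases hc : T c with
  | none => exact absurd hc h
  | some e =>
    cases e with
    | al k => exact ⟨k, Or.inl hc⟩
    | be s => exact ⟨_, Or.inr ⟨s, hc, rfl⟩⟩

theorem hasVal_al (h : T c = some (MEntry.al k)) : HasVal T c v ↔ v = k := by
  simp [HasVal, h, eq_comm]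

theorem hasVal_be (h : T c = some (MEntry.be s)) :
    HasVal T c v ↔ v = s + (c.2 : ℤ) - (c.1 : ℤ) := by
  simp [HasVal, h]

theorem swapCells_fst (h : c ≠ c') : swapCells T c c' c = T c' := by
  simp [swapCells, h]

theorem swapCells_snd : swapCells T c c' c' = T c := by
  simp [swapCells]

theorem swapCells_of_ne (h : d ≠ c) (h' : d ≠ c') : swapCells T c c' d = T d := by
  simp [swapCells, h, h']

theorem swapCells_hasVal_of_ne (h : d ≠ c) (h' : d ≠ c') :
    HasVal (swapCells T c c') d v ↔ HasVal T d v := by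
  simp [HasVal, swapCells_of_ne h h']

theorem alphaColumnStrict_iff : AlphaColumnStrict T ↔
    (∀ c c' k k', T c = some (MEntry.al k) → T c' = some (MEntry.al k') →
      c.1 ≤ c'.1 → c.2 ≤ c'.2 → k' ≤ k) ∧
    (∀ c c' k, T c = some (MEntry.al k) → T c' = some (MEntry.al k) →
      c.2 = c'.2 → c = c') := by
  constructor
  · rintro ⟨h1, h2⟩
    refine ⟨fun c c' k k' hc hc' => h1 c c' _ _ hc hc' trivial trivial, fun c c' k hc hc' e => ?_⟩
    by_contra hne
    exact h2 c c' _ _ hc hc' trivial trivial e hne rfl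
  · rintro ⟨h1, h2⟩
    refine ⟨?_, ?_⟩
    · rintro c c' (k | k) (k' | k') hc hc' p p'
      · exact h1 c c' k k' hc hc'
      all_goals first | exact p.elim | exact p'.elim
    · rintro c c' (k | k) (k' | k') hc hc' p p' e hne heq
      · obtain rfl : k = k' := heq
        exact hne (h2 c c' k hc hc' e)
      all_goals first | exact p.elim | exact p'.elim

theorem betaRowStrict_iff : BetaRowStrict T ↔
    (∀ c c' k k', T c = some (MEntry.be k) → T c' = some (MEntry.be k') →
      c.1 ≤ c'.1 → c.2 ≤ c'.2 → k' ≤ k) ∧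
    (∀ c c' k, T c = some (MEntry.be k) → T c' = some (MEntry.be k) →
      c.1 = c'.1 → c = c') := by
  constructor
  · rintro ⟨h1, h2⟩
    refine ⟨fun c c' k k' hc hc' => h1 c c' _ _ hc hc' trivial trivial, fun c c' k hc hc' e => ?_⟩
    by_contra hne
    exact h2 c c' _ _ hc hc' trivial trivial e hne rfl
  · rintro ⟨h1, h2⟩
    refine ⟨?_, ?_⟩
    · rintro c c' (k | k) (k' | k') hc hc' p p'
      on_goal 4 => exact h1 c c' k k' hc hc'
      all_goals first | exact p.elim | exact p'.elim
    · rintro c c' (k | k) (k' | k') hc hc' p p' e hne heq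
      on_goal 4 =>
        obtain rfl : k = k' := heq
        exact hne (h2 c c' k hc hc' e)
      all_goals first | exact p.elim | exact p'.elim

theorem swapCells_eq_al (hne : c ≠ c') (hc : T c = some (MEntry.al r))
    (hc' : T c' = some (MEntry.be s)) :
    swapCells T c c' d = some (MEntry.al k) ↔
      (d = c' ∧ k = r) ∨ (d ≠ c ∧ T d = some (MEntry.al k)) := by
  by_cases h : d = c
  · subst h
    simp [swapCells_fst hne, hc', hne]
  · by_cases h' : d = c'
    · subst h'
      simp [swapCells_snd, hc, hc', eq_comm]
    · simp [swapCells_of_ne h h', h, h']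

theorem swapCells_eq_be (hne : c ≠ c') (hc : T c = some (MEntry.al r))
    (hc' : T c' = some (MEntry.be s)) :
    swapCells T c c' d = some (MEntry.be k) ↔
      (d = c ∧ k = s) ∨ (d ≠ c' ∧ T d = some (MEntry.be k)) := by
  by_cases h : d = c
  · subst h
    simp [swapCells_fst hne, hc', hc, eq_comm]
  · by_cases h' : d = c'
    · subst h'
      simp [swapCells_snd, hc, h]
    · simp [swapCells_of_ne h h', h, h']

theorem AlphaColumnStrict.swapCells (hT : AlphaColumnStrict T) (hne : c ≠ c')
    (hc : T c = some (MEntry.al r)) (hc' : T c' = some (MEntry.be s))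
    (hle : ∀ d k, T d = some (MEntry.al k) → d ≠ c → d.1 ≤ c'.1 → d.2 ≤ c'.2 → r ≤ k)
    (hge : ∀ d k, T d = some (MEntry.al k) → d ≠ c → c'.1 ≤ d.1 → c'.2 ≤ d.2 → k ≤ r)
    (hcol : ∀ d, T d = some (MEntry.al r) → d ≠ c → d.2 ≠ c'.2) :
    AlphaColumnStrict (swapCells T c c') := by
  rw [alphaColumnStrict_iff] at hT ⊢
  obtain ⟨h1, h2⟩ := hT
  refine ⟨fun d d' k k' hd hd' hi hj => ?_, fun d d' k hd hd' hj => ?_⟩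
  · rw [swapCells_eq_al hne hc hc'] at hd hd'
    rcases hd with ⟨rfl, rfl⟩ | ⟨hd, hk⟩ <;> rcases hd' with ⟨rfl, rfl⟩ | ⟨hd', hk'⟩
    · exact le_rfl
    · exact hge _ _ hk' hd' hi hj
    · exact hle _ _ hk hd hi hj
    · exact h1 _ _ _ _ hk hk' hi hj
  · rw [swapCells_eq_al hne hc hc'] at hd hd'
    rcases hd with ⟨rfl, rfl⟩ | ⟨hd, hk⟩ <;> rcases hd' with ⟨rfl, e⟩ | ⟨hd', hk'⟩
    · rfl
    · exact absurd hj.symm (hcol _ hk' hd')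
    · subst e
      exact absurd hj (hcol _ hk hd)
    · exact h2 _ _ _ hk hk' hj

theorem BetaRowStrict.swapCells (hT : BetaRowStrict T) (hne : c ≠ c')
    (hc : T c = some (MEntry.al r)) (hc' : T c' = some (MEntry.be s))
    (hle : ∀ d k, T d = some (MEntry.be k) → d ≠ c' → d.1 ≤ c.1 → d.2 ≤ c.2 → s ≤ k)
    (hge : ∀ d k, T d = some (MEntry.be k) → d ≠ c' → c.1 ≤ d.1 → c.2 ≤ d.2 → k ≤ s)
    (hrow : ∀ d, T d = some (MEntry.be s) → d ≠ c' → d.1 ≠ c.1) :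
    BetaRowStrict (swapCells T c c') := by
  rw [betaRowStrict_iff] at hT ⊢
  obtain ⟨h1, h2⟩ := hT
  refine ⟨fun d d' k k' hd hd' hi hj => ?_, fun d d' k hd hd' hj => ?_⟩
  · rw [swapCells_eq_be hne hc hc'] at hd hd'
    rcases hd with ⟨rfl, rfl⟩ | ⟨hd, hk⟩ <;> rcases hd' with ⟨rfl, rfl⟩ | ⟨hd', hk'⟩
    · exact le_rfl
    · exact hge _ _ hk' hd' hi hj
    · exact hle _ _ hk hd hi hj
    · exact h1 _ _ _ _ hk hk' hi hj
  · rw [swapCells_eq_be hne hc hc'] at hd hd'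
    rcases hd with ⟨rfl, rfl⟩ | ⟨hd, hk⟩ <;> rcases hd' with ⟨rfl, e⟩ | ⟨hd', hk'⟩
    · rfl
    · exact absurd hj.symm (hrow _ hk' hd')
    · subst e
      exact absurd hj (hrow _ hk hd)
    · exact h2 _ _ _ hk hk' hj

end SwapLemmas

/-- A slide at `(i, j)` to the right: the sliding entry `α_r` and the entry `β_s` to its right are
out of order, and `β_s` may be moved left without creating a conflict with the cell above. -/
def SlidesRight (T : MixedTableau) (i j : ℕ) (r s : ℤ) : Prop :=
  T (i, j + 1) = some (MEntry.be s) ∧ r < s + (j + 1) - i ∧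
    ∀ y, HasVal T (i + 1, j) y → y < s + j - i

/-- A slide at `(i, j)` upwards: the sliding entry `α_r` and the entry `β_t` above it are
out of order, and `β_t` may be moved down without creating a conflict with the cell to the right. -/
def SlidesUp (T : MixedTableau) (i j : ℕ) (r t : ℤ) : Prop :=
  T (i + 1, j) = some (MEntry.be t) ∧ r ≤ t + j - (i + 1) ∧
    ∀ x, HasVal T (i, j + 1) x → x ≤ t + j - i

theorem GGSlide.right_or_up {T T' : MixedTableau} {i j : ℕ} {r : ℤ}
    (hT : AlphaColumnStrict T) (hc : T (i, j) = some (MEntry.al r))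
    (h : GGSlide T (i, j) T') :
    (∃ s, SlidesRight T i j r s ∧ T' = swapCells T (i, j) (i, j + 1)) ∨
    (∃ t, SlidesUp T i j r t ∧ T' = swapCells T (i, j) (i + 1, j)) := by
  rw [alphaColumnStrict_iff] at hT
  have hup : ∀ k, T (i + 1, j) = some (MEntry.al k) → k < r := by
    intro k hk
    have h1 := hT.1 _ _ _ _ hc hk (by simp) (by simp)
    refine lt_of_le_of_ne h1 ?_
    rintro rfl
    simpa using hT.2 _ _ _ hc hk rfl
  have hrt : ∀ k, T (i, j + 1) = some (MEntry.al k) → k ≤ r := fun k hk =>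
    hT.1 _ _ _ _ hc hk (by simp) (by simp)
  rcases h with ⟨⟨r', s, h1, h2, h3⟩, hV, rfl⟩ | ⟨⟨r', t, h1, h2, h3⟩, hH, rfl⟩ |
    ⟨⟨r', s', h1, h2, h3⟩, ⟨r'', t', h1', h2', h3'⟩, s, t, hs, ht, h⟩
  · obtain rfl : r = r' := by simpa [hc] using h1
    simp only [rtCell] at h2 h3
    refine Or.inl ⟨s, ⟨h2, by omega, ?_⟩, rfl⟩
    rintro y (hy | ⟨t, ht, rfl⟩)
    · have := hup _ hy
      omega
    · have : ¬ (r ≤ t + j - (i + 1)) := fun hlt => hV ⟨r, t, hc, ht, by simpa using hlt⟩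
      push_cast
      omega
  · obtain rfl : r = r' := by simpa [hc] using h1
    simp only [upCell] at h2 h3
    refine Or.inr ⟨t, ⟨h2, by omega, ?_⟩, rfl⟩
    rintro x (hx | ⟨s, hs, rfl⟩)
    · have := hrt _ hx
      omega
    · have : ¬ (r < s + (j + 1) - i) := fun hlt => hH ⟨r, s, hc, hs, by simpa using hlt⟩
      push_cast
      omega
  · obtain rfl : r = r' := by simpa [hc] using h1
    obtain rfl : r = r'' := by simpa [hc] using h1'
    obtain rfl : s = s' := by simpa [hs] using h2
    obtain rfl : t = t' := by simpa [ht] using h2'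
    simp only [rtCell, upCell] at hs ht h3 h3' h
    rcases h with ⟨hle, rfl⟩ | ⟨hlt, rfl⟩
    · refine Or.inl ⟨s, ⟨hs, by omega, fun y hy => ?_⟩, rfl⟩
      rw [hasVal_be ht] at hy
      push_cast at hy
      omega
    · refine Or.inr ⟨t, ⟨ht, by omega, fun x hx => ?_⟩, rfl⟩
      rw [hasVal_be hs] at hx
      push_cast at hx
      omega

/-- `T` is a filling of `mu / lam`, and the cells of `N / lam` (the ones not yet
processed) are filled with `α` entries. -/
structure PartialSort (T : MixedTableau) (lam N mu : Set Cell) : Prop where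
  alpha : AlphaColumnStrict T
  beta : BetaRowStrict T
  part_lam : IsPartitionShape lam
  part_N : IsPartitionShape N
  part_mu : IsPartitionShape mu
  lam_sub : lam ⊆ N
  N_sub : N ⊆ mu
  filled : ∀ a b, T (a, b) ≠ none ↔ (a, b) ∈ mu ∧ (a, b) ∉ lam
  al_of_mem : ∀ a b, (a, b) ∈ N → (a, b) ∉ lam → ∃ k, T (a, b) = some (MEntry.al k)

/-- The cell `(a, b)` of a region `S` guarding the processed entries `α_r` does not let
another entry `α_r` slide to the right so that it ends up below a processed `α_r`. -/
def GuardAt (T : MixedTableau) (N : Set Cell) (r : ℤ) (S : ℕ → ℕ → Prop) (a b : ℕ) : Prop :=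
  (∃ u x, HasVal T (a + 1, b) u ∧ HasVal T (a, b + 1) x ∧ x - 1 ≤ u) ∨
  (∃ a' ≤ a, (a', b + 1) ∉ N ∧ T (a', b + 1) = some (MEntry.al r)) ∨
  (S a (b + 1) ∧ ∀ a', (a', b + 1) ∉ N → T (a', b + 1) ≠ some (MEntry.al r))

/-- The state between the slides of two `α` entries: all the cells outside `N` are in order, and
`(p, q)` is the original cell of the last processed entry `α_r`. -/
structure Settled (T : MixedTableau) (lam N mu : Set Cell) (p q : ℕ) (r : ℤ) : Prop
    extends PartialSort T lam N mu where
  unproc : ∀ a b k, (a, b) ∈ N → T (a, b) = some (MEntry.al k) → r ≤ k ∧ (k = r → p ≤ a ∧ b < q)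
  proc_le : ∀ a b k, (a, b) ∉ N → T (a, b) = some (MEntry.al k) → k ≤ r
  proc_col : ∀ a b, (a, b) ∉ N → T (a, b) = some (MEntry.al r) → q ≤ b
  row : ∀ a b u v, (a, b) ∉ N → HasVal T (a, b) u → HasVal T (a, b + 1) v → v ≤ u
  col : ∀ a b u v, (a, b) ∉ N → HasVal T (a, b) u → HasVal T (a + 1, b) v → v < u
  guard : ∃ S : ℕ → ℕ → Prop, (∀ a b, p ≤ a → b < q → S a b) ∧ ∀ a b, S a b →
    S (a + 1) b ∧ (1 ≤ b → (a + 1, b) ∉ N → GuardAt T N r S a b)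

/-- The state during the slide of an entry `α_r` that started at `(p, q)` and is now at `(i, j)`. -/
structure Sliding (T : MixedTableau) (lam N mu : Set Cell) (p q i j : ℕ) (r : ℤ) : Prop
    extends PartialSort T lam N mu where
  unproc : ∀ a b k, (a, b) ∈ N → T (a, b) = some (MEntry.al k) → r ≤ k ∧ (k = r → p ≤ a ∧ b < q)
  proc_le : ∀ a b k, (a, b) ∉ N → T (a, b) = some (MEntry.al k) → k ≤ r
  proc_col : ∀ a b, (a, b) ∉ N → T (a, b) = some (MEntry.al r) → (a, b) ≠ (i, j) → j < b
  corner : ∀ a b, p ≤ a → q ≤ b → (a, b) ∉ N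
  one_le_q : 1 ≤ q
  p_le : p ≤ i
  q_le : q ≤ j
  active : T (i, j) = some (MEntry.al r)
  row : ∀ a b u v, (a, b) ∉ N → (a, b) ≠ (i, j) → (a, b + 1) ≠ (i, j) →
    HasVal T (a, b) u → HasVal T (a, b + 1) v → v ≤ u
  col : ∀ a b u v, (a, b) ∉ N → (a, b) ≠ (i, j) → (a + 1, b) ≠ (i, j) →
    HasVal T (a, b) u → HasVal T (a + 1, b) v → v < u
  left : ∀ b w, b + 1 = j → (i, b) ∉ N → HasVal T (i, b) w →
    r ≤ w ∧ (∀ x, HasVal T (i, j + 1) x → x - 1 ≤ w) ∧ (∀ y, HasVal T (i + 1, j) y → y + 1 ≤ w)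
  below : ∀ a v, a + 1 = i → (a, j) ∉ N → HasVal T (a, j) v →
    r < v ∧ (∀ x, HasVal T (i, j + 1) x → x ≤ v) ∧ (∀ y, HasVal T (i + 1, j) y → y + 1 < v)
  guard : ∃ S : ℕ → ℕ → Prop, S i j ∧
    ∀ a b, i ≤ a → j ≤ b → S a b → S (a + 1) b ∧ GuardAt T N r S a b
  trail : ∃ S : ℕ → ℕ → Prop, (∀ a b, p ≤ a → b < q → S a b) ∧ ∀ a b, S a b →
    b < j ∧ S (a + 1) b ∧ (1 ≤ b → (a + 1, b) ∉ N → GuardAt T N r S a b)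

namespace PartialSort

variable {T : MixedTableau} {lam N mu : Set Cell} {a b : ℕ}

theorem pos (h : PartialSort T lam N mu) (hf : T (a, b) ≠ none) : 1 ≤ a ∧ 1 ≤ b :=
  h.part_mu.2.1 _ ((h.filled a b).1 hf).1

theorem not_mem_of_le (h : PartialSort T lam N mu) (ha : 1 ≤ a) (hb : 1 ≤ b)
    (hN : (a, b) ∉ N) {a' b' : ℕ} (ha' : a ≤ a') (hb' : b ≤ b') : (a', b') ∉ N :=
  fun hm => hN (h.part_N.2.2 _ _ _ _ hm ha ha' hb hb')

theorem filled_of_le (h : PartialSort T lam N mu) {a' b' : ℕ} (hf : T (a', b') ≠ none)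
    (ha : 1 ≤ a) (hb : 1 ≤ b) (ha' : a ≤ a') (hb' : b ≤ b') (hN : (a, b) ∉ N) :
    T (a, b) ≠ none :=
  (h.filled a b).2 ⟨h.part_mu.2.2 _ _ _ _ ((h.filled _ _).1 hf).1 ha ha' hb hb',
    fun hl => hN (h.lam_sub hl)⟩

theorem be_not_mem (h : PartialSort T lam N mu) {s : ℤ} (hs : T (a, b) = some (MEntry.be s)) :
    (a, b) ∉ N := by
  intro hm
  obtain ⟨k, hk⟩ := h.al_of_mem a b hm ((h.filled a b).1 (by simp [hs])).2
  simp [hs] at hk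

theorem swap (h : PartialSort T lam N mu) {c c' : Cell} (hne : c ≠ c')
    (hc : T c ≠ none) (hc' : T c' ≠ none) (hN : c ∉ N) (hN' : c' ∉ N)
    (ha : AlphaColumnStrict (swapCells T c c')) (hb : BetaRowStrict (swapCells T c c')) :
    PartialSort (swapCells T c c') lam N mu := by
  refine ⟨ha, hb, h.part_lam, h.part_N, h.part_mu, h.lam_sub, h.N_sub, fun a b => ?_,
    fun a b hm hl => ?_⟩
  · rw [← h.filled]
    by_cases e : (a, b) = c
    · rw [e, swapCells_fst hne]
      simp [hc, hc']
    · by_cases e' : (a, b) = c'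
      · rw [e', swapCells_snd]
        simp [hc, hc']
      · rw [swapCells_of_ne e e']
  · rw [swapCells_of_ne (by rintro rfl; exact hN hm) (by rintro rfl; exact hN' hm)]
    exact h.al_of_mem a b hm hl

/-- If some cell is unprocessed, then the rightmost smallest unprocessed entry is at a corner
of `N`, and the other unprocessed entries with the same index are northwest of it. -/
theorem exists_next (h : PartialSort T lam N mu) (hne : ∃ c ∈ N, c ∉ lam) :
    ∃ p q r, (p, q) ∈ N ∧ (p, q) ∉ lam ∧ T (p, q) = some (MEntry.al r) ∧
      (∀ a b k, (a, b) ∈ N → (a, b) ≠ (p, q) → T (a, b) = some (MEntry.al k) →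
        r ≤ k ∧ (k = r → p ≤ a ∧ b < q)) ∧
      (∀ a b, p ≤ a → q ≤ b → (a, b) ∈ N → (a, b) = (p, q)) := by
  have hT := alphaColumnStrict_iff.1 h.alpha
  have hidx : ∀ c : Cell, ∃ k : ℤ, c ∈ N → c ∉ lam → T c = some (MEntry.al k) := by
    rintro ⟨a, b⟩
    by_cases hc : (a, b) ∈ N ∧ (a, b) ∉ lam
    · obtain ⟨k, hk⟩ := h.al_of_mem a b hc.1 hc.2
      exact ⟨k, fun _ _ => hk⟩
    · exact ⟨0, fun h1 h2 => absurd ⟨h1, h2⟩ hc⟩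
  choose f hf using hidx
  have hfin : (N \ lam).Finite := h.part_N.1.subset Set.sdiff_subset
  obtain ⟨⟨p, q⟩, ⟨hN, hl⟩, hmin⟩ := Set.exists_min_image (N \ lam)
    (fun c => toLex (f c, -(c.2 : ℤ))) hfin (by obtain ⟨c, h1, h2⟩ := hne; exact ⟨c, h1, h2⟩)
  have hpq := hf _ hN hl
  have key : ∀ a b k, (a, b) ∈ N → (a, b) ≠ (p, q) → T (a, b) = some (MEntry.al k) →
      f (p, q) ≤ k ∧ (k = f (p, q) → p ≤ a ∧ b < q) := by
    intro a b k hm hne' hk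
    have hl' := ((h.filled a b).1 (by simp [hk])).2
    have hk' := hf _ hm hl'
    have hkf : k = f (a, b) := by simpa [hk] using hk'
    have hlex := hmin _ ⟨hm, hl'⟩
    rw [Prod.Lex.toLex_le_toLex] at hlex
    simp only [← hkf] at hlex
    refine ⟨by omega, fun e => ?_⟩
    subst e
    have hbq : b < q := by
      rcases lt_trichotomy b q with hb | hb | hb
      · exact hb
      · exact absurd (hT.2 _ _ _ hk hpq hb) hne'
      · omega
    refine ⟨?_, hbq⟩
    by_contra hap
    have hpos := h.part_N.2.1 _ hm
    have hpos' := h.part_N.2.1 _ hN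
    have hm' : (p, b) ∈ N := h.part_N.2.2 _ _ _ _ hN hpos'.1 le_rfl hpos.2 hbq.le
    have hl'' : (p, b) ∉ lam := fun hh =>
      hl' (h.part_lam.2.2 _ _ _ _ hh hpos.1 (by omega) hpos.2 le_rfl)
    obtain ⟨m, hm2⟩ := h.al_of_mem _ _ hm' hl''
    have h1 := hT.1 _ _ _ _ hk hm2 (by simp; omega) (by simp)
    have h2 := hT.1 _ _ _ _ hm2 hpq (by simp) (by simpa using hbq.le)
    have h3 : m = f (p, q) := le_antisymm h1 h2
    rw [h3] at hm2
    have h4 := congrArg Prod.fst (hT.2 _ _ _ hk hm2 rfl)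
    simp only at h4
    omega
  refine ⟨p, q, f (p, q), hN, hl, hpq, key, fun a b ha hb hm => ?_⟩
  by_contra hne'
  have hpos := h.part_N.2.1 _ hN
  obtain ⟨k, hk⟩ := h.al_of_mem a b hm fun hh =>
    hl (h.part_lam.2.2 _ _ _ _ hh hpos.1 ha hpos.2 hb)
  have h1 := key a b k hm hne' hk
  have h2 := hT.1 _ _ _ _ hpq hk ha hb
  have := h1.2 (le_antisymm h2 h1.1)
  omega

end PartialSort

namespace Sliding

variable {T : MixedTableau} {lam N mu : Set Cell} {p q i j : ℕ} {r s t : ℤ}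

theorem active_not_mem (h : Sliding T lam N mu p q i j r) : (i, j) ∉ N :=
  h.corner i j h.p_le h.q_le

theorem col_chain (h : Sliding T lam N mu p q i j r) {a b : ℕ} {u : ℤ} (hN : (a, b) ∉ N)
    (hu : HasVal T (a, b) u) (n : ℕ) {v : ℤ} (hv : HasVal T (a + n, b) v)
    (hne : ∀ k ≤ n, (a + k, b) ≠ (i, j)) : v ≤ u - n := by
  have hpos := h.pos hu.ne_none
  induction n generalizing v with
  | zero =>
    rcases hu with hu | ⟨s, hu, rfl⟩
    · rw [add_zero, hasVal_al hu] at hv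
      simp [hv]
    · rw [add_zero, hasVal_be hu] at hv
      simp [hv]
  | succ n ih =>
    have hN' : (a + n, b) ∉ N := h.not_mem_of_le hpos.1 hpos.2 hN (by omega) le_rfl
    obtain ⟨w, hw⟩ := exists_hasVal
      (h.filled_of_le hv.ne_none (by omega) hpos.2 (by omega) le_rfl hN')
    have h1 := ih hw fun k hk => hne k (by omega)
    have h2 := h.col (a + n) b w v hN' (hne n (by omega)) (hne (n + 1) le_rfl) hw hv
    push_cast
    omega

theorem row_chain (h : Sliding T lam N mu p q i j r) {a b : ℕ} {u : ℤ} (hN : (a, b) ∉ N)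
    (hu : HasVal T (a, b) u) (n : ℕ) {v : ℤ} (hv : HasVal T (a, b + n) v)
    (hne : ∀ k ≤ n, (a, b + k) ≠ (i, j)) : v ≤ u := by
  have hpos := h.pos hu.ne_none
  induction n generalizing v with
  | zero =>
    rcases hu with hu | ⟨s, hu, rfl⟩
    · rw [add_zero, hasVal_al hu] at hv
      simp [hv]
    · rw [add_zero, hasVal_be hu] at hv
      simp [hv]
  | succ n ih =>
    have hN' : (a, b + n) ∉ N := h.not_mem_of_le hpos.1 hpos.2 hN le_rfl (by omega)
    obtain ⟨w, hw⟩ := exists_hasVal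
      (h.filled_of_le hv.ne_none hpos.1 (by omega) le_rfl (by omega) hN')
    have h1 := ih hw fun k hk => hne k (by omega)
    have h2 := h.row a (b + n) w v hN' (hne n (by omega)) (hne (n + 1) le_rfl) hw hv
    omega

/-- An `α` entry below the sliding `α_r` in the column to its right has a larger index. -/
theorem lt_of_slidesRight (h : Sliding T lam N mu p q i j r) (hs : SlidesRight T i j r s)
    {a : ℕ} {k : ℤ} (hk : T (a, j + 1) = some (MEntry.al k)) (ha : a < i) : r < k := by
  obtain ⟨hx, hrx, -⟩ := hs
  have hq := h.q_le
  by_cases hN : (a, j + 1) ∈ N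
  · have h1 := h.unproc _ _ _ hN hk
    refine lt_of_le_of_ne h1.1 fun e => ?_
    have := (h1.2 e.symm).2
    omega
  · obtain ⟨n, rfl⟩ := Nat.exists_eq_add_of_lt ha
    have h1 := h.col_chain hN (Or.inl hk) (n + 1) (Or.inr ⟨s, hx, rfl⟩) (by simp)
    push_cast at h1 hrx
    omega

/-- If the sliding `α_r` moves right, then the column it enters has no other `α_r`, and it stays
in every region guarding the other `α_r`. -/
theorem guard_of_slidesRight (h : Sliding T lam N mu p q i j r) (hs : SlidesRight T i j r s)
    {S : ℕ → ℕ → Prop} (hS : GuardAt T N r S i j) :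
    S i (j + 1) ∧ ∀ a, T (a, j + 1) ≠ some (MEntry.al r) := by
  have hq := h.q_le
  rcases hS with ⟨u, x, hu, hx, hux⟩ | ⟨a, ha, -, ha'⟩ | ⟨h1, h2⟩
  · rw [hasVal_be hs.1] at hx
    have := hs.2.2 u hu
    push_cast at hx
    omega
  · rcases ha.lt_or_eq with hlt | rfl
    · exact absurd (h.lt_of_slidesRight hs ha' hlt) (lt_irrefl r)
    · have := hs.1
      simp [ha'] at this
  · refine ⟨h1, fun a ha => ?_⟩
    by_cases hN : (a, j + 1) ∈ N
    · have := ((h.unproc _ _ _ hN ha).2 rfl).2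
      omega
    · exact h2 a hN ha

theorem slideRight_alphaColumnStrict (h : Sliding T lam N mu p q i j r)
    (hs : SlidesRight T i j r s) : AlphaColumnStrict (swapCells T (i, j) (i, j + 1)) := by
  have hT := alphaColumnStrict_iff.1 h.alpha
  obtain ⟨S, hS, hS'⟩ := h.guard
  have hG := h.guard_of_slidesRight hs (hS' i j le_rfl le_rfl hS).2
  refine h.alpha.swapCells (by simp) h.active hs.1 ?_ ?_ ?_
  · rintro ⟨a, b⟩ k hk hne ha hb
    simp only at ha hb
    rcases hb.lt_or_eq with hb | rfl
    · exact hT.1 _ _ _ _ hk h.active ha (Nat.lt_succ_iff.1 hb)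
    · rcases ha.lt_or_eq with ha | rfl
      · exact (h.lt_of_slidesRight hs hk ha).le
      · have := hs.1
        simp [hk] at this
  · rintro ⟨a, b⟩ k hk hne ha hb
    exact hT.1 _ _ _ _ h.active hk ha (le_trans (Nat.le_succ j) hb)
  · rintro ⟨a, b⟩ hk hne rfl
    exact hG.2 a hk

theorem slideRight_betaRowStrict (h : Sliding T lam N mu p q i j r)
    (hs : SlidesRight T i j r s) : BetaRowStrict (swapCells T (i, j) (i, j + 1)) := by
  have hT := betaRowStrict_iff.1 h.beta
  have hpos := h.pos (a := i) (b := j) (by simp [h.active])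
  have hx : HasVal T (i, j + 1) (s + (j + 1) - i) := Or.inr ⟨s, hs.1, by push_cast; ring⟩
  have hle : ∀ a b k, T (a, b) = some (MEntry.be k) → a ≤ i → b ≤ j → s ≤ k :=
    fun a b k hk ha hb => hT.1 _ _ _ _ hk hs.1 ha (Nat.le_succ_of_le hb)
  refine h.beta.swapCells (by simp) h.active hs.1 ?_ ?_ ?_
  · rintro ⟨a, b⟩ k hk hne ha hb
    exact hle a b k hk ha hb
  · rintro ⟨a, b⟩ k hk hne ha hb
    simp only at ha hb
    rcases hb.lt_or_eq with hb | rfl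
    · exact hT.1 _ _ _ _ hs.1 hk ha hb
    · rcases ha.lt_or_eq with ha | rfl
      · obtain ⟨n, rfl⟩ := Nat.exists_eq_add_of_lt ha
        have hN : (i + 1, j) ∉ N :=
          h.not_mem_of_le hpos.1 hpos.2 h.active_not_mem (by omega) le_rfl
        obtain ⟨y, hy⟩ := exists_hasVal
          (h.filled_of_le (a := i + 1) (b := j) (a' := i + n + 1) (b' := j) (by simp [hk])
            (by omega) hpos.2 (by omega) le_rfl hN)
        have h1 := hs.2.2 y hy
        have h2 := h.col_chain hN hy n (v := k + j - (i + n + 1))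
          (Or.inr ⟨k, by rw [show i + 1 + n = i + n + 1 by ring]; exact hk,
            by push_cast; ring⟩) (by simp; omega)
        omega
      · simp [h.active] at hk
  · rintro ⟨a, b⟩ hk hne rfl
    simp only at hk hne h hs hx hle hpos
    rcases lt_trichotomy b j with hb | rfl | hb
    · obtain ⟨n, rfl⟩ := Nat.exists_eq_add_of_lt hb
      have hN := h.be_not_mem hk
      have hpos' := h.pos (a := a) (b := b) (by simp [hk])
      have hN' : (a, b + n) ∉ N := h.not_mem_of_le hpos'.1 hpos'.2 hN le_rfl (by omega)
      obtain ⟨w, hw⟩ := exists_hasVal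
        (h.filled_of_le (a' := a) (b' := b + n + 1) (by simp [h.active])
          hpos'.1 (by omega) le_rfl (by omega) hN')
      have h1 := (h.left _ w rfl hN' hw).2.1 _ hx
      have h2 := h.row_chain hN (Or.inr ⟨s, hk, rfl⟩) n hw (by simp; omega)
      push_cast at h1 h2
      omega
    · simp [h.active] at hk
    · have := hT.2 _ _ _ hk hs.1 rfl
      exact hne this

theorem slideRight (h : Sliding T lam N mu p q i j r) (hs : SlidesRight T i j r s) :
    Sliding (swapCells T (i, j) (i, j + 1)) lam N mu p q i (j + 1) r := by
  have hpos := h.pos (a := i) (b := j) (by simp [h.active])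
  have hx : HasVal T (i, j + 1) (s + (j + 1) - i) := Or.inr ⟨s, hs.1, by push_cast; ring⟩
  have hcN := h.active_not_mem
  have hq := h.q_le
  have hnot : ∀ {a b}, i ≤ a → j ≤ b → (a, b) ∉ N := h.not_mem_of_le hpos.1 hpos.2 hcN
  have hxN : (i, j + 1) ∉ N := hnot le_rfl (by omega)
  have hval : ∀ {a b v}, (a, b) ≠ (i, j) → (a, b) ≠ (i, j + 1) →
      (HasVal (swapCells T (i, j) (i, j + 1)) (a, b) v ↔ HasVal T (a, b) v) :=
    fun h1 h2 => swapCells_hasVal_of_ne h1 h2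
  have hnew : ∀ {v}, HasVal (swapCells T (i, j) (i, j + 1)) (i, j) v ↔ v = s + j - i :=
    fun {v} => hasVal_be (by rw [swapCells_fst (by simp), hs.1])
  have hal : ∀ {a b k}, swapCells T (i, j) (i, j + 1) (a, b) = some (MEntry.al k) ↔
      ((a, b) = (i, j + 1) ∧ k = r) ∨ ((a, b) ≠ (i, j) ∧ T (a, b) = some (MEntry.al k)) :=
    fun {a b k} => swapCells_eq_al (by simp) h.active hs.1
  obtain ⟨S, hS, hS'⟩ := h.guard
  have hG := h.guard_of_slidesRight hs (hS' i j le_rfl le_rfl hS).2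
  obtain ⟨R, hR, hR'⟩ := h.trail
  obtain ⟨hrx, hy⟩ := hs.2
  refine
    { toPartialSort := h.toPartialSort.swap (by simp) (by simp [h.active]) (by simp [hs.1]) hcN hxN
        (h.slideRight_alphaColumnStrict hs) (h.slideRight_betaRowStrict hs)
      unproc := ?_, proc_le := ?_, proc_col := ?_, corner := h.corner, one_le_q := h.one_le_q
      p_le := h.p_le, q_le := by omega, active := by rw [swapCells_snd, h.active]
      row := ?_, col := ?_, left := ?_, below := ?_, guard := ?_, trail := ?_ }
  · intro a b k hm hk
    rcases hal.1 hk with ⟨e, -⟩ | ⟨-, hk⟩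
    · exact absurd (e ▸ hm) hxN
    · exact h.unproc a b k hm hk
  · intro a b k hm hk
    rcases hal.1 hk with ⟨-, rfl⟩ | ⟨-, hk⟩
    · exact le_rfl
    · exact h.proc_le a b k hm hk
  · intro a b hm hk hne
    rcases hal.1 hk with ⟨e, -⟩ | ⟨hne', hk⟩
    · exact absurd e hne
    · rcases (Nat.succ_le_of_lt (h.proc_col a b hm hk hne')).eq_or_lt with rfl | hlt
      · exact absurd hk (hG.2 a)
      · exact hlt
  · intro a b u v hm hne hne' hu hv
    by_cases e : (a, b) = (i, j)
    · simp only [Prod.mk.injEq] at e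
      obtain ⟨rfl, rfl⟩ := e
      exact absurd rfl hne'
    rw [hval e hne] at hu
    by_cases e' : (a, b + 1) = (i, j)
    · simp only [Prod.mk.injEq] at e'
      obtain ⟨rfl, rfl⟩ := e'
      rw [hnew] at hv
      have := (h.left b u rfl hm hu).2.1 _ hx
      push_cast at this hv
      omega
    rw [hval e' hne'] at hv
    exact h.row a b u v hm e e' hu hv
  · intro a b u v hm hne hne' hu hv
    by_cases e : (a, b) = (i, j)
    · simp only [Prod.mk.injEq] at e
      obtain ⟨rfl, rfl⟩ := e
      rw [hnew] at hu
      rw [hval (by simp) (by simp)] at hv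
      have := hy v hv
      omega
    rw [hval e hne] at hu
    by_cases e' : (a + 1, b) = (i, j)
    · simp only [Prod.mk.injEq] at e'
      obtain ⟨rfl, rfl⟩ := e'
      rw [hnew] at hv
      have := (h.below a u rfl hm hu).2.1 _ hx
      omega
    rw [hval e' hne'] at hv
    exact h.col a b u v hm e e' hu hv
  · intro b w hb hm hw
    obtain rfl : b = j := by omega
    rw [hnew] at hw
    refine ⟨by omega, fun x' hx' => ?_, fun y' hy' => ?_⟩
    · rw [hval (by simp; omega) (by simp)] at hx'
      have := h.row _ _ _ _ hxN (by simp) (by simp; omega) hx hx'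
      omega
    · rw [hval (by simp) (by simp)] at hy'
      have hN : (i + 1, b) ∉ N := hnot (by omega) le_rfl
      obtain ⟨y, hy1⟩ := exists_hasVal (h.filled_of_le (a := i + 1) (b := b) hy'.ne_none
        (by omega) hpos.2 le_rfl (by omega) hN)
      have h1 := hy y hy1
      have h2 := h.row _ _ _ _ hN (by simp) (by simp) hy1 hy'
      omega
  · intro a v ha hm hv
    subst ha
    rw [hval (by simp) (by simp)] at hv
    have hxv := h.col _ _ _ _ hm (by simp) (by simp) hv hx
    refine ⟨by omega, fun x' hx' => ?_, fun y' hy' => ?_⟩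
    · rw [hval (by simp; omega) (by simp)] at hx'
      have := h.row _ _ _ _ hxN (by simp) (by simp; omega) hx hx'
      omega
    · rw [hval (by simp) (by simp)] at hy'
      have := h.col _ _ _ _ hxN (by simp) (by simp) hx hy'
      omega
  · refine ⟨S, hG.1, fun a b ha hb hab => ⟨(hS' a b ha (by omega) hab).1, ?_⟩⟩
    rcases (hS' a b ha (by omega) hab).2 with ⟨u, x, hu, hx, hux⟩ | ⟨a', ha', hm, hk⟩ | ⟨h1, h2⟩
    · exact Or.inl ⟨u, x, (hval (by simp; omega) (by simp; omega)).2 hu,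
        (hval (by simp; omega) (by simp; omega)).2 hx, hux⟩
    · exact Or.inr (Or.inl ⟨a', ha', hm, hal.2 (Or.inr ⟨by simp; omega, hk⟩)⟩)
    · refine Or.inr (Or.inr ⟨h1, fun a' hm hk => ?_⟩)
      rcases hal.1 hk with ⟨e, -⟩ | ⟨-, hk⟩
      · simp only [Prod.mk.injEq] at e
        omega
      · exact h2 a' hm hk
  · refine ⟨fun a b => R a b ∨ (i ≤ a ∧ b = j), fun a b ha hb => Or.inl (hR a b ha hb), ?_⟩
    rintro a b (hab | ⟨ha, rfl⟩)
    · obtain ⟨hbj, hup, hg⟩ := hR' a b hab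
      refine ⟨by omega, Or.inl hup, fun hb1 hm => ?_⟩
      have hcol : b + 1 = j → i ≤ a → GuardAt (swapCells T (i, j) (i, j + 1)) N r
          (fun a b => R a b ∨ (i ≤ a ∧ b = j)) a b := by
        rintro rfl hia
        refine Or.inr (Or.inr ⟨Or.inr ⟨hia, rfl⟩, fun a' hm' hk => ?_⟩)
        rcases hal.1 hk with ⟨e, -⟩ | ⟨hne, hk⟩
        · simp at e
        · exact lt_irrefl _ (h.proc_col _ _ hm' hk hne)
      rcases hg hb1 hm with ⟨u, x, hu, hx, hux⟩ | ⟨a', ha', hm', hk⟩ | ⟨h1, h2⟩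
      · by_cases e : (a, b + 1) = (i, j)
        · simp only [Prod.mk.injEq] at e
          exact hcol e.2 e.1.ge
        · exact Or.inl ⟨u, x, (hval (by simp; omega) (by simp; omega)).2 hu,
            (hval e (by simp; omega)).2 hx, hux⟩
      · by_cases e : (a', b + 1) = (i, j)
        · simp only [Prod.mk.injEq] at e
          exact hcol e.2 (by omega)
        · have := h.proc_col _ _ hm' hk e
          omega
      · have hne : b + 1 ≠ j := by
          rintro rfl
          exact h2 i hcN h.active
        refine Or.inr (Or.inr ⟨Or.inl h1, fun a' hm' hk => ?_⟩)
        rcases hal.1 hk with ⟨e, -⟩ | ⟨-, hk⟩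
        · simp only [Prod.mk.injEq] at e
          omega
        · exact h2 a' hm' hk
    · refine ⟨by omega, Or.inr ⟨by omega, rfl⟩, fun _ _ => Or.inr (Or.inl ⟨i, ha, hxN, ?_⟩)⟩
      exact hal.2 (Or.inl ⟨rfl, rfl⟩)

theorem slideUp_alphaColumnStrict (h : Sliding T lam N mu p q i j r)
    (hs : SlidesUp T i j r t) : AlphaColumnStrict (swapCells T (i, j) (i + 1, j)) := by
  have hT := alphaColumnStrict_iff.1 h.alpha
  refine h.alpha.swapCells (by simp) h.active hs.1 ?_ ?_ ?_
  · rintro ⟨a, b⟩ k hk hne ha hb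
    simp only at ha hb
    rcases ha.lt_or_eq with ha | rfl
    · exact hT.1 _ _ _ _ hk h.active (Nat.lt_succ_iff.1 ha) hb
    · rcases hb.lt_or_eq with hb | rfl
      · by_cases hN : (i + 1, b) ∈ N
        · exact (h.unproc _ _ _ hN hk).1
        · obtain ⟨n, rfl⟩ := Nat.exists_eq_add_of_lt hb
          have h1 := h.row_chain hN (Or.inl hk) (n + 1) (Or.inr ⟨t, hs.1, rfl⟩) (by simp)
          have h2 := hs.2.1
          push_cast at h1 h2
          omega
      · have := hs.1
        simp [hk] at this
  · rintro ⟨a, b⟩ k hk hne ha hb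
    exact hT.1 _ _ _ _ h.active hk (le_trans (Nat.le_succ i) ha) hb
  · rintro ⟨a, b⟩ hk hne e
    exact hne (hT.2 _ _ _ hk h.active e)

theorem slideUp_betaRowStrict (h : Sliding T lam N mu p q i j r)
    (hs : SlidesUp T i j r t) : BetaRowStrict (swapCells T (i, j) (i + 1, j)) := by
  have hT := betaRowStrict_iff.1 h.beta
  have hpos := h.pos (a := i) (b := j) (by simp [h.active])
  have hy : HasVal T (i + 1, j) (t + j - (i + 1)) := Or.inr ⟨t, hs.1, by push_cast; ring⟩
  have hright : ∀ b k, T (i, b) = some (MEntry.be k) → j < b → k < t := by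
    intro b k hk hb
    obtain ⟨n, rfl⟩ := Nat.exists_eq_add_of_lt hb
    have hN : (i, j + 1) ∉ N :=
      h.not_mem_of_le hpos.1 hpos.2 h.active_not_mem le_rfl (by omega)
    obtain ⟨x, hx⟩ := exists_hasVal
      (h.filled_of_le (a := i) (b := j + 1) (a' := i) (b' := j + n + 1) (by simp [hk])
        hpos.1 (by omega) le_rfl (by omega) hN)
    have h1 := hs.2.2 x hx
    have h2 := h.row_chain hN hx n (v := k + (j + n + 1) - i)
      (Or.inr ⟨k, by rw [show j + 1 + n = j + n + 1 by ring]; exact hk,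
        by push_cast; ring⟩) (by simp; omega)
    omega
  refine h.beta.swapCells (by simp) h.active hs.1 ?_ ?_ ?_
  · rintro ⟨a, b⟩ k hk hne ha hb
    exact hT.1 _ _ _ _ hk hs.1 (Nat.le_succ_of_le ha) hb
  · rintro ⟨a, b⟩ k hk hne ha hb
    simp only at ha hb
    rcases ha.lt_or_eq with ha | rfl
    · exact hT.1 _ _ _ _ hs.1 hk ha hb
    · rcases hb.lt_or_eq with hb | rfl
      · exact (hright b k hk hb).le
      · simp [h.active] at hk
  · rintro ⟨a, b⟩ hk hne rfl
    simp only at hk hne h hs hy hright hpos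
    rcases lt_trichotomy b j with hb | rfl | hb
    · obtain ⟨n, rfl⟩ := Nat.exists_eq_add_of_lt hb
      have hN := h.be_not_mem hk
      have hpos' := h.pos (a := a) (b := b) (by simp [hk])
      have hN' : (a, b + n) ∉ N := h.not_mem_of_le hpos'.1 hpos'.2 hN le_rfl (by omega)
      obtain ⟨w, hw⟩ := exists_hasVal
        (h.filled_of_le (a' := a) (b' := b + n + 1) (by simp [h.active])
          hpos'.1 (by omega) le_rfl (by omega) hN')
      have h1 := (h.left _ w rfl hN' hw).2.2 _ hy
      have h2 := h.row_chain hN (Or.inr ⟨t, hk, rfl⟩) n hw (by simp; omega)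
      push_cast at h1 h2
      omega
    · simp [h.active] at hk
    · exact lt_irrefl _ (hright b t hk hb)

theorem slideUp (h : Sliding T lam N mu p q i j r) (hs : SlidesUp T i j r t) :
    Sliding (swapCells T (i, j) (i + 1, j)) lam N mu p q (i + 1) j r := by
  have hpos := h.pos (a := i) (b := j) (by simp [h.active])
  have hy : HasVal T (i + 1, j) (t + j - (i + 1)) := Or.inr ⟨t, hs.1, by push_cast; ring⟩
  have hcN := h.active_not_mem
  have hp := h.p_le
  have hnot : ∀ {a b}, i ≤ a → j ≤ b → (a, b) ∉ N := h.not_mem_of_le hpos.1 hpos.2 hcN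
  have hyN : (i + 1, j) ∉ N := hnot (by omega) le_rfl
  have hval : ∀ {a b v}, (a, b) ≠ (i, j) → (a, b) ≠ (i + 1, j) →
      (HasVal (swapCells T (i, j) (i + 1, j)) (a, b) v ↔ HasVal T (a, b) v) :=
    fun h1 h2 => swapCells_hasVal_of_ne h1 h2
  have hnew : ∀ {v}, HasVal (swapCells T (i, j) (i + 1, j)) (i, j) v ↔ v = t + j - i :=
    fun {v} => hasVal_be (by rw [swapCells_fst (by simp), hs.1])
  have hal : ∀ {a b k}, swapCells T (i, j) (i + 1, j) (a, b) = some (MEntry.al k) ↔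
      ((a, b) = (i + 1, j) ∧ k = r) ∨ ((a, b) ≠ (i, j) ∧ T (a, b) = some (MEntry.al k)) :=
    fun {a b k} => swapCells_eq_al (by simp) h.active hs.1
  obtain ⟨S, hS, hS'⟩ := h.guard
  obtain ⟨R, hR, hR'⟩ := h.trail
  obtain ⟨hry, hx⟩ := hs.2
  refine
    { toPartialSort := h.toPartialSort.swap (by simp) (by simp [h.active]) (by simp [hs.1]) hcN hyN
        (h.slideUp_alphaColumnStrict hs) (h.slideUp_betaRowStrict hs)
      unproc := ?_, proc_le := ?_, proc_col := ?_, corner := h.corner, one_le_q := h.one_le_q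
      p_le := by omega, q_le := h.q_le, active := by rw [swapCells_snd, h.active]
      row := ?_, col := ?_, left := ?_, below := ?_, guard := ?_, trail := ?_ }
  · intro a b k hm hk
    rcases hal.1 hk with ⟨e, -⟩ | ⟨-, hk⟩
    · exact absurd (e ▸ hm) hyN
    · exact h.unproc a b k hm hk
  · intro a b k hm hk
    rcases hal.1 hk with ⟨-, rfl⟩ | ⟨-, hk⟩
    · exact le_rfl
    · exact h.proc_le a b k hm hk
  · intro a b hm hk hne
    rcases hal.1 hk with ⟨e, -⟩ | ⟨hne', hk⟩
    · exact absurd e hne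
    · exact h.proc_col a b hm hk hne'
  · intro a b u v hm hne hne' hu hv
    by_cases e : (a, b) = (i, j)
    · simp only [Prod.mk.injEq] at e
      obtain ⟨rfl, rfl⟩ := e
      rw [hnew] at hu
      rw [hval (by simp) (by simp)] at hv
      have := hx v hv
      omega
    rw [hval e hne] at hu
    by_cases e' : (a, b + 1) = (i, j)
    · simp only [Prod.mk.injEq] at e'
      obtain ⟨rfl, rfl⟩ := e'
      rw [hnew] at hv
      have := (h.left b u rfl hm hu).2.2 _ hy
      push_cast at this hv
      omega
    rw [hval e' hne'] at hv
    exact h.row a b u v hm e e' hu hv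
  · intro a b u v hm hne hne' hu hv
    by_cases e : (a, b) = (i, j)
    · simp only [Prod.mk.injEq] at e
      obtain ⟨rfl, rfl⟩ := e
      exact absurd rfl hne'
    rw [hval e hne] at hu
    by_cases e' : (a + 1, b) = (i, j)
    · simp only [Prod.mk.injEq] at e'
      obtain ⟨rfl, rfl⟩ := e'
      rw [hnew] at hv
      have := (h.below a u rfl hm hu).2.2 _ hy
      push_cast at this hv
      omega
    rw [hval e' hne'] at hv
    exact h.col a b u v hm e e' hu hv
  · intro b w hb hm hw
    subst hb
    rw [hval (by simp) (by simp)] at hw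
    have hyw := h.row _ _ _ _ hm (by simp) (by simp) hw hy
    refine ⟨by omega, fun x' hx' => ?_, fun y' hy' => ?_⟩
    · rw [hval (by simp) (by simp)] at hx'
      have := h.row _ _ _ _ hyN (by simp) (by simp) hy hx'
      omega
    · rw [hval (by simp; omega) (by simp)] at hy'
      have := h.col _ _ _ _ hyN (by simp) (by simp; omega) hy hy'
      omega
  · intro a v ha hm hv
    obtain rfl : a = i := by omega
    rw [hnew] at hv
    refine ⟨by omega, fun x' hx' => ?_, fun y' hy' => ?_⟩
    · rw [hval (by simp) (by simp)] at hx'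
      have := h.row _ _ _ _ hyN (by simp) (by simp) hy hx'
      omega
    · rw [hval (by simp; omega) (by simp)] at hy'
      have := h.col _ _ _ _ hyN (by simp) (by simp; omega) hy hy'
      omega
  · refine ⟨S, (hS' i j le_rfl le_rfl hS).1,
      fun a b ha hb hab => ⟨(hS' a b (by omega) hb hab).1, ?_⟩⟩
    rcases (hS' a b (by omega) hb hab).2 with ⟨u, x, hu, hx, hux⟩ | ⟨a', ha', hm, hk⟩ | ⟨h1, h2⟩
    · exact Or.inl ⟨u, x, (hval (by simp; omega) (by simp; omega)).2 hu,
        (hval (by simp; omega) (by simp; omega)).2 hx, hux⟩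
    · exact Or.inr (Or.inl ⟨a', ha', hm, hal.2 (Or.inr ⟨by simp; omega, hk⟩)⟩)
    · refine Or.inr (Or.inr ⟨h1, fun a' hm hk => ?_⟩)
      rcases hal.1 hk with ⟨e, -⟩ | ⟨-, hk⟩
      · simp only [Prod.mk.injEq] at e
        omega
      · exact h2 a' hm hk
  · refine ⟨R, hR, fun a b hab => ?_⟩
    obtain ⟨hbj, hup, hg⟩ := hR' a b hab
    refine ⟨hbj, hup, fun hb1 hm => ?_⟩
    have hcol : b + 1 = j → i ≤ a → GuardAt (swapCells T (i, j) (i + 1, j)) N r R a b := by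
      rintro rfl hia
      rcases hia.eq_or_lt with rfl | hlt
      · have hf := h.filled_of_le (a := i + 1) (b := b) hy.ne_none (by omega) hb1 le_rfl
          (by omega) hm
        obtain ⟨u, hu⟩ := exists_hasVal hf
        have hyu := h.row _ _ _ _ hm (by simp) (by simp) hu hy
        exact Or.inl ⟨u, _, (hval (by simp) (by simp)).2 hu, hnew.2 rfl, by omega⟩
      · exact Or.inr (Or.inl ⟨i + 1, hlt, hyN, hal.2 (Or.inl ⟨rfl, rfl⟩)⟩)
    rcases hg hb1 hm with ⟨u, x, hu, hx, hux⟩ | ⟨a', ha', hm', hk⟩ | ⟨h1, h2⟩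
    · by_cases e : b + 1 = j ∧ i ≤ a
      · exact hcol e.1 e.2
      · exact Or.inl ⟨u, x, (hval (by simp; omega) (by simp; omega)).2 hu,
          (hval (by simp; omega) (by simp; omega)).2 hx, hux⟩
    · by_cases e : (a', b + 1) = (i, j)
      · simp only [Prod.mk.injEq] at e
        exact hcol e.2 (by omega)
      · have := h.proc_col _ _ hm' hk e
        omega
    · have hne : b + 1 ≠ j := by
        rintro rfl
        exact h2 i hcN h.active
      refine Or.inr (Or.inr ⟨h1, fun a' hm' hk => ?_⟩)
      rcases hal.1 hk with ⟨e, -⟩ | ⟨-, hk⟩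
      · simp only [Prod.mk.injEq] at e
        omega
      · exact h2 a' hm' hk

/-- A sliding entry in order is settled. -/
theorem settled (h : Sliding T lam N mu p q i j r) (ho : ¬ OutOfOrder T (i, j)) :
    Settled T lam N mu p q r := by
  have hT := alphaColumnStrict_iff.1 h.alpha
  have hq := h.q_le
  have hact : ∀ {v}, HasVal T (i, j) v ↔ v = r := hasVal_al h.active
  obtain ⟨R, hR, hR'⟩ := h.trail
  refine
    { toPartialSort := h.toPartialSort
      unproc := h.unproc, proc_le := h.proc_le, proc_col := ?_
      row := ?_, col := ?_, guard := ⟨R, hR, fun a b hab => (hR' a b hab).2⟩ }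
  · intro a b hm hk
    by_cases e : (a, b) = (i, j)
    · simp only [Prod.mk.injEq] at e
      omega
    · have := h.proc_col a b hm hk e
      omega
  · intro a b u v hm hu hv
    by_cases e : (a, b) = (i, j)
    · simp only [Prod.mk.injEq] at e
      obtain ⟨rfl, rfl⟩ := e
      rw [hact] at hu
      subst hu
      rcases hv with hv | ⟨s, hs, rfl⟩
      · exact hT.1 _ _ _ _ h.active hv le_rfl (Nat.le_succ b)
      · by_contra hlt
        refine ho (Or.inl ⟨u, s, h.active, hs, ?_⟩)
        push_cast at hlt ⊢
        omega
    by_cases e' : (a, b + 1) = (i, j)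
    · simp only [Prod.mk.injEq] at e'
      obtain ⟨rfl, rfl⟩ := e'
      rw [hact] at hv
      subst hv
      exact (h.left b u rfl hm hu).1
    exact h.row a b u v hm e e' hu hv
  · intro a b u v hm hu hv
    by_cases e : (a, b) = (i, j)
    · simp only [Prod.mk.injEq] at e
      obtain ⟨rfl, rfl⟩ := e
      rw [hact] at hu
      subst hu
      rcases hv with hv | ⟨s, hs, rfl⟩
      · refine lt_of_le_of_ne (hT.1 _ _ _ _ h.active hv (Nat.le_succ a) le_rfl) ?_
        rintro rfl
        simpa using congrArg Prod.fst (hT.2 _ _ _ h.active hv rfl)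
      · by_contra hlt
        refine ho (Or.inr ⟨u, s, h.active, hs, ?_⟩)
        push_cast at hlt ⊢
        omega
    by_cases e' : (a + 1, b) = (i, j)
    · simp only [Prod.mk.injEq] at e'
      obtain ⟨rfl, rfl⟩ := e'
      rw [hact] at hv
      subst hv
      exact (h.below a u rfl hm hu).1
    exact h.col a b u v hm e e' hu hv

/-- If the sliding entry is out of order, then it is the one chosen by the GG-jdt map. -/
theorem eq_of_ggChosen (h : Sliding T lam N mu p q i j r) (ho : OutOfOrder T (i, j)) {c : Cell}
    (hc : GGChosen T c) : c = (i, j) := by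
  have hT := alphaColumnStrict_iff.1 h.alpha
  have hq := h.q_le
  obtain ⟨a, b⟩ := c
  obtain ⟨k, hk, hoc, hmin, hright⟩ := hc
  by_contra hne
  have hkr := hmin _ _ h.active ho
  by_cases hN : (a, b) ∈ N
  · have h1 := h.unproc a b k hN hk
    obtain rfl : k = r := le_antisymm hkr h1.1
    have h2 := h1.2 rfl
    have h3 := hright _ h.active ho
    simp only at h3
    omega
  · rcases hoc with ⟨k', s, hk', hs, hlt⟩ | ⟨k', s, hk', hs, hlt⟩
    · obtain rfl : k = k' := by simpa [hk] using hk'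
      have hs' : T (a, b + 1) = some (MEntry.be s) := hs
      have h1 := h.row a b k _ hN hne (by rintro e; simp [e, h.active] at hs') (Or.inl hk)
        (Or.inr ⟨s, hs', rfl⟩)
      push_cast at h1 hlt
      omega
    · obtain rfl : k = k' := by simpa [hk] using hk'
      have hs' : T (a + 1, b) = some (MEntry.be s) := hs
      have h1 := h.col a b k _ hN hne (by rintro e; simp [e, h.active] at hs') (Or.inl hk)
        (Or.inr ⟨s, hs', rfl⟩)
      push_cast at h1 hlt
      omega

end Sliding

namespace Settled

variable {T T' : MixedTableau} {lam N mu : Set Cell} {p q : ℕ} {r : ℤ}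

theorem exists_sliding (h : Settled T lam N mu p q r) (hne : ∃ c ∈ N, c ∉ lam) :
    ∃ p' q' r', (p', q') ∈ N ∧ Sliding T lam (N \ {(p', q')}) mu p' q' p' q' r' := by
  obtain ⟨p', q', r', hN, hl, hr', hmin, hcorner⟩ := h.exists_next hne
  have hpos := h.part_N.2.1 _ hN
  simp only at hpos
  have hmem : ∀ {a b}, (a, b) ∉ N \ {(p', q')} → (a, b) ≠ (p', q') → (a, b) ∉ N :=
    fun h1 h2 h3 => h1 ⟨h3, h2⟩
  have hrr := h.unproc _ _ _ hN hr'
  have hbefore : ∀ {a b}, T (a, b) ≠ none → a ≤ p' → b ≤ q' → (a, b) ∈ N := fun hf ha hb =>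
    h.part_N.2.2 _ _ _ _ hN (h.pos hf).1 ha (h.pos hf).2 hb
  obtain ⟨S, hS, hS'⟩ := h.guard
  refine ⟨p', q', r', hN,
    { alpha := h.alpha, beta := h.beta, part_lam := h.part_lam, part_mu := h.part_mu
      part_N := ⟨h.part_N.1.subset Set.sdiff_subset, fun c hc => h.part_N.2.1 c hc.1, ?_⟩
      lam_sub := fun c hc => ⟨h.lam_sub hc, by rintro rfl; exact hl hc⟩
      N_sub := fun c hc => h.N_sub hc.1
      filled := h.filled
      al_of_mem := fun a b hm => h.al_of_mem a b hm.1
      unproc := fun a b k hm => hmin a b k hm.1 hm.2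
      proc_le := ?_, proc_col := ?_
      corner := fun a b ha hb hm => hm.2 (hcorner a b ha hb hm.1)
      one_le_q := hpos.2, p_le := le_rfl, q_le := le_rfl, active := hr'
      row := fun a b u v hm hne _ => h.row a b u v (hmem hm hne)
      col := fun a b u v hm hne _ => h.col a b u v (hmem hm hne)
      left := ?_, below := ?_, guard := ?_, trail := ?_ }⟩
  · rintro a b a' b' ⟨hm, hne'⟩ ha' haa hb' hbb
    refine ⟨h.part_N.2.2 _ _ _ _ hm ha' haa hb' hbb, fun e => hne' ?_⟩
    simp only [Set.mem_singleton_iff, Prod.mk.injEq] at e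
    exact hcorner a b (by omega) (by omega) hm
  · intro a b k hm hk
    by_cases e : (a, b) = (p', q')
    · rw [e, hr'] at hk
      simp only [Option.some.injEq, MEntry.al.injEq] at hk
      exact hk.ge
    · exact (h.proc_le a b k (hmem hm e) hk).trans hrr.1
  · intro a b hm hk hne'
    have h1 := h.proc_le a b _ (hmem hm hne') hk
    obtain rfl : r' = r := le_antisymm h1 hrr.1
    exact (hrr.2 rfl).2.trans_le (h.proc_col a b (hmem hm hne') hk)
  · intro b w hb hm hw
    exact absurd (hbefore hw.ne_none le_rfl (by omega)) (hmem hm (by simp; omega))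
  · intro a v ha hm hv
    exact absurd (hbefore hv.ne_none (by omega) le_rfl) (hmem hm (by simp; omega))
  · by_cases e : r' = r
    · subst e
      refine ⟨S, hS _ _ (hrr.2 rfl).1 (hrr.2 rfl).2, fun a b ha hb hab => ?_⟩
      obtain ⟨hup, hg⟩ := hS' a b hab
      have hm : (a + 1, b) ∉ N := fun hm => by
        have := hcorner _ _ (by omega) hb hm
        simp only [Prod.mk.injEq] at this
        omega
      refine ⟨hup, ?_⟩
      rcases hg (by omega) hm with h1 | ⟨a', ha', hm', hk⟩ | ⟨h1, h2⟩
      · exact Or.inl h1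
      · exact Or.inr (Or.inl ⟨a', ha', fun hh => hm' hh.1, hk⟩)
      · exact Or.inr (Or.inr ⟨h1, fun a' hm' => h2 a' (hmem hm' (by simp; omega))⟩)
    · refine ⟨fun _ _ => True, trivial, fun a b ha hb _ =>
        ⟨trivial, Or.inr (Or.inr ⟨trivial, fun a' hm' hk => ?_⟩)⟩⟩
      have h1 := h.proc_le _ _ _ (hmem hm' (by simp; omega)) hk
      exact e (le_antisymm h1 hrr.1)
  · refine ⟨fun a b => p' ≤ a ∧ b < q', fun a b ha hb => ⟨ha, hb⟩, fun a b hab =>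
      ⟨hab.2, ⟨by omega, hab.2⟩, fun hb1 hm => ?_⟩⟩
    rcases (Nat.succ_le_of_lt hab.2).eq_or_lt with e | hlt
    · exact Or.inr (Or.inl ⟨p', hab.1, by simp [← e], by rw [← e] at hr'; exact hr'⟩)
    · refine Or.inr (Or.inr ⟨⟨hab.1, hlt⟩, fun a' hm' hk => ?_⟩)
      have hlt' : b + 1 < q' := hlt
      have hm2 := hmem hm' (by simp; omega)
      obtain rfl : r' = r := le_antisymm (h.proc_le _ _ _ hm2 hk) hrr.1
      have h1 := h.proc_col _ _ hm2 hk
      have h2 := (hrr.2 rfl).2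
      omega

/-- In a settled state, an entry out of order is unprocessed. -/
theorem mem_of_outOfOrder (h : Settled T lam N mu p q r) {c : Cell} (hc : OutOfOrder T c) :
    c ∈ N ∧ c ∉ lam := by
  obtain ⟨a, b⟩ := c
  have hk : ∃ k, T (a, b) = some (MEntry.al k) := by
    rcases hc with ⟨k, s, hk, -⟩ | ⟨k, s, hk, -⟩ <;> exact ⟨k, hk⟩
  obtain ⟨k, hk⟩ := hk
  refine ⟨?_, ((h.filled a b).1 (by simp [hk])).2⟩
  by_contra hN
  rcases hc with ⟨k', s, hk', hs, hlt⟩ | ⟨k', s, hk', hs, hlt⟩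
  · have h1 := h.row a b _ _ hN (Or.inl hk') (Or.inr ⟨s, hs, rfl⟩)
    push_cast at h1 hlt
    omega
  · have h1 := h.col a b _ _ hN (Or.inl hk') (Or.inr ⟨s, hs, rfl⟩)
    push_cast at h1 hlt
    omega

end Settled

section Iteration

variable {T T' : MixedTableau} {lam mu : Set Cell}

/-- An iteration of the GG-jdt map that acts on the sliding entry is a switch. -/
theorem Sliding.switch_of_ggStep {N : Set Cell} {p q i j : ℕ} {r : ℤ}
    (h : Sliding T lam N mu p q i j r) (ho : OutOfOrder T (i, j)) (hstep : GGStep T T') :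
    Switch T T' ∧ ∃ i' j', Sliding T' lam N mu p q i' j' r := by
  obtain ⟨c, hc, hslide⟩ := hstep
  obtain rfl := h.eq_of_ggChosen ho hc
  rcases hslide.right_or_up h.alpha h.active with ⟨s, hs, rfl⟩ | ⟨t, ht, rfl⟩
  · exact ⟨⟨h.alpha, h.beta, _, _, Or.inl rfl, ⟨r, h.active⟩, ⟨s, hs.1⟩, rfl,
      h.slideRight_alphaColumnStrict hs, h.slideRight_betaRowStrict hs⟩, _, _, h.slideRight hs⟩
  · exact ⟨⟨h.alpha, h.beta, _, _, Or.inr rfl, ⟨r, h.active⟩, ⟨t, ht.1⟩, rfl,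
      h.slideUp_alphaColumnStrict ht, h.slideUp_betaRowStrict ht⟩, _, _, h.slideUp ht⟩

theorem Settled.switch_of_ggStep {N : Set Cell} {p q : ℕ} {r : ℤ}
    (h : Settled T lam N mu p q r) (hstep : GGStep T T') :
    Switch T T' ∧ ∃ N' p' q' i' j' r', Sliding T' lam N' mu p' q' i' j' r' := by
  induction hn : N.ncard using Nat.strong_induction_on generalizing N p q r with
  | _ n ih =>
    have hne : ∃ c ∈ N, c ∉ lam := by
      obtain ⟨c, ⟨k, hk, hc, -⟩, -⟩ := hstep
      exact ⟨c, h.mem_of_outOfOrder hc⟩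
    obtain ⟨p', q', r', hN, hsl⟩ := h.exists_sliding hne
    by_cases ho : OutOfOrder T (p', q')
    · obtain ⟨hsw, i', j', hsl'⟩ := hsl.switch_of_ggStep ho hstep
      exact ⟨hsw, _, _, _, _, _, _, hsl'⟩
    · refine ih _ ?_ (hsl.settled ho) rfl
      rw [← hn]
      exact Set.ncard_sdiff_singleton_lt_of_mem hN h.part_N.1

theorem Sliding.switch_and_sliding_of_ggStep {N : Set Cell} {p q i j : ℕ} {r : ℤ}
    (h : Sliding T lam N mu p q i j r) (hstep : GGStep T T') :
    Switch T T' ∧ ∃ N' p' q' i' j' r', Sliding T' lam N' mu p' q' i' j' r' := by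
  by_cases ho : OutOfOrder T (i, j)
  · obtain ⟨hsw, i', j', hsl'⟩ := h.switch_of_ggStep ho hstep
    exact ⟨hsw, _, _, _, _, _, _, hsl'⟩
  · exact (h.settled ho).switch_of_ggStep hstep

theorem Sliding.reflTransGen_switch {N : Set Cell} {p q i j : ℕ} {r : ℤ}
    (h : Sliding T lam N mu p q i j r) (hsteps : Relation.ReflTransGen GGStep T T') :
    Relation.ReflTransGen Switch T T' := by
  induction hsteps using Relation.ReflTransGen.head_induction_on generalizing N p q i j r with
  | refl => exact .refl
  | head hstep _ ih =>
    obtain ⟨hsw, N', p', q', i', j', r', hsl⟩ := h.switch_and_sliding_of_ggStep hstep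
    exact .head hsw (ih hsl)

/-- An `(α,β)`-sorted tableau is settled, with all its `α` entries unprocessed. -/
theorem ABSorted.exists_settled (hT : IsMixedTableau T) (ha : AlphaColumnStrict T)
    (hb : BetaRowStrict T) (hs : ABSorted T) :
    ∃ lam N mu, Settled T lam N mu 0 0 0 := by
  have hB := betaRowStrict_iff.1 hb
  obtain ⟨lam, mu, ⟨hlam, hmu, -, hshape⟩, nu, hnu, hlnu, hnumu, hal, hbe⟩ := hs
  have hal' : ∀ {a b k}, T (a, b) = some (MEntry.al k) → (a, b) ∈ nu := fun {a b k} hk =>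
    ((Set.ext_iff.1 hal (a, b)).1 ⟨k, hk⟩).1
  have hval : ∀ {a b v}, (a, b) ∉ nu → HasVal T (a, b) v →
      ∃ s, T (a, b) = some (MEntry.be s) ∧ v = s + b - a := by
    rintro a b v hN (hv | hv)
    · exact absurd (hal' hv) hN
    · exact hv
  have hpos : ∀ {a b v}, HasVal T (a, b) v → 1 ≤ a ∧ 1 ≤ b := fun hv => hT.2.1 _ hv.ne_none
  refine ⟨lam, nu, mu,
    { alpha := ha, beta := hb, part_lam := hlam, part_N := hnu, part_mu := hmu
      lam_sub := hlnu, N_sub := hnumu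
      filled := fun a b => Set.ext_iff.1 hshape (a, b)
      al_of_mem := fun a b hm hl => (Set.ext_iff.1 hal (a, b)).2 ⟨hm, hl⟩
      unproc := ?_
      proc_le := fun a b k hm hk => absurd (hal' hk) hm
      proc_col := fun a b hm hk => absurd (hal' hk) hm
      row := ?_, col := ?_
      guard := ⟨fun _ _ => False, fun a b _ hb => absurd hb (Nat.not_lt_zero b),
        fun _ _ h => h.elim⟩ }⟩
  · intro a b k _ hk
    have := hT.2.2 _ _ hk
    omega
  · intro a b u v hN hu hv
    have hN' : (a, b + 1) ∉ nu := fun hm =>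
      hN (hnu.2.2 _ _ _ _ hm (hpos hu).1 le_rfl (hpos hu).2 (Nat.le_succ b))
    obtain ⟨s, hs, rfl⟩ := hval hN hu
    obtain ⟨s', hs', rfl⟩ := hval hN' hv
    have h1 := hB.1 _ _ _ _ hs hs' le_rfl (Nat.le_succ b)
    have h2 : s' ≠ s := by
      rintro rfl
      simpa using congrArg Prod.snd (hB.2 _ _ _ hs hs' rfl)
    push_cast
    omega
  · intro a b u v hN hu hv
    have hN' : (a + 1, b) ∉ nu := fun hm =>
      hN (hnu.2.2 _ _ _ _ hm (hpos hu).1 (Nat.le_succ a) (hpos hu).2 le_rfl)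
    obtain ⟨s, hs, rfl⟩ := hval hN hu
    obtain ⟨s', hs', rfl⟩ := hval hN' hv
    have h1 := hB.1 _ _ _ _ hs hs' (Nat.le_succ a) le_rfl
    push_cast
    omega

end Iteration

/-- Proposition 4.13: for a flagged-mixed tableau `T` that is
`α`-column-strict, `β`-row-strict and `(α,β)`-sorted, `jdt_GG(T)` is obtained
from `T` by a sequence of switches. -/
theorem ggjdt_is_switching (T E : MixedTableau)
    (hT : IsMixedTableau T) (hF : IsFMT T)
    (ha : AlphaColumnStrict T) (hb : BetaRowStrict T) (hs : ABSorted T)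
    (hE : GGRel T E) :
    Relation.ReflTransGen Switch T E := by
  obtain ⟨lam, N, mu, h⟩ := hs.exists_settled hT ha hb
  rcases hE.1.cases_head with rfl | ⟨T', hstep, hsteps⟩
  · exact .refl
  · obtain ⟨hsw, _, _, _, _, _, _, hsl⟩ := h.switch_of_ggStep hstep
    exact .head hsw (hsl.reflTransGen_switch hsteps)
end

section
/- Let Q ∈ BFT(μ/λ) be a biflagged tableau of skew shape μ/λ. Then jdt_GG(Q) ∈ EXQ(μ/λ), i.e., jdt_GG(Q) is an exquisite tableau of shape μ/λ. -/
/-!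
Common definitions: mixed tableaux, tableau switching, shuffling, GG-jdt,
hook-valued tableaux and the uncrowding algorithms.
Conventions: French notation, cells `(i, j)` with `i` the row index (counted
from the bottom) and `j` the column index, both `≥ 1`.
-/

open scoped Classical

/-! ### Elementary facts about cells, swaps and values -/

theorem rtCell_fst (c : Cell) : (rtCell c).1 = c.1 := rfl
theorem rtCell_snd (c : Cell) : (rtCell c).2 = c.2 + 1 := rfl
theorem upCell_fst (c : Cell) : (upCell c).1 = c.1 + 1 := rfl
theorem upCell_snd (c : Cell) : (upCell c).2 = c.2 := rfl

theorem cell_ext_iff (c d : Cell) : c = d ↔ c.1 = d.1 ∧ c.2 = d.2 := Prod.ext_iff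

theorem cell_le_iff (c d : Cell) : c ≤ d ↔ c.1 ≤ d.1 ∧ c.2 ≤ d.2 := Iff.rfl

theorem rtCell_ne (c : Cell) : rtCell c ≠ c := by
  simp [cell_ext_iff, rtCell]

theorem upCell_ne (c : Cell) : upCell c ≠ c := by
  simp [cell_ext_iff, upCell]

theorem le_rtCell (c : Cell) : c ≤ rtCell c := by
  simp [cell_le_iff, rtCell]

theorem le_upCell (c : Cell) : c ≤ upCell c := by
  simp [cell_le_iff, upCell]

theorem rtCell_inj {c d : Cell} (h : rtCell c = rtCell d) : c = d := by
  simp only [cell_ext_iff, rtCell] at h ⊢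
  omega

theorem upCell_inj {c d : Cell} (h : upCell c = upCell d) : c = d := by
  simp only [cell_ext_iff, upCell] at h ⊢
  omega

theorem swapCells_left {T : MixedTableau} {c d : Cell} : swapCells T c d c = T d := by
  by_cases h : c = d
  · subst h; simp [swapCells]
  · simp [swapCells, Function.update_of_ne h]

theorem swapCells_right {T : MixedTableau} {c d : Cell} : swapCells T c d d = T c := by
  simp [swapCells]

theorem swapCells_of_ne_s14 {T : MixedTableau} {c d p : Cell} (h₁ : p ≠ c) (h₂ : p ≠ d) :
    swapCells T c d p = T p := by
  simp [swapCells, Function.update_of_ne h₁, Function.update_of_ne h₂]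

/-- The value of a cell: the index of an `α`, and the index of a `β` shifted by its content
and by the constant `θ`. -/
def cellVal (θ : ℤ) (T : MixedTableau) (p : Cell) : ℤ :=
  match T p with
  | some (MEntry.al k) => k
  | some (MEntry.be k) => k + ((p.2 : ℤ) - (p.1 : ℤ)) + θ
  | none => 0

theorem cellVal_al {θ : ℤ} {T : MixedTableau} {p : Cell} {k : ℤ}
    (h : T p = some (MEntry.al k)) : cellVal θ T p = k := by
  simp [cellVal, h]

theorem cellVal_be {θ : ℤ} {T : MixedTableau} {p : Cell} {k : ℤ}
    (h : T p = some (MEntry.be k)) : cellVal θ T p = k + ((p.2 : ℤ) - (p.1 : ℤ)) + θ := by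
  simp [cellVal, h]

theorem cellVal_congr {θ : ℤ} {T T' : MixedTableau} {p : Cell} (h : T p = T' p) :
    cellVal θ T p = cellVal θ T' p := by
  simp [cellVal, h]

/-- An `α_r` at `q` would be out of order and slide to the right. -/
def RightMove (θ r : ℤ) (T : MixedTableau) (q : Cell) : Prop :=
  ∃ s, T (rtCell q) = some (MEntry.be s) ∧ r < cellVal θ T (rtCell q) ∧
    ∀ t, T (upCell q) = some (MEntry.be t) → r ≤ cellVal θ T (upCell q) → t ≤ s

/-- An `α_r` at `q` would be out of order and slide upwards. -/
def UpMove (θ r : ℤ) (T : MixedTableau) (q : Cell) : Prop :=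
  ∃ t, T (upCell q) = some (MEntry.be t) ∧ r ≤ cellVal θ T (upCell q) ∧
    ∀ s, T (rtCell q) = some (MEntry.be s) → r < cellVal θ T (rtCell q) → s < t

theorem RightMove.congr {θ r : ℤ} {T T' : MixedTableau} {q : Cell}
    (hr : T (rtCell q) = T' (rtCell q)) (hu : T (upCell q) = T' (upCell q))
    (h : RightMove θ r T q) : RightMove θ r T' q := by
  obtain ⟨s, h1, h2, h3⟩ := h
  refine ⟨s, hr ▸ h1, cellVal_congr (θ := θ) hr ▸ h2, fun t h4 h5 => h3 t (hu ▸ h4) ?_⟩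
  rwa [cellVal_congr (θ := θ) hu]

/-- Values weakly decrease along rows and strictly decrease up columns within `V`. -/
structure InOrderOn (θ : ℤ) (T : MixedTableau) (V : Set Cell) : Prop where
  rt : ∀ p ∈ V, rtCell p ∈ V → cellVal θ T (rtCell p) ≤ cellVal θ T p
  up : ∀ p ∈ V, upCell p ∈ V → cellVal θ T (upCell p) + 1 ≤ cellVal θ T p

/-- `S` is a region containing `c` that an `α_r` sliding from `c` never leaves, lying strictly
to the left of all other `α_r` outside `U`. -/
structure Barrier (θ : ℤ) (sh : Set Cell) (T : MixedTableau) (U : Set Cell) (r : ℤ) (c : Cell)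
    (S : Set Cell) : Prop where
  mem : c ∈ S
  up : ∀ q ∈ S, upCell q ∈ S
  sep : ∀ p, T p = some (MEntry.al r) → p ∉ U → p ≠ c → ∀ q ∈ S, q.2 < p.2
  frontier : ∀ q ∈ S, c ≤ q → q ∈ sh → rtCell q ∉ S → upCell q ∉ U → ¬ RightMove θ r T q

/-- `S` is the part of a future barrier built by the `α_r` that has slid to `c`. -/
structure PartialBarrier (θ : ℤ) (sh : Set Cell) (T : MixedTableau) (U : Set Cell) (r : ℤ)
    (c : Cell) (S : Set Cell) : Prop where
  col : ∀ q ∈ S, q.2 < c.2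
  up : ∀ q ∈ S, upCell q ∈ S
  mem : ∀ u ∈ U, cellVal θ T u = r → u ∈ S
  frontier : ∀ q ∈ S, q ∈ sh → rtCell q ∉ S → upCell q ∉ U →
    ¬ RightMove θ r T q ∨ (c.1 ≤ q.1 ∧ q.2 + 1 = c.2)

/-- `U` is an initial region of `α`-cells within the shape `sh` of `T`. -/
structure AlphaRegion (θ : ℤ) (sh : Set Cell) (T : MixedTableau) (U : Set Cell) : Prop where
  shape : ∀ p, T p ≠ none ↔ p ∈ sh
  alpha : ∀ u ∈ U, ∃ k, T u = some (MEntry.al k)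
  lower : ∀ u ∈ U, ∀ p ∈ sh, p ≤ u → p ∈ U
  anti : ∀ u ∈ U, ∀ v ∈ U, u ≤ v → cellVal θ T v ≤ cellVal θ T u
  strict : ∀ u ∈ U, ∀ v ∈ U, u.2 = v.2 → u.1 < v.1 → cellVal θ T v < cellVal θ T u

/-- The state between two rounds of sliding: `U` holds the `α`-entries not yet treated. -/
structure Idle (θ : ℤ) (sh : Set Cell) (T : MixedTableau) (U : Set Cell) : Prop
    extends AlphaRegion θ sh T U where
  order : InOrderOn θ T (sh \ U)
  small : ∀ u ∈ U, ∀ p k, T p = some (MEntry.al k) → p ∉ U → k ≤ cellVal θ T u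
  barrier : ∀ u ∈ U, ∃ S, Barrier θ sh T U (cellVal θ T u) u S

/-- The state within a round of sliding: `α_r` is sliding and has reached the cell `c`, and `U`
holds the `α`-entries not yet treated. -/
structure Moving (θ : ℤ) (sh : Set Cell) (T : MixedTableau) (U : Set Cell) (c : Cell) (r : ℤ) :
    Prop extends AlphaRegion θ sh T U where
  cur : T c = some (MEntry.al r)
  notMem : c ∉ U
  large : ∀ u ∈ U, r ≤ cellVal θ T u ∧ (cellVal θ T u = r → u.2 < c.2)
  small : ∀ p k, T p = some (MEntry.al k) → p ∉ U → k ≤ r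
  order : InOrderOn θ T ((sh \ U) \ {c})
  holeLeft : ∀ p ∈ sh \ U, rtCell p = c → r ≤ cellVal θ T p ∧
    (rtCell c ∈ sh → cellVal θ T (rtCell c) ≤ cellVal θ T p + 1) ∧
    (upCell c ∈ sh → cellVal θ T (upCell c) + 1 ≤ cellVal θ T p)
  holeBelow : ∀ p ∈ sh \ U, upCell p = c → r + 1 ≤ cellVal θ T p ∧
    (rtCell c ∈ sh → cellVal θ T (rtCell c) ≤ cellVal θ T p) ∧
    (upCell c ∈ sh → cellVal θ T (upCell c) + 2 ≤ cellVal θ T p)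
  barrier : ∃ S, Barrier θ sh T U r c S
  next : ∃ S, PartialBarrier θ sh T U r c S

theorem AlphaRegion.not_mem_of_le {θ : ℤ} {sh U : Set Cell} {T : MixedTableau}
    (h : AlphaRegion θ sh T U) {p q : Cell} (hp : p ∈ sh) (hpU : p ∉ U) (hpq : p ≤ q) :
    q ∉ U := fun hq => hpU (h.lower q hq p hp hpq)

theorem AlphaRegion.mem_of_some {θ : ℤ} {sh U : Set Cell} {T : MixedTableau}
    (h : AlphaRegion θ sh T U) {p : Cell} {e : MEntry} (hp : T p = some e) : p ∈ sh :=
  (h.shape p).1 (by simp [hp])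

theorem AlphaRegion.not_mem_of_be {θ : ℤ} {sh U : Set Cell} {T : MixedTableau}
    (h : AlphaRegion θ sh T U) {p : Cell} {s : ℤ} (hp : T p = some (MEntry.be s)) : p ∉ U := by
  intro hU
  obtain ⟨k, hk⟩ := h.alpha p hU
  simp [hp] at hk

theorem AlphaRegion.entry {θ : ℤ} {sh U : Set Cell} {T : MixedTableau}
    (h : AlphaRegion θ sh T U) {p : Cell} (hp : p ∈ sh) :
    (∃ k, T p = some (MEntry.al k)) ∨ ∃ k, T p = some (MEntry.be k) := by
  have := (h.shape p).2 hp
  match hT : T p with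
  | none => exact absurd hT this
  | some (.al k) => exact Or.inl ⟨k, rfl⟩
  | some (.be k) => exact Or.inr ⟨k, rfl⟩

/-- Swapping two cells of the shape outside `U` preserves the region `U`. -/
theorem AlphaRegion.swap {θ : ℤ} {sh U : Set Cell} {T : MixedTableau}
    (h : AlphaRegion θ sh T U) {c d : Cell} (hc : c ∈ sh) (hd : d ∈ sh) (hcU : c ∉ U)
    (hdU : d ∉ U) : AlphaRegion θ sh (swapCells T c d) U := by
  have key : ∀ u ∈ U, swapCells T c d u = T u := fun u hu =>
    swapCells_of_ne_s14 (fun e => hcU (e ▸ hu)) (fun e => hdU (e ▸ hu))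
  have keyv : ∀ u ∈ U, cellVal θ (swapCells T c d) u = cellVal θ T u := fun u hu =>
    cellVal_congr (key u hu)
  refine ⟨fun p => ?_, fun u hu => ?_, h.lower, fun u hu v hv huv => ?_,
    fun u hu v hv h1 h2 => ?_⟩
  · by_cases hpd : p = d
    · subst hpd
      rw [swapCells_right]
      exact ⟨fun _ => hd, fun _ => (h.shape c).2 hc⟩
    · by_cases hpc : p = c
      · subst hpc
        rw [swapCells_left]
        exact ⟨fun _ => hc, fun _ => (h.shape d).2 hd⟩
      · rw [swapCells_of_ne_s14 hpc hpd]
        exact h.shape p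
  · rw [key u hu]; exact h.alpha u hu
  · rw [keyv u hu, keyv v hv]; exact h.anti u hu v hv huv
  · rw [keyv u hu, keyv v hv]; exact h.strict u hu v hv h1 h2

section Slides

variable {θ r : ℤ} {sh U : Set Cell} {T : MixedTableau} {c : Cell}

theorem Moving.mem_shape (h : Moving θ sh T U c r) : c ∈ sh := h.mem_of_some h.cur

theorem Moving.sep (h : Moving θ sh T U c r) {p : Cell} (hp : T p = some (MEntry.al r))
    (hpU : p ∉ U) (hpc : p ≠ c) : c.2 < p.2 := by
  obtain ⟨S, hS⟩ := h.barrier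
  exact hS.sep p hp hpU hpc c hS.mem

theorem Moving.rt_not_mem (h : Moving θ sh T U c r) : rtCell c ∉ U :=
  h.not_mem_of_le h.mem_shape h.notMem (le_rtCell c)

theorem Moving.up_not_mem (h : Moving θ sh T U c r) : upCell c ∉ U :=
  h.not_mem_of_le h.mem_shape h.notMem (le_upCell c)

/-- A treated `α` directly above the sliding `α_r` has a smaller index. -/
theorem Moving.up_alpha_lt (h : Moving θ sh T U c r) {k : ℤ}
    (hk : T (upCell c) = some (MEntry.al k)) : k < r := by
  have h1 := h.small _ _ hk h.up_not_mem
  rcases h1.lt_or_eq with h2 | h2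
  · exact h2
  · subst h2
    have := h.sep hk h.up_not_mem (upCell_ne c)
    simp [upCell] at this

theorem Moving.right_val (h : Moving θ sh T U c r) (hm : RightMove θ r T c)
    (hu : upCell c ∈ sh) :
    cellVal θ T (upCell c) + 1 ≤ cellVal θ T (rtCell c) - 1 := by
  obtain ⟨s, hs, hrs, hst⟩ := hm
  rcases h.entry hu with ⟨k, hk⟩ | ⟨t, ht⟩
  · have := h.up_alpha_lt hk
    rw [cellVal_al hk]
    omega
  · by_cases hrt : r ≤ cellVal θ T (upCell c)
    · have := hst t ht hrt
      rw [cellVal_be ht, cellVal_be hs]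
      simp only [upCell, rtCell]
      push_cast
      omega
    · omega

theorem Moving.up_val (h : Moving θ sh T U c r) (hm : UpMove θ r T c)
    (hu : rtCell c ∈ sh) :
    cellVal θ T (rtCell c) ≤ cellVal θ T (upCell c) + 1 := by
  obtain ⟨t, ht, hrt, hst⟩ := hm
  rcases h.entry hu with ⟨k, hk⟩ | ⟨s, hs⟩
  · have := h.small _ _ hk h.rt_not_mem
    rw [cellVal_al hk]
    omega
  · by_cases hrs : r < cellVal θ T (rtCell c)
    · have := hst s hs hrs
      rw [cellVal_be ht, cellVal_be hs]
      simp only [upCell, rtCell]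
      push_cast
      omega
    · omega

theorem Moving.slide_right (hsh : sh.OrdConnected) (h : Moving θ sh T U c r)
    (hm : RightMove θ r T c) :
    Moving θ sh (swapCells T c (rtCell c)) U (rtCell c) r := by
  have hm' := hm
  obtain ⟨s, hs, hrs, hst⟩ := hm'
  set d := rtCell c with hd
  set T' := swapCells T c d with hT'
  have hcd : d ≠ c := rtCell_ne c
  have hdsh : d ∈ sh := h.mem_of_some hs
  have hdU : d ∉ U := h.rt_not_mem
  have hcsh := h.mem_shape
  have hTc : T' c = some (MEntry.be s) := by rw [hT', swapCells_left, hs]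
  have hTd : T' d = some (MEntry.al r) := by rw [hT', swapCells_right, h.cur]
  have hTo : ∀ p, p ≠ c → p ≠ d → T' p = T p := fun p h1 h2 => swapCells_of_ne_s14 h1 h2
  have hvo : ∀ p, p ≠ c → p ≠ d → cellVal θ T' p = cellVal θ T p := fun p h1 h2 =>
    cellVal_congr (hTo p h1 h2)
  have hvc : cellVal θ T' c = cellVal θ T d - 1 := by
    rw [cellVal_be hTc, cellVal_be hs]
    simp only [hd, rtCell]
    push_cast
    omega
  have hvU : ∀ u ∈ U, cellVal θ T' u = cellVal θ T u := fun u hu =>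
    hvo u (fun e => h.notMem (e ▸ hu)) (fun e => hdU (e ▸ hu))
  have hup := h.right_val hm
  rw [← hd] at hup
  have hdW : d ∈ (sh \ U) \ {c} := ⟨⟨hdsh, hdU⟩, hcd⟩
  refine {
    toAlphaRegion := h.swap hcsh hdsh h.notMem hdU, cur := hTd, notMem := hdU,
    large := ?_, small := ?_, order := ⟨?_, ?_⟩, holeLeft := ?_, holeBelow := ?_,
    barrier := ?_, next := ?_ }
  · intro u hu
    rw [hvU u hu]
    refine ⟨(h.large u hu).1, fun e => ?_⟩
    have := (h.large u hu).2 e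
    simp only [hd, rtCell]
    omega
  · intro p k hk hpU
    by_cases hpd : p = d
    · subst hpd; rw [hTd] at hk; simp at hk; omega
    · by_cases hpc : p = c
      · subst hpc; rw [hTc] at hk; simp at hk
      · rw [hTo p hpc hpd] at hk
        exact h.small p k hk hpU
  · intro p hp hp'
    by_cases hpc : p = c
    · subst hpc; exact absurd rfl hp'.2
    · rw [hvo p hpc hp.2]
      by_cases hpc' : rtCell p = c
      · rw [hpc', hvc]
        have := (h.holeLeft p hp.1 hpc').2.1 hdsh
        rw [← hd] at this
        omega
      · rw [hvo _ hpc' hp'.2]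
        exact h.order.rt p ⟨hp.1, hpc⟩ ⟨hp'.1, hpc'⟩
  · intro p hp hp'
    by_cases hpc : p = c
    · subst hpc
      rw [hvc, hvo _ (upCell_ne p) hp'.2]
      exact hup hp'.1.1
    · rw [hvo p hpc hp.2]
      by_cases hpc' : upCell p = c
      · rw [hpc', hvc]
        have := (h.holeBelow p hp.1 hpc').2.1 hdsh
        rw [← hd] at this
        omega
      · rw [hvo _ hpc' hp'.2]
        exact h.order.up p ⟨hp.1, hpc⟩ ⟨hp'.1, hpc'⟩
  · intro p hp hpd
    have hpc : p = c := rtCell_inj hpd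
    subst hpc
    rw [hvc]
    refine ⟨by omega, fun h1 => ?_, fun h1 => ?_⟩
    · have h2 : rtCell d ≠ p := by
        simp only [hd, cell_ext_iff, rtCell, ne_eq]
        omega
      rw [hvo _ h2 (rtCell_ne d)]
      have := h.order.rt d hdW ⟨⟨h1, h.not_mem_of_le hdsh hdU (le_rtCell d)⟩, h2⟩
      omega
    · have h2 : upCell d ≠ p := by simp [hd, cell_ext_iff, rtCell, upCell]
      rw [hvo _ h2 (upCell_ne d)]
      have h3 : upCell p ∈ sh := hsh.out hcsh h1 ⟨le_upCell p, by
        simp [hd, rtCell, upCell]⟩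
      have h4 := hup h3
      have := h.order.rt (upCell p) ⟨⟨h3, h.up_not_mem⟩, upCell_ne p⟩
        ⟨⟨h1, h.not_mem_of_le hdsh hdU (le_upCell d)⟩, h2⟩
      have h5 : rtCell (upCell p) = upCell d := rfl
      rw [h5] at this
      omega
  · intro p hp hpd
    have hpc : p ≠ c := by
      rintro rfl
      simp [hd, rtCell, upCell] at hpd
    have hpd' : p ≠ d := fun e => upCell_ne d (e ▸ hpd)
    rw [hvo p hpc hpd']
    have h0 := h.order.up p ⟨hp, hpc⟩ (hpd ▸ hdW)
    rw [hpd] at h0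
    refine ⟨by omega, fun h1 => ?_, fun h1 => ?_⟩
    · have h2 : rtCell d ≠ c := by
        simp only [hd, cell_ext_iff, rtCell, ne_eq]
        omega
      rw [hvo _ h2 (rtCell_ne d)]
      have := h.order.rt d hdW ⟨⟨h1, h.not_mem_of_le hdsh hdU (le_rtCell d)⟩, h2⟩
      omega
    · have h2 : upCell d ≠ c := by simp [hd, cell_ext_iff, rtCell, upCell]
      rw [hvo _ h2 (upCell_ne d)]
      have := h.order.up d hdW ⟨⟨h1, h.not_mem_of_le hdsh hdU (le_upCell d)⟩, h2⟩
      omega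
  · obtain ⟨S, hS⟩ := h.barrier
    refine ⟨S, ?_, hS.up, ?_, ?_⟩
    · by_contra hdS
      exact hS.frontier c hS.mem le_rfl hcsh hdS h.up_not_mem hm
    · intro p hp hpU hpd
      have hpc : p ≠ c := by
        rintro rfl
        rw [hTc] at hp
        simp at hp
      rw [hTo p hpc hpd] at hp
      exact hS.sep p hp hpU hpc
    · intro q hq hdq hqsh h1 h2 h3
      refine hS.frontier q hq ((le_rtCell c).trans hdq) hqsh h1 h2 (h3.congr ?_ ?_) <;>
      · apply hTo <;> intro e <;>
          simp only [hd, cell_ext_iff, cell_le_iff, rtCell, upCell] at e hdq <;> omega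
  · obtain ⟨S, hS⟩ := h.next
    refine ⟨S ∪ {q | c.1 ≤ q.1 ∧ q.2 = c.2}, ?_, ?_, ?_, ?_⟩
    · rintro q (hq | hq)
      · have := hS.col q hq
        simp only [hd, rtCell]
        omega
      · simp only [hd, rtCell, hq.2]
        omega
    · rintro q (hq | ⟨h1, h2⟩)
      · exact Or.inl (hS.up q hq)
      · exact Or.inr ⟨by simp only [upCell]; omega, h2⟩
    · intro u hu hur
      rw [hvU u hu] at hur
      exact Or.inl (hS.mem u hu hur)
    · rintro q (hq | ⟨h1, h2⟩) hqsh hrt hupq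
      · rw [Set.mem_union, not_or] at hrt
        have hcol := hS.col q hq
        rcases hS.frontier q hq hqsh hrt.1 hupq with h1 | ⟨h1, h2⟩
        · refine Or.inl fun h2 => h1 (h2.congr ?_ ?_)
          · apply hTo
            · intro e
              exact hrt.2 (by simp [e])
            · intro e
              simp only [hd, cell_ext_iff, rtCell] at e
              omega
          · apply hTo <;> intro e <;>
              simp only [hd, cell_ext_iff, rtCell, upCell] at e <;> omega
        · exact absurd ⟨h1, h2⟩ hrt.2
      · exact Or.inr ⟨h1, by simp [hd, rtCell, h2]⟩

theorem Moving.slide_up (hsh : sh.OrdConnected) (h : Moving θ sh T U c r)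
    (hm : UpMove θ r T c) :
    Moving θ sh (swapCells T c (upCell c)) U (upCell c) r := by
  have hm' := hm
  obtain ⟨t, ht, hrt, hst⟩ := hm'
  set d := upCell c with hd
  set T' := swapCells T c d with hT'
  have hcd : d ≠ c := upCell_ne c
  have hdsh : d ∈ sh := h.mem_of_some ht
  have hdU : d ∉ U := h.up_not_mem
  have hcsh := h.mem_shape
  have hTc : T' c = some (MEntry.be t) := by rw [hT', swapCells_left, ht]
  have hTd : T' d = some (MEntry.al r) := by rw [hT', swapCells_right, h.cur]
  have hTo : ∀ p, p ≠ c → p ≠ d → T' p = T p := fun p h1 h2 => swapCells_of_ne_s14 h1 h2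
  have hvo : ∀ p, p ≠ c → p ≠ d → cellVal θ T' p = cellVal θ T p := fun p h1 h2 =>
    cellVal_congr (hTo p h1 h2)
  have hvc : cellVal θ T' c = cellVal θ T d + 1 := by
    rw [cellVal_be hTc, cellVal_be ht]
    simp only [hd, upCell]
    push_cast
    omega
  have hvU : ∀ u ∈ U, cellVal θ T' u = cellVal θ T u := fun u hu =>
    hvo u (fun e => h.notMem (e ▸ hu)) (fun e => hdU (e ▸ hu))
  have hrv := h.up_val hm
  have hdW : d ∈ (sh \ U) \ {c} := ⟨⟨hdsh, hdU⟩, hcd⟩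
  have hrd : rtCell d ∈ sh → cellVal θ T' (rtCell d) ≤ cellVal θ T d := by
    intro h1
    have h2 : rtCell d ≠ c := by simp [hd, cell_ext_iff, rtCell, upCell]
    rw [hvo _ h2 (rtCell_ne d)]
    exact h.order.rt d hdW ⟨⟨h1, h.not_mem_of_le hdsh hdU (le_rtCell d)⟩, h2⟩
  have hud : upCell d ∈ sh → cellVal θ T' (upCell d) + 1 ≤ cellVal θ T d := by
    intro h1
    have h2 : upCell d ≠ c := by
      simp only [hd, cell_ext_iff, upCell, ne_eq]
      omega
    rw [hvo _ h2 (upCell_ne d)]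
    exact h.order.up d hdW ⟨⟨h1, h.not_mem_of_le hdsh hdU (le_upCell d)⟩, h2⟩
  refine {
    toAlphaRegion := h.swap hcsh hdsh h.notMem hdU, cur := hTd, notMem := hdU,
    large := ?_, small := ?_, order := ⟨?_, ?_⟩, holeLeft := ?_, holeBelow := ?_,
    barrier := ?_, next := ?_ }
  · intro u hu
    rw [hvU u hu]
    exact h.large u hu
  · intro p k hk hpU
    by_cases hpd : p = d
    · subst hpd; rw [hTd] at hk; simp at hk; omega
    · by_cases hpc : p = c
      · subst hpc; rw [hTc] at hk; simp at hk
      · rw [hTo p hpc hpd] at hk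
        exact h.small p k hk hpU
  · intro p hp hp'
    by_cases hpc : p = c
    · subst hpc
      rw [hvc, hvo _ (rtCell_ne p) hp'.2]
      exact hrv hp'.1.1
    · rw [hvo p hpc hp.2]
      by_cases hpc' : rtCell p = c
      · rw [hpc', hvc]
        exact (h.holeLeft p hp.1 hpc').2.2 hdsh
      · rw [hvo _ hpc' hp'.2]
        exact h.order.rt p ⟨hp.1, hpc⟩ ⟨hp'.1, hpc'⟩
  · intro p hp hp'
    by_cases hpc : p = c
    · subst hpc; exact absurd rfl hp'.2
    · rw [hvo p hpc hp.2]
      by_cases hpc' : upCell p = c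
      · rw [hpc', hvc]
        have := (h.holeBelow p hp.1 hpc').2.2 hdsh
        rw [← hd] at this
        omega
      · rw [hvo _ hpc' hp'.2]
        exact h.order.up p ⟨hp.1, hpc⟩ ⟨hp'.1, hpc'⟩
  · intro p hp hpd
    have hpc : p ≠ c := by
      rintro rfl
      simp [hd, rtCell, upCell] at hpd
    have hpd' : p ≠ d := fun e => rtCell_ne d (e ▸ hpd)
    rw [hvo p hpc hpd']
    have h0 := h.order.rt p ⟨hp, hpc⟩ (hpd ▸ hdW)
    rw [hpd] at h0
    refine ⟨by omega, fun h1 => ?_, fun h1 => ?_⟩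
    · have := hrd h1
      omega
    · have := hud h1
      omega
  · intro p hp hpd
    have hpc : p = c := upCell_inj hpd
    subst hpc
    rw [hvc]
    refine ⟨by omega, fun h1 => ?_, fun h1 => ?_⟩
    · have := hrd h1
      omega
    · have := hud h1
      omega
  · obtain ⟨S, hS⟩ := h.barrier
    refine ⟨S, hS.up c hS.mem, hS.up, ?_, ?_⟩
    · intro p hp hpU hpd
      have hpc : p ≠ c := by
        rintro rfl
        rw [hTc] at hp
        simp at hp
      rw [hTo p hpc hpd] at hp
      exact hS.sep p hp hpU hpc
    · intro q hq hdq hqsh h1 h2 h3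
      refine hS.frontier q hq ((le_upCell c).trans hdq) hqsh h1 h2 (h3.congr ?_ ?_) <;>
      · apply hTo <;> intro e <;>
          simp only [hd, cell_ext_iff, cell_le_iff, rtCell, upCell] at e hdq <;> omega
  · obtain ⟨S, hS⟩ := h.next
    refine ⟨S, hS.col, hS.up, ?_, ?_⟩
    · intro u hu hur
      rw [hvU u hu] at hur
      exact hS.mem u hu hur
    · intro q hq hqsh hrt' hupq
      have hcol := hS.col q hq
      by_cases hqc : rtCell q = c
      · left
        rintro ⟨s, hs, -, hst'⟩
        have hs' : s = t := by
          rw [hqc, hTc] at hs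
          simpa using hs.symm
        subst hs'
        have hrud : rtCell (upCell q) = d := by
          rw [hd, ← hqc]
          rfl
        have h1 : upCell q ∈ sh := hsh.out hqsh hdsh ⟨le_upCell q, hrud ▸ le_rtCell _⟩
        have h2 : upCell q ≠ c := by
          intro e
          simp only [cell_ext_iff, upCell] at e
          omega
        have h3 : upCell q ≠ d := fun e => rtCell_ne d (e ▸ hrud)
        have h4 := h.order.rt (upCell q) ⟨⟨h1, hupq⟩, h2⟩ (hrud ▸ hdW)
        rw [hrud] at h4
        rcases h.entry h1 with ⟨k, hk⟩ | ⟨y, hy⟩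
        · have h5 := h.small _ _ hk hupq
          have h6 := cellVal_al (θ := θ) hk
          have h7 : k = r := by omega
          subst h7
          have := h.sep hk hupq h2
          simp only [upCell] at this
          omega
        · have h5 := hst' y (by rw [hTo _ h2 h3, hy]) (by rw [hvo _ h2 h3]; omega)
          rw [cellVal_be hy, cellVal_be ht, ← hrud] at h4
          simp only [rtCell] at h4
          push_cast at h4
          omega
      · by_cases hqd : rtCell q = d
        · right
          rw [← hqd]
          exact ⟨le_rfl, rfl⟩
        · rcases hS.frontier q hq hqsh hrt' hupq with h1 | ⟨h1, h2⟩
          · left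
            refine fun h2 => h1 (h2.congr (hTo _ hqc hqd) ?_)
            apply hTo <;> intro e <;>
              simp only [hd, cell_ext_iff, upCell] at e <;> omega
          · right
            refine ⟨?_, h2⟩
            simp only [cell_ext_iff, rtCell, hd, upCell] at hqc ⊢
            omega

end Slides

/-! ### Sliding states satisfy the strictness conditions -/

theorem antitone_of_adjacent {V : Set Cell} (hV : V.OrdConnected) {f : Cell → ℤ}
    (hr : ∀ p ∈ V, rtCell p ∈ V → f (rtCell p) ≤ f p)
    (hu : ∀ p ∈ V, upCell p ∈ V → f (upCell p) ≤ f p)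
    {p q : Cell} (hp : p ∈ V) (hq : q ∈ V) (hpq : p ≤ q) : f q ≤ f p := by
  have key : ∀ n m : ℕ, (p.1 + n, p.2 + m) ∈ V → f (p.1 + n, p.2 + m) ≤ f p := by
    intro n
    induction n with
    | zero =>
      intro m
      induction m with
      | zero => intro _; exact le_rfl
      | succ m ih =>
        intro h
        have h' : (p.1 + 0, p.2 + m) ∈ V := hV.out hp h
          ⟨by simp [cell_le_iff], by simp⟩
        exact (hr _ h' h).trans (ih h')
    | succ n ih =>
      intro m h
      have h' : (p.1 + n, p.2 + m) ∈ V := hV.out hp h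
        ⟨by simp [cell_le_iff], by simp⟩
      exact (hu _ h' h).trans (ih m h')
  rw [cell_le_iff] at hpq
  have e : q = (p.1 + (q.1 - p.1), p.2 + (q.2 - p.2)) := by
    rw [cell_ext_iff]
    simp only
    omega
  rw [e] at hq ⊢
  exact key _ _ hq

theorem alphaColumnStrict_iff_s14 {T : MixedTableau} : AlphaColumnStrict T ↔
    ∀ p q k l, T p = some (MEntry.al k) → T q = some (MEntry.al l) → p ≤ q →
      l ≤ k ∧ (p.2 = q.2 → p ≠ q → l < k) := by
  constructor
  · intro h p q k l hp hq hpq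
    have h1 := h.1 p q _ _ hp hq trivial trivial hpq.1 hpq.2
    refine ⟨h1, fun h2 h3 => ?_⟩
    have h4 := h.2 p q _ _ hp hq trivial trivial h2 h3
    simp only [MEntry.idx] at h1 h4
    omega
  · intro h
    constructor
    · rintro p q (k | k) (l | l) hp hq h1 h2 h3 h4
      · exact (h p q k l hp hq ⟨h3, h4⟩).1
      · exact h2.elim
      · exact h1.elim
      · exact h1.elim
    · rintro p q (k | k) (l | l) hp hq h1 h2 h3 h4
      · simp only [MEntry.idx]
        rcases le_total p.1 q.1 with h5 | h5
        · have := (h p q k l hp hq ⟨h5, h3.le⟩).2 h3 h4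
          omega
        · have := (h q p l k hq hp ⟨h5, h3.ge⟩).2 h3.symm h4.symm
          omega
      · exact h2.elim
      · exact h1.elim
      · exact h1.elim

theorem betaRowStrict_iff_s14 {T : MixedTableau} : BetaRowStrict T ↔
    ∀ p q k l, T p = some (MEntry.be k) → T q = some (MEntry.be l) → p ≤ q →
      l ≤ k ∧ (p.1 = q.1 → p ≠ q → l < k) := by
  constructor
  · intro h p q k l hp hq hpq
    have h1 := h.1 p q _ _ hp hq trivial trivial hpq.1 hpq.2
    refine ⟨h1, fun h2 h3 => ?_⟩
    have h4 := h.2 p q _ _ hp hq trivial trivial h2 h3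
    simp only [MEntry.idx] at h1 h4
    omega
  · intro h
    constructor
    · rintro p q (k | k) (l | l) hp hq h1 h2 h3 h4
      · exact h2.elim
      · exact h1.elim
      · exact h2.elim
      · exact (h p q k l hp hq ⟨h3, h4⟩).1
    · rintro p q (k | k) (l | l) hp hq h1 h2 h3 h4
      · exact h1.elim
      · exact h1.elim
      · exact h2.elim
      · simp only [MEntry.idx]
        rcases le_total p.2 q.2 with h5 | h5
        · have := (h p q k l hp hq ⟨h3.le, h5⟩).2 h3 h4
          omega
        · have := (h q p l k hq hp ⟨h3.ge, h5⟩).2 h3.symm h4.symm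
          omega

theorem AlphaRegion.ordConnected_diff {θ : ℤ} {sh U : Set Cell} {T : MixedTableau}
    (hsh : sh.OrdConnected) (h : AlphaRegion θ sh T U) : (sh \ U).OrdConnected :=
  ⟨fun _ hp _ hq _ hz => ⟨hsh.out hp.1 hq.1 hz, h.not_mem_of_le hp.1 hp.2 hz.1⟩⟩

section Validity

variable {θ r : ℤ} {sh U : Set Cell} {T : MixedTableau} {c : Cell}

/-- No treated `α` lies weakly southwest of the sliding one. -/
theorem Moving.not_le_of_treated (hsh : sh.OrdConnected) (h : Moving θ sh T U c r) {p : Cell}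
    {k : ℤ} (hp : T p = some (MEntry.al k)) (hpU : p ∉ U) (hpc : p ≠ c) : ¬ p ≤ c := by
  intro hle
  have hk := h.small p k hp hpU
  have hvc := cellVal_al (θ := θ) h.cur
  have hV : ((sh \ U) ∩ Set.Iic c).OrdConnected :=
    (h.ordConnected_diff hsh).inter Set.ordConnected_Iic
  have := antitone_of_adjacent hV (f := fun z => cellVal θ T z + z.1) (p := p) (q := c) ?_ ?_
    ⟨⟨h.mem_of_some hp, hpU⟩, hle⟩ ⟨⟨h.mem_shape, h.notMem⟩, Set.mem_Iic.2 le_rfl⟩ hle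
  · have h1 := cellVal_al (θ := θ) hp
    have h2 := hle.1
    have h3 : k = r := by omega
    subst h3
    have := h.sep hp hpU hpc
    have := hle.2
    omega
  · intro z hz hz'
    have hzc : z ≠ c := by
      rintro rfl
      have := hz'.2.2
      simp [rtCell] at this
    by_cases hzc' : rtCell z = c
    · have := (h.holeLeft z hz.1 hzc').1
      have h9 : z.1 = c.1 := by rw [← hzc', rtCell_fst]
      rw [hzc', hvc]
      omega
    · have := h.order.rt z ⟨hz.1, hzc⟩ ⟨hz'.1, hzc'⟩
      simp only [rtCell] at this ⊢
      omega
  · intro z hz hz'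
    have hzc : z ≠ c := by
      rintro rfl
      have := hz'.2.1
      simp [upCell] at this
    by_cases hzc' : upCell z = c
    · have := (h.holeBelow z hz.1 hzc').1
      have h9 : z.1 + 1 = c.1 := by rw [← hzc', upCell_fst]
      rw [hzc', hvc]
      omega
    · have := h.order.up z ⟨hz.1, hzc⟩ ⟨hz'.1, hzc'⟩
      simp only [upCell] at this ⊢
      push_cast
      omega

theorem Moving.val_add_row_le (hsh : sh.OrdConnected) (h : Moving θ sh T U c r) {p q : Cell}
    {k : ℤ} (hp : T p = some (MEntry.al k)) (hpU : p ∉ U) (hpc : p ≠ c) (hq : q ∈ sh)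
    (hpq : p ≤ q) : cellVal θ T q + q.1 ≤ k + p.1 := by
  have hps := h.mem_of_some hp
  have hV : ((sh \ U) ∩ Set.Ici p).OrdConnected :=
    (h.ordConnected_diff hsh).inter Set.ordConnected_Ici
  have hc : ∀ z ∈ (sh \ U) ∩ Set.Ici p, z ≠ c := by
    rintro z hz rfl
    exact h.not_le_of_treated hsh hp hpU hpc hz.2
  rw [← cellVal_al (θ := θ) hp]
  refine antitone_of_adjacent hV (f := fun z => cellVal θ T z + z.1) ?_ ?_
    ⟨⟨hps, hpU⟩, Set.mem_Ici.2 le_rfl⟩ ⟨⟨hq, h.not_mem_of_le hps hpU hpq⟩, hpq⟩ hpq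
  · intro z hz hz'
    have := h.order.rt z ⟨hz.1, hc z hz⟩ ⟨hz'.1, hc _ hz'⟩
    simp only [rtCell] at this ⊢
    omega
  · intro z hz hz'
    have := h.order.up z ⟨hz.1, hc z hz⟩ ⟨hz'.1, hc _ hz'⟩
    simp only [upCell] at this ⊢
    push_cast
    omega

theorem Moving.alphaColumnStrict (hsh : sh.OrdConnected) (h : Moving θ sh T U c r) :
    AlphaColumnStrict T := by
  rw [alphaColumnStrict_iff_s14]
  intro p q k l hp hq hpq
  have hps := h.mem_of_some hp
  have hvp := cellVal_al (θ := θ) hp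
  have hvq := cellVal_al (θ := θ) hq
  by_cases hqU : q ∈ U
  · have hpU := h.lower q hqU p hps hpq
    have h1 := h.anti p hpU q hqU hpq
    refine ⟨by omega, fun h2 h3 => ?_⟩
    have := h.strict p hpU q hqU h2 (lt_of_le_of_ne hpq.1 fun e => h3 (Prod.ext e h2))
    omega
  · have h1 := h.small q l hq hqU
    by_cases hpU : p ∈ U
    · have h2 := h.large p hpU
      refine ⟨by omega, fun h3 h4 => ?_⟩
      by_contra h5
      have h6 : l = r := by omega
      subst h6
      have h7 := h2.2 (by omega)
      by_cases hqc : q = c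
      · subst hqc
        omega
      · have := h.sep hq hqU hqc
        omega
    · by_cases hpc : p = c
      · subst hpc
        have h2 : k = r := by simpa [h.cur] using hp.symm
        subst h2
        refine ⟨h1, fun h3 h4 => ?_⟩
        by_contra h5
        have h6 : l = k := by omega
        subst h6
        have := h.sep hq hqU h4.symm
        omega
      · have h2 := h.val_add_row_le hsh hp hpU hpc (h.mem_of_some hq) hpq
        have h3 := hpq.1
        refine ⟨by omega, fun h4 h5 => ?_⟩
        have : p.1 < q.1 := lt_of_le_of_ne h3 fun e => h5 (Prod.ext e h4)
        omega

theorem Moving.betaRowStrict (hsh : sh.OrdConnected) (h : Moving θ sh T U c r) :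
    BetaRowStrict T := by
  rw [betaRowStrict_iff_s14]
  obtain ⟨x, hx1, hx2, hxL, hxB⟩ : ∃ x : ℤ,
      (rtCell c ∈ sh → cellVal θ T (rtCell c) - 1 ≤ x) ∧
      (upCell c ∈ sh → cellVal θ T (upCell c) + 1 ≤ x) ∧
      (∀ p ∈ sh \ U, rtCell p = c → x ≤ cellVal θ T p) ∧
      (∀ p ∈ sh \ U, upCell p = c → x + 1 ≤ cellVal θ T p) := by
    by_cases h1 : rtCell c ∈ sh <;> by_cases h2 : upCell c ∈ sh
    · refine ⟨max (cellVal θ T (rtCell c) - 1) (cellVal θ T (upCell c) + 1),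
        fun _ => le_max_left _ _, fun _ => le_max_right _ _, fun p hp e => ?_,
        fun p hp e => ?_⟩
      · have h3 := (h.holeLeft p hp e).2
        have := h3.1 h1
        have := h3.2 h2
        omega
      · have h3 := (h.holeBelow p hp e).2
        have := h3.1 h1
        have := h3.2 h2
        omega
    · refine ⟨cellVal θ T (rtCell c) - 1, fun _ => le_rfl, fun h3 => absurd h3 h2,
        fun p hp e => ?_, fun p hp e => ?_⟩
      · have := (h.holeLeft p hp e).2.1 h1
        omega
      · have := (h.holeBelow p hp e).2.1 h1
        omega
    · refine ⟨cellVal θ T (upCell c) + 1, fun h3 => absurd h3 h1, fun _ => le_rfl,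
        fun p hp e => ?_, fun p hp e => ?_⟩
      · have := (h.holeLeft p hp e).2.2 h2
        omega
      · have := (h.holeBelow p hp e).2.2 h2
        omega
    · exact ⟨r, fun h3 => absurd h3 h1, fun h3 => absurd h3 h2,
        fun p hp e => (h.holeLeft p hp e).1, fun p hp e => (h.holeBelow p hp e).1⟩
  let w : Cell → ℤ := fun z => (if z = c then x else cellVal θ T z) - z.2 + z.1
  have wc : w c = x - c.2 + c.1 := by simp [w]
  have wo : ∀ z, z ≠ c → w z = cellVal θ T z - z.2 + z.1 := fun z hz => by simp [w, hz]
  have hV := h.ordConnected_diff hsh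
  have hstep : ∀ z ∈ sh \ U, rtCell z ∈ sh \ U → z ≠ c → w (rtCell z) + 1 ≤ w z := by
    intro z hz hz' hzc
    rw [wo z hzc]
    by_cases hzc' : rtCell z = c
    · have := hxL z hz hzc'
      rw [hzc', wc, ← hzc']
      simp only [rtCell]
      push_cast
      omega
    · have := h.order.rt z ⟨hz, hzc⟩ ⟨hz', hzc'⟩
      rw [wo _ hzc']
      simp only [rtCell] at this ⊢
      push_cast
      omega
  have hrt : ∀ z ∈ sh \ U, rtCell z ∈ sh \ U → w (rtCell z) ≤ w z := by
    intro z hz hz'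
    by_cases hzc : z = c
    · subst hzc
      have := hx1 hz'.1
      rw [wc, wo _ (rtCell_ne z)]
      simp only [rtCell] at this ⊢
      push_cast
      omega
    · have := hstep z hz hz' hzc
      omega
  have hup : ∀ z ∈ sh \ U, upCell z ∈ sh \ U → w (upCell z) ≤ w z := by
    intro z hz hz'
    by_cases hzc : z = c
    · subst hzc
      have := hx2 hz'.1
      rw [wc, wo _ (upCell_ne z)]
      simp only [upCell] at this ⊢
      push_cast
      omega
    · rw [wo z hzc]
      by_cases hzc' : upCell z = c
      · have := hxB z hz hzc'
        rw [hzc', wc, ← hzc']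
        simp only [upCell]
        push_cast
        omega
      · have := h.order.up z ⟨hz, hzc⟩ ⟨hz', hzc'⟩
        rw [wo _ hzc']
        simp only [upCell] at this ⊢
        push_cast
        omega
  intro p q k l hp hq hpq
  have hne : ∀ {z s}, T z = some (MEntry.be s) → z ≠ c := by
    rintro z s hz rfl
    simp [h.cur] at hz
  have hpV : p ∈ sh \ U := ⟨h.mem_of_some hp, h.not_mem_of_be hp⟩
  have hqV : q ∈ sh \ U := ⟨h.mem_of_some hq, h.not_mem_of_be hq⟩
  have hwp : w p = k + θ := by rw [wo p (hne hp), cellVal_be hp]; ring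
  have hwq : w q = l + θ := by rw [wo q (hne hq), cellVal_be hq]; ring
  have h1 := antitone_of_adjacent hV hrt hup hpV hqV hpq
  refine ⟨by omega, fun h2 h3 => ?_⟩
  have h4 : p.2 < q.2 := lt_of_le_of_ne hpq.2 fun e => h3 (Prod.ext h2 e)
  have h5 : rtCell p ≤ q := ⟨h2.le, h4⟩
  have h6 : rtCell p ∈ sh \ U := hV.out hpV hqV ⟨le_rtCell p, h5⟩
  have h7 := hstep p hpV h6 (hne hp)
  have h8 := antitone_of_adjacent hV hrt hup h6 hqV h5
  omega

end Validity

/-! ### Passing between sliding states -/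

section Rounds

variable {θ r : ℤ} {sh U : Set Cell} {T : MixedTableau} {c : Cell}

theorem InOrderOn.val_add_row_le {V : Set Cell} (h : InOrderOn θ T V) (hV : V.OrdConnected)
    {p q : Cell} (hp : p ∈ V) (hq : q ∈ V) (hpq : p ≤ q) :
    cellVal θ T q + q.1 ≤ cellVal θ T p + p.1 := by
  refine antitone_of_adjacent hV (f := fun z => cellVal θ T z + z.1) ?_ ?_ hp hq hpq
  · intro z hz hz'
    have := h.rt z hz hz'
    simp only [rtCell] at this ⊢
    omega
  · intro z hz hz'
    have := h.up z hz hz'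
    simp only [upCell] at this ⊢
    push_cast
    omega

theorem rightMove_or_upMove_iff : (RightMove θ r T c ∨ UpMove θ r T c) ↔
    (∃ s, T (rtCell c) = some (MEntry.be s) ∧ r < cellVal θ T (rtCell c)) ∨
      ∃ t, T (upCell c) = some (MEntry.be t) ∧ r ≤ cellVal θ T (upCell c) := by
  constructor
  · rintro (⟨s, h1, h2, -⟩ | ⟨t, h1, h2, -⟩)
    · exact Or.inl ⟨s, h1, h2⟩
    · exact Or.inr ⟨t, h1, h2⟩
  · intro h
    by_cases hs : ∃ s, T (rtCell c) = some (MEntry.be s) ∧ r < cellVal θ T (rtCell c)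
    · obtain ⟨s, hs1, hs2⟩ := hs
      by_cases ht : ∃ t, T (upCell c) = some (MEntry.be t) ∧ r ≤ cellVal θ T (upCell c)
      · obtain ⟨t, ht1, ht2⟩ := ht
        rcases le_or_gt t s with hst | hst
        · refine Or.inl ⟨s, hs1, hs2, fun t' ht' _ => ?_⟩
          rw [ht1] at ht'
          simp only [Option.some.injEq, MEntry.be.injEq] at ht'
          omega
        · refine Or.inr ⟨t, ht1, ht2, fun s' hs' _ => ?_⟩
          rw [hs1] at hs'
          simp only [Option.some.injEq, MEntry.be.injEq] at hs'
          omega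
      · exact Or.inl ⟨s, hs1, hs2, fun t ht1 ht2 => absurd ⟨t, ht1, ht2⟩ ht⟩
    · obtain ⟨t, ht1, ht2⟩ := h.resolve_left hs
      exact Or.inr ⟨t, ht1, ht2, fun s hs1 hs2 => absurd ⟨s, hs1, hs2⟩ hs⟩

theorem Moving.finish (hsh : sh.OrdConnected) (h : Moving θ sh T U c r)
    (hm : ¬ (RightMove θ r T c ∨ UpMove θ r T c)) : Idle θ sh T U := by
  rw [rightMove_or_upMove_iff] at hm
  have hvc := cellVal_al (θ := θ) h.cur
  have hR : rtCell c ∈ sh → cellVal θ T (rtCell c) ≤ r := by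
    intro h1
    rcases h.entry h1 with ⟨k, hk⟩ | ⟨s, hs⟩
    · rw [cellVal_al hk]
      exact h.small _ _ hk h.rt_not_mem
    · by_contra h2
      exact hm (Or.inl ⟨s, hs, not_le.1 h2⟩)
  have hU : upCell c ∈ sh → cellVal θ T (upCell c) + 1 ≤ r := by
    intro h1
    rcases h.entry h1 with ⟨k, hk⟩ | ⟨s, hs⟩
    · rw [cellVal_al hk]
      exact h.up_alpha_lt hk
    · by_contra h2
      exact hm (Or.inr ⟨s, hs, by omega⟩)
  have hord : InOrderOn θ T (sh \ U) := by
    constructor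
    · intro p hp hp'
      by_cases hpc : p = c
      · subst hpc
        rw [hvc]
        exact hR hp'.1
      · by_cases hpc' : rtCell p = c
        · rw [hpc', hvc]
          exact (h.holeLeft p hp hpc').1
        · exact h.order.rt p ⟨hp, hpc⟩ ⟨hp', hpc'⟩
    · intro p hp hp'
      by_cases hpc : p = c
      · subst hpc
        rw [hvc]
        exact hU hp'.1
      · by_cases hpc' : upCell p = c
        · rw [hpc', hvc]
          exact (h.holeBelow p hp hpc').1
        · exact h.order.up p ⟨hp, hpc⟩ ⟨hp', hpc'⟩
  refine { toAlphaRegion := h.toAlphaRegion, order := hord, small := ?_, barrier := ?_ }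
  · intro u hu p k hp hpU
    exact (h.small p k hp hpU).trans (h.large u hu).1
  · intro u hu
    rcases (h.large u hu).1.lt_or_eq with hlt | heq
    · refine ⟨Set.univ, trivial, fun _ _ => trivial, fun p hp hpU => ?_,
        fun q _ _ _ hq => absurd trivial hq⟩
      have := h.small p _ hp hpU
      omega
    · obtain ⟨S, hS⟩ := h.next
      refine ⟨S, hS.mem u hu heq.symm, hS.up, ?_, ?_⟩
      · intro p hp hpU _ q hq
        rw [← heq] at hp
        have h1 := hS.col q hq
        by_cases hpc : p = c
        · rwa [hpc]
        · exact h1.trans (h.sep hp hpU hpc)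
      · intro q hq _ hqsh hrt hup hmv
        rw [← heq] at hmv
        rcases hS.frontier q hq hqsh hrt hup with h1 | ⟨h1, h2⟩
        · exact h1 hmv
        · obtain ⟨s, hs, hrs, -⟩ := hmv
          have hle : c ≤ rtCell q := ⟨h1, h2.ge⟩
          have h3 := hord.val_add_row_le (h.ordConnected_diff hsh)
            ⟨h.mem_shape, h.notMem⟩ ⟨h.mem_of_some hs, h.not_mem_of_be hs⟩ hle
          rw [hvc] at h3
          simp only [rtCell_fst] at h3
          omega

theorem Idle.start (hsh : sh.OrdConnected) (h : Idle θ sh T U) (hfin : U.Finite)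
    (hne : U.Nonempty) : ∃ u ∈ U, Moving θ sh T (U \ {u}) u (cellVal θ T u) := by
  obtain ⟨u, hu, hmin⟩ := Set.exists_min_image U
    (fun v => toLex (cellVal θ T v, -(v.2 : ℤ))) hfin hne
  have hmin' : ∀ v ∈ U, cellVal θ T u ≤ cellVal θ T v ∧
      (cellVal θ T v = cellVal θ T u → v.2 ≤ u.2) := by
    intro v hv
    have := hmin v hv
    simp only [Prod.Lex.toLex_le_toLex] at this
    omega
  have hush : u ∈ sh := by
    obtain ⟨k, hk⟩ := h.alpha u hu
    exact h.mem_of_some hk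
  have hlow : ∀ v ∈ U, v ≠ u → ¬ u ≤ v := by
    intro v hv hvu hle
    have h1 := h.anti u hu v hv hle
    have h2 := hmin' v hv
    have h3 := hle.2
    have h4 : u.2 = v.2 := by omega
    have h5 : u.1 < v.1 := lt_of_le_of_ne hle.1 fun e => hvu (Prod.ext e.symm h4.symm)
    have := h.strict u hu v hv h4 h5
    omega
  have hlarge : ∀ v ∈ U \ {u}, cellVal θ T u ≤ cellVal θ T v ∧
      (cellVal θ T v = cellVal θ T u → v.2 < u.2) := by
    rintro v ⟨hv, hvu⟩
    have h1 := hmin' v hv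
    refine ⟨h1.1, fun h2 => lt_of_le_of_ne (h1.2 h2) fun h3 => ?_⟩
    rcases lt_trichotomy u.1 v.1 with h4 | h4 | h4
    · have := h.strict u hu v hv h3.symm h4
      omega
    · exact hvu (Prod.ext h4.symm h3)
    · have := h.strict v hv u hu h3 h4
      omega
  have hset : (sh \ (U \ {u})) \ {u} = sh \ U := by
    ext z
    simp only [Set.mem_sdiff, Set.mem_singleton_iff]
    constructor
    · tauto
    · rintro ⟨h1, h2⟩
      exact ⟨⟨h1, fun h3 => h2 h3.1⟩, fun e => h2 (e ▸ hu)⟩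
  have hvac : ∀ p ∈ sh \ (U \ {u}), p ≠ u → ¬ p ≤ u := fun p hp hpu hle =>
    hp.2 ⟨h.lower u hu p hp.1 hle, hpu⟩
  have hout : ∀ p, p ∉ U \ {u} → p ≠ u → p ∉ U := fun p hp hpu hpU => hp ⟨hpU, hpu⟩
  refine ⟨u, hu, {
    shape := h.shape
    alpha := fun v hv => h.alpha v hv.1
    lower := fun v hv p hp hpv => ⟨h.lower v hv.1 p hp hpv, fun e => by
      rw [Set.mem_singleton_iff] at e
      exact hlow v hv.1 hv.2 (e ▸ hpv)⟩
    anti := fun v hv w hw => h.anti v hv.1 w hw.1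
    strict := fun v hv w hw => h.strict v hv.1 w hw.1
    cur := ?_
    notMem := fun hu' => hu'.2 rfl
    large := hlarge
    small := ?_
    order := hset.symm ▸ h.order
    holeLeft := fun p hp e => absurd (e ▸ le_rtCell p)
      (hvac p hp fun e' => rtCell_ne p (e.trans e'.symm))
    holeBelow := fun p hp e => absurd (e ▸ le_upCell p)
      (hvac p hp fun e' => upCell_ne p (e.trans e'.symm))
    barrier := ?_
    next := ?_ }⟩
  · obtain ⟨k, hk⟩ := h.alpha u hu
    rw [hk, cellVal_al hk]
  · intro p k hp hpU
    by_cases hpu : p = u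
    · rw [← hpu, cellVal_al hp]
    · exact h.small u hu p k hp (hout p hpU hpu)
  · obtain ⟨S, hS⟩ := h.barrier u hu
    refine ⟨S, hS.mem, hS.up, fun p hp hpU hpu => hS.sep p hp (hout p hpU hpu) hpu,
      fun q hq huq hqsh hrt hup => hS.frontier q hq huq hqsh hrt (hout _ hup fun e => ?_)⟩
    have := huq.1
    rw [← e] at this
    simp [upCell] at this
  · refine ⟨{q | u.1 ≤ q.1 ∧ q.2 < u.2}, fun q hq => hq.2,
      fun q hq => ⟨hq.1.trans (le_upCell q).1, hq.2⟩, fun v hv hvu => ?_,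
      fun q hq _ hrt _ => Or.inr ⟨hq.1, ?_⟩⟩
    · have h1 := (hlarge v hv).2 hvu
      refine ⟨?_, h1⟩
      by_contra h2
      have h3 : v ≤ (u.1, v.2) := ⟨by simp only; omega, le_rfl⟩
      have h4 : ((u.1, v.2) : Cell) ≤ u := ⟨le_rfl, h1.le⟩
      obtain ⟨k, hk⟩ := h.alpha v hv.1
      have h5 := h.lower u hu _ (hsh.out (h.mem_of_some hk) hush ⟨h3, h4⟩) h4
      have h6 := h.strict v hv.1 _ h5 rfl (by simp only; omega)
      have h7 := h.anti _ h5 u hu h4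
      omega
    · have h1 := hq.1
      have h2 := hq.2
      simp only [rtCell, Set.mem_ofPred_eq, not_and, not_lt] at hrt
      have := hrt h1
      omega

/-- If not everything is treated and in order, some sliding state has a pending move. -/
theorem Idle.advance (hsh : sh.OrdConnected) (hfin : U.Finite) (h : Idle θ sh T U) :
    Idle θ sh T ∅ ∨ ∃ (V : Set Cell) (c : Cell) (r : ℤ), V.Finite ∧ Moving θ sh T V c r ∧
      (RightMove θ r T c ∨ UpMove θ r T c) := by
  induction hn : U.ncard generalizing U with
  | zero =>
    rw [Set.ncard_eq_zero hfin] at hn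
    exact Or.inl (hn ▸ h)
  | succ n ih =>
    obtain ⟨u, hu, hM⟩ := h.start hsh hfin
      (Set.nonempty_of_ncard_ne_zero (by omega))
    have hfin' : (U \ {u}).Finite := hfin.sdiff
    by_cases hm : RightMove θ (cellVal θ T u) T u ∨ UpMove θ (cellVal θ T u) T u
    · exact Or.inr ⟨_, _, _, hfin', hM, hm⟩
    · refine ih hfin' (hM.finish hsh hm) ?_
      rw [Set.ncard_sdiff_singleton_of_mem hu]
      omega

theorem not_move_of_order {V : Set Cell} (hV : InOrderOn θ T V) {p : Cell} {k : ℤ}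
    (hp : T p = some (MEntry.al k)) (hpV : p ∈ V)
    (hb : ∀ q s, T q = some (MEntry.be s) → q ∈ V) :
    ¬ (RightMove θ k T p ∨ UpMove θ k T p) := by
  have hv := cellVal_al (θ := θ) hp
  rintro (⟨s, h1, h2, -⟩ | ⟨t, h1, h2, -⟩)
  · have := hV.rt p hpV (hb _ s h1)
    omega
  · have := hV.up p hpV (hb _ t h1)
    omega

theorem Idle.not_move (h : Idle θ sh T ∅) {p : Cell} {k : ℤ}
    (hp : T p = some (MEntry.al k)) : ¬ (RightMove θ k T p ∨ UpMove θ k T p) :=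
  not_move_of_order h.order hp ⟨h.mem_of_some hp, fun e => e⟩
    fun _ _ hq => ⟨h.mem_of_some hq, fun e => e⟩

/-- The smallest and then rightmost entry that is out of order is the sliding one. -/
theorem Moving.eq_of_chosen (h : Moving θ sh T U c r) {p : Cell} {k : ℤ}
    (hp : T p = some (MEntry.al k)) (hm : RightMove θ k T p ∨ UpMove θ k T p)
    (hk : k ≤ r) (hcol : k = r → c.2 ≤ p.2) : p = c := by
  by_contra hpc
  by_cases hpU : p ∈ U
  · have h1 := h.large p hpU
    rw [cellVal_al hp] at h1
    have h2 : k = r := by omega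
    have := hcol h2
    have := h1.2 h2
    omega
  · refine not_move_of_order h.order hp ⟨⟨h.mem_of_some hp, hpU⟩, hpc⟩ (fun q s hq => ?_) hm
    refine ⟨⟨h.mem_of_some hq, h.not_mem_of_be hq⟩, ?_⟩
    rintro rfl
    simp [h.cur] at hq

theorem Moving.switch_right (hsh : sh.OrdConnected) (h : Moving θ sh T U c r)
    (hm : RightMove θ r T c) : Switch T (swapCells T c (rtCell c)) := by
  have h' := h.slide_right hsh hm
  obtain ⟨s, hs, -⟩ := hm
  exact ⟨h.alphaColumnStrict hsh, h.betaRowStrict hsh, c, _, Or.inl rfl, ⟨r, h.cur⟩, ⟨s, hs⟩,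
    rfl, h'.alphaColumnStrict hsh, h'.betaRowStrict hsh⟩

theorem Moving.switch_up (hsh : sh.OrdConnected) (h : Moving θ sh T U c r)
    (hm : UpMove θ r T c) : Switch T (swapCells T c (upCell c)) := by
  have h' := h.slide_up hsh hm
  obtain ⟨s, hs, -⟩ := hm
  exact ⟨h.alphaColumnStrict hsh, h.betaRowStrict hsh, c, _, Or.inr rfl, ⟨r, h.cur⟩, ⟨s, hs⟩,
    rfl, h'.alphaColumnStrict hsh, h'.betaRowStrict hsh⟩

end Rounds

theorem IsPartitionShape.ordConnected_diff {lam mu : Set Cell} (hl : IsPartitionShape lam)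
    (hm : IsPartitionShape mu) : (mu \ lam).OrdConnected := by
  refine ⟨fun p hp q hq z hz => ⟨?_, fun hzl => hp.2 ?_⟩⟩
  · have h1 := hm.2.1 p hp.1
    exact hm.2.2 q.1 q.2 z.1 z.2 hq.1 (h1.1.trans hz.1.1) hz.2.1 (h1.2.trans hz.1.2) hz.2.2
  · have h1 := hm.2.1 p hp.1
    exact hl.2.2 z.1 z.2 p.1 p.2 hzl h1.1 hz.1.1 h1.2 hz.1.2

/-- Initially, no `α`-entry has been treated. -/
theorem idle_of_sorted {lam mu : Set Cell} {Q : MixedTableau} (θ : ℤ)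
    (hQ : HasSkewShape Q lam mu) (hα : AlphaColumnStrict Q) (hβ : BetaRowStrict Q)
    (hs : ABSortedShape Q lam mu) : Idle θ (mu \ lam) Q (alphaCells Q) := by
  obtain ⟨hl, hm, hlm, hsh⟩ := hQ
  obtain ⟨nu, hnu, hlnu, hnumu, hA, hB⟩ := hs
  rw [alphaColumnStrict_iff_s14] at hα
  rw [betaRowStrict_iff_s14] at hβ
  have hbe : ∀ p ∈ (mu \ lam) \ alphaCells Q, ∃ s, Q p = some (MEntry.be s) := by
    rintro p ⟨hp, hpA⟩
    have : p ∈ betaCells Q := by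
      rw [hB]
      rw [hA] at hpA
      exact ⟨hp.1, fun h => hpA ⟨h, hp.2⟩⟩
    exact this
  refine {
    shape := fun p => by rw [← hsh]; rfl
    alpha := fun u hu => hu
    lower := ?_
    anti := ?_
    strict := ?_
    order := ⟨?_, ?_⟩
    small := fun u _ p k hp hpU => absurd ⟨k, hp⟩ hpU
    barrier := fun u _ => ⟨Set.univ, trivial, fun _ _ => trivial,
      fun p hp hpU => absurd ⟨_, hp⟩ hpU, fun q _ _ _ hq => absurd trivial hq⟩ }
  · intro u hu p hp hpu
    rw [hA] at hu ⊢
    have h1 := hm.2.1 p hp.1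
    exact ⟨hnu.2.2 u.1 u.2 p.1 p.2 hu.1 h1.1 hpu.1 h1.2 hpu.2, hp.2⟩
  · rintro u ⟨k, hk⟩ v ⟨l, hl⟩ huv
    rw [cellVal_al hk, cellVal_al hl]
    exact (hα u v k l hk hl huv).1
  · rintro u ⟨k, hk⟩ v ⟨l, hl⟩ h2 h1
    rw [cellVal_al hk, cellVal_al hl]
    exact (hα u v k l hk hl ⟨h1.le, h2.le⟩).2 h2 fun e => by simp [e] at h1
  · intro p hp hp'
    obtain ⟨k, hk⟩ := hbe p hp
    obtain ⟨l, hl⟩ := hbe _ hp'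
    have := (hβ _ _ k l hk hl (le_rtCell p)).2 rfl (rtCell_ne p).symm
    rw [cellVal_be hk, cellVal_be hl]
    simp only [rtCell]
    push_cast
    omega
  · intro p hp hp'
    obtain ⟨k, hk⟩ := hbe p hp
    obtain ⟨l, hl⟩ := hbe _ hp'
    have := (hβ _ _ k l hk hl (le_upCell p)).1
    rw [cellVal_be hk, cellVal_be hl]
    simp only [upCell]
    push_cast
    omega

/-! ### The GG-jdt map as a sequence of switches -/

theorem cellVal_zero_rt {T : MixedTableau} {c : Cell} {s : ℤ}
    (hs : T (rtCell c) = some (MEntry.be s)) :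
    cellVal 0 T (rtCell c) = s + ((c.2 : ℤ) + 1) - (c.1 : ℤ) := by
  rw [cellVal_be hs, rtCell_fst, rtCell_snd]
  push_cast
  ring

theorem cellVal_zero_up {T : MixedTableau} {c : Cell} {s : ℤ}
    (hs : T (upCell c) = some (MEntry.be s)) :
    cellVal 0 T (upCell c) = s + (c.2 : ℤ) - ((c.1 : ℤ) + 1) := by
  rw [cellVal_be hs, upCell_fst, upCell_snd]
  push_cast
  ring

theorem outOfOrderH_iff {T : MixedTableau} {c : Cell} {r : ℤ} (hr : T c = some (MEntry.al r)) :
    OutOfOrderH T c ↔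
      ∃ s, T (rtCell c) = some (MEntry.be s) ∧ r < cellVal 0 T (rtCell c) := by
  constructor
  · rintro ⟨r', s, h1, h2, h3⟩
    have : r' = r := by simpa [hr] using h1.symm
    subst this
    exact ⟨s, h2, by rwa [cellVal_zero_rt h2]⟩
  · rintro ⟨s, h2, h3⟩
    exact ⟨r, s, hr, h2, by rwa [cellVal_zero_rt h2] at h3⟩

theorem outOfOrderV_iff {T : MixedTableau} {c : Cell} {r : ℤ} (hr : T c = some (MEntry.al r)) :
    OutOfOrderV T c ↔
      ∃ t, T (upCell c) = some (MEntry.be t) ∧ r ≤ cellVal 0 T (upCell c) := by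
  constructor
  · rintro ⟨r', s, h1, h2, h3⟩
    have : r' = r := by simpa [hr] using h1.symm
    subst this
    exact ⟨s, h2, by rwa [cellVal_zero_up h2]⟩
  · rintro ⟨s, h2, h3⟩
    exact ⟨r, s, hr, h2, by rwa [cellVal_zero_up h2] at h3⟩

theorem outOfOrder_iff {T : MixedTableau} {c : Cell} {r : ℤ} (hr : T c = some (MEntry.al r)) :
    OutOfOrder T c ↔ (RightMove 0 r T c ∨ UpMove 0 r T c) := by
  rw [rightMove_or_upMove_iff, OutOfOrder, outOfOrderH_iff hr, outOfOrderV_iff hr]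

theorem GGSlide.move {T T' : MixedTableau} {c : Cell} {r : ℤ}
    (hr : T c = some (MEntry.al r)) (h : GGSlide T c T') :
    (RightMove 0 r T c ∧ T' = swapCells T c (rtCell c)) ∨
      (UpMove 0 r T c ∧ T' = swapCells T c (upCell c)) := by
  rw [GGSlide, outOfOrderH_iff hr, outOfOrderV_iff hr] at h
  rcases h with ⟨⟨s, h1, h2⟩, h3, h4⟩ | ⟨⟨s, h1, h2⟩, h3, h4⟩ |
    ⟨⟨s, h1, h2⟩, ⟨t, h3, h4⟩, s', t', h5, h6, ⟨h7, h8⟩ | ⟨h7, h8⟩⟩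
  · exact Or.inl ⟨⟨s, h1, h2, fun t h5 h6 => absurd ⟨t, h5, h6⟩ h3⟩, h4⟩
  · exact Or.inr ⟨⟨s, h1, h2, fun t h5 h6 => absurd ⟨t, h5, h6⟩ h3⟩, h4⟩
  · refine Or.inl ⟨⟨s', h5, h2, fun t h9 _ => ?_⟩, h8⟩
    rw [h6] at h9
    simp only [Option.some.injEq, MEntry.be.injEq] at h9
    omega
  · refine Or.inr ⟨⟨t', h6, h4, fun t h9 _ => ?_⟩, h8⟩
    rw [h5] at h9
    simp only [Option.some.injEq, MEntry.be.injEq] at h9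
    omega

/-- `T` is a state between two rounds of sliding or within one. -/
def SlideState (θ : ℤ) (sh : Set Cell) (T : MixedTableau) : Prop :=
  (∃ U : Set Cell, U.Finite ∧ Idle θ sh T U) ∨
    ∃ (U : Set Cell) (c : Cell) (r : ℤ), U.Finite ∧ Moving θ sh T U c r

theorem SlideState.advance {θ : ℤ} {sh : Set Cell} {T : MixedTableau} (hsh : sh.OrdConnected)
    (h : SlideState θ sh T) :
    Idle θ sh T ∅ ∨ ∃ (V : Set Cell) (c : Cell) (r : ℤ), V.Finite ∧ Moving θ sh T V c r ∧
      (RightMove θ r T c ∨ UpMove θ r T c) := by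
  rcases h with ⟨U, hU, h⟩ | ⟨U, c, r, hU, h⟩
  · exact h.advance hsh hU
  · by_cases hm : RightMove θ r T c ∨ UpMove θ r T c
    · exact Or.inr ⟨U, c, r, hU, h, hm⟩
    · exact (h.finish hsh hm).advance hsh hU

theorem SlideState.ggStep {sh : Set Cell} {T T' : MixedTableau} (hsh : sh.OrdConnected)
    (h : SlideState 0 sh T) (hT : GGStep T T') : SlideState 0 sh T' ∧ Switch T T' := by
  obtain ⟨p, ⟨k, hk, hout, hmin, hcol⟩, hsl⟩ := hT
  rw [outOfOrder_iff hk] at hout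
  rcases h.advance hsh with h0 | ⟨V, c, r, hV, hM, hm⟩
  · exact absurd hout (h0.not_move hk)
  · have hoc := (outOfOrder_iff hM.cur).2 hm
    have hpc : p = c := by
      refine hM.eq_of_chosen hk hout (hmin c r hM.cur hoc) fun e => ?_
      subst e
      exact hcol c hM.cur hoc
    subst hpc
    rcases hsl.move hM.cur with ⟨h1, rfl⟩ | ⟨h1, rfl⟩
    · exact ⟨Or.inr ⟨V, _, r, hV, hM.slide_right hsh h1⟩, hM.switch_right hsh h1⟩
    · exact ⟨Or.inr ⟨V, _, r, hV, hM.slide_up hsh h1⟩, hM.switch_up hsh h1⟩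

theorem SlideState.ggSteps {sh : Set Cell} {Q T : MixedTableau} (hsh : sh.OrdConnected)
    (h : SlideState 0 sh Q) (hT : Relation.ReflTransGen GGStep Q T) :
    SlideState 0 sh T ∧ Relation.ReflTransGen Switch Q T := by
  induction hT with
  | refl => exact ⟨h, .refl⟩
  | tail _ hstep ih =>
    have := ih.1.ggStep hsh hstep
    exact ⟨this.1, ih.2.tail this.2⟩

theorem SlideState.idle_of_ordered {sh : Set Cell} {T : MixedTableau} (hsh : sh.OrdConnected)
    (h : SlideState 0 sh T) (hT : ∀ c, ¬ OutOfOrder T c) : Idle 0 sh T ∅ := by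
  rcases h.advance hsh with h0 | ⟨V, c, r, hV, hM, hm⟩
  · exact h0
  · exact absurd ((outOfOrder_iff hM.cur).2 hm) (hT c)

theorem Idle.totallyColumnStrict {sh : Set Cell} {T : MixedTableau} (h : Idle 0 sh T ∅) :
    TotallyColumnStrict (cBetaPlus T) := by
  have key : ∀ c e, cBetaPlus T c = some e → c ∈ sh \ ∅ ∧ e.idx = cellVal 0 T c := by
    intro c e he
    unfold cBetaPlus at he
    match hT : T c with
    | none => simp [hT] at he
    | some (.al k) =>
      simp only [hT, Option.some.injEq] at he
      subst he
      exact ⟨⟨h.mem_of_some hT, fun e => e⟩, by rw [cellVal_al hT]; rfl⟩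
    | some (.be k) =>
      simp only [hT, Option.some.injEq] at he
      subst he
      exact ⟨⟨h.mem_of_some hT, fun e => e⟩, by rw [cellVal_be hT]; simp [MEntry.idx]⟩
  constructor
  · intro c e e' h1 h2
    have := h.order.up c (key _ _ h1).1 (key _ _ h2).1
    rw [(key _ _ h1).2, (key _ _ h2).2]
    omega
  · intro c e e' h1 h2
    have := h.order.rt c (key _ _ h1).1 (key _ _ h2).1
    rwa [(key _ _ h1).2, (key _ _ h2).2]

/-! ### The shuffle as a sequence of switches -/

/-- The shift `θ` is so large that every `β` adjacent to an `α` exceeds it in value. -/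
def ShiftBound (θ : ℤ) (sh : Set Cell) (T : MixedTableau) : Prop :=
  ∀ p q z r s, T p = some (MEntry.al r) → T q = some (MEntry.be s) → z ∈ sh →
    r + (z.1 : ℤ) < s + θ

theorem swapCells_eq_exists (T : MixedTableau) (c d p : Cell) :
    ∃ q, swapCells T c d p = T q := by
  by_cases h1 : p = d
  · exact ⟨c, by rw [h1, swapCells_right]⟩
  · by_cases h2 : p = c
    · exact ⟨d, by rw [h2, swapCells_left]⟩
    · exact ⟨p, swapCells_of_ne_s14 h2 h1⟩

theorem ShiftBound.swap {θ : ℤ} {sh : Set Cell} {T : MixedTableau} (h : ShiftBound θ sh T)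
    (c d : Cell) : ShiftBound θ sh (swapCells T c d) := by
  intro p q z r s hp hq hz
  obtain ⟨p', hp'⟩ := swapCells_eq_exists T c d p
  obtain ⟨q', hq'⟩ := swapCells_eq_exists T c d q
  exact h p' q' z r s (hp' ▸ hp) (hq' ▸ hq) hz

theorem exists_shiftBound {sh : Set Cell} {T : MixedTableau} (hfin : sh.Finite)
    (hT : ∀ p, T p ≠ none → p ∈ sh) : ∃ θ, ShiftBound θ sh T := by
  obtain ⟨N, hN⟩ := (hfin.image fun p => |((T p).elim 0 MEntry.idx : ℤ)| + (p.1 : ℤ)).bddAbove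
  have hN' : ∀ p ∈ sh, |((T p).elim 0 MEntry.idx : ℤ)| + (p.1 : ℤ) ≤ N := fun p hp =>
    hN (Set.mem_image_of_mem _ hp)
  refine ⟨3 * N + 1, fun p q z r s hp hq hz => ?_⟩
  have h1 := hN' p (hT p (by simp [hp]))
  have h2 := hN' q (hT q (by simp [hq]))
  have h3 := hN' z hz
  simp only [hp, hq, Option.elim, MEntry.idx] at h1 h2
  have := le_abs_self r
  have := neg_abs_le s
  have := abs_nonneg ((T z).elim 0 MEntry.idx : ℤ)
  omega

theorem ShiftBound.lt {θ : ℤ} {sh : Set Cell} {T : MixedTableau} (h : ShiftBound θ sh T)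
    {p q : Cell} {r s : ℤ} (hp : T p = some (MEntry.al r)) (hq : T q = some (MEntry.be s))
    (hqs : q ∈ sh) : r < cellVal θ T q := by
  have := h p q q r s hp hq hqs
  rw [cellVal_be hq]
  omega

section Shuffle

variable {θ r : ℤ} {sh U : Set Cell} {T : MixedTableau} {c : Cell}

theorem AlphaRegion.shuffPending_iff (h : AlphaRegion θ sh T U) (hb : ShiftBound θ sh T)
    (hr : T c = some (MEntry.al r)) :
    ShuffPending T c ↔ (RightMove θ r T c ∨ UpMove θ r T c) := by
  rw [rightMove_or_upMove_iff]
  constructor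
  · rintro ⟨-, ⟨s, hs⟩ | ⟨s, hs⟩⟩
    · exact Or.inr ⟨s, hs, (hb.lt hr hs (h.mem_of_some hs)).le⟩
    · exact Or.inl ⟨s, hs, hb.lt hr hs (h.mem_of_some hs)⟩
  · rintro (⟨s, hs, -⟩ | ⟨s, hs, -⟩)
    · exact ⟨⟨r, hr⟩, Or.inr ⟨s, hs⟩⟩
    · exact ⟨⟨r, hr⟩, Or.inl ⟨s, hs⟩⟩

theorem Moving.shuffMove (h : Moving θ sh T U c r) (hb : ShiftBound θ sh T) {d : Cell}
    {T' : MixedTableau} (hm : ShuffMoveTo T c d T') :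
    T' = swapCells T c d ∧
      ((RightMove θ r T c ∧ d = rtCell c) ∨ (UpMove θ r T c ∧ d = upCell c)) := by
  obtain ⟨-, h1, h2⟩ := hm
  refine ⟨h1, ?_⟩
  rcases h2 with ⟨⟨s, hs⟩, h3, h4⟩ | ⟨⟨s, hs⟩, h3, h4⟩ | ⟨k, j, hk, hj, h3⟩
  · exact Or.inl ⟨⟨s, hs, hb.lt h.cur hs (h.mem_of_some hs), fun t ht _ => absurd ⟨t, ht⟩ h3⟩, h4⟩
  · exact Or.inr ⟨⟨s, hs, (hb.lt h.cur hs (h.mem_of_some hs)).le,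
      fun t ht _ => absurd ⟨t, ht⟩ h3⟩, h4⟩
  · rcases h3 with ⟨h3, h4⟩ | ⟨h3, h4⟩
    · refine Or.inr ⟨⟨k, hk, (hb.lt h.cur hk (h.mem_of_some hk)).le, fun t ht _ => ?_⟩, h4⟩
      rw [hj] at ht
      simp only [Option.some.injEq, MEntry.be.injEq] at ht
      omega
    · refine Or.inl ⟨⟨j, hj, hb.lt h.cur hj (h.mem_of_some hj), fun t ht _ => ?_⟩, h4⟩
      rw [hk] at ht
      simp only [Option.some.injEq, MEntry.be.injEq] at ht
      omega

theorem Moving.shuffTrack (hsh : sh.OrdConnected) {R : MixedTableau} (hR : ShuffTrack T c R)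
    (h : Moving θ sh T U c r) (hb : ShiftBound θ sh T) :
    Idle θ sh R U ∧ ShiftBound θ sh R ∧ Relation.ReflTransGen Switch T R := by
  induction hR with
  | done T c hset =>
    refine ⟨h.finish hsh fun hm => ?_, hb, .refl⟩
    rcases ((h.shuffPending_iff hb h.cur).2 hm).2 with h1 | h1
    · exact hset.1 h1
    · exact hset.2 h1
  | step T c d T' R hmv _ ih =>
    obtain ⟨rfl, ⟨hm, rfl⟩ | ⟨hm, rfl⟩⟩ := h.shuffMove hb hmv
    · obtain ⟨h1, h2, h3⟩ := ih (h.slide_right hsh hm) (hb.swap _ _)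
      exact ⟨h1, h2, h3.head (h.switch_right hsh hm)⟩
    · obtain ⟨h1, h2, h3⟩ := ih (h.slide_up hsh hm) (hb.swap _ _)
      exact ⟨h1, h2, h3.head (h.switch_up hsh hm)⟩

theorem ShuffRel.switches (hsh : sh.OrdConnected) {R : MixedTableau} (hR : ShuffRel T R)
    (h : ∃ U : Set Cell, U.Finite ∧ Idle θ sh T U) (hb : ShiftBound θ sh T) :
    Relation.ReflTransGen Switch T R ∧ ∀ c, ¬ ShuffPending R c := by
  induction hR with
  | done T hT => exact ⟨.refl, hT⟩
  | step T p T' R hch htr _ ih =>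
    obtain ⟨hpend, k, hk, hmin, hcol⟩ := hch
    obtain ⟨U, hU, h⟩ := h
    have hout := (h.shuffPending_iff hb hk).1 hpend
    rcases h.advance hsh hU with h0 | ⟨V, c, r, hV, hM, hm⟩
    · exact absurd hout (h0.not_move hk)
    · have hoc := (hM.shuffPending_iff hb hM.cur).2 hm
      have hpc : p = c := by
        refine hM.eq_of_chosen hk hout (hmin c r hoc hM.cur) fun e => ?_
        subst e
        exact hcol c hoc hM.cur
      subst hpc
      obtain ⟨h1, h2, h3⟩ := hM.shuffTrack hsh htr hb
      obtain ⟨h4, h5⟩ := ih ⟨V, hV, h1⟩ h2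
      exact ⟨h3.trans h4, h5⟩

end Shuffle

/-! ### Confluence of switching -/

section Confluence

variable {T T₁ T₂ : MixedTableau} {c₁ d₁ c₂ d₂ : Cell}

theorem le_of_adjacent {c d : Cell} (h : d = rtCell c ∨ d = upCell c) : c ≤ d := by
  rcases h with rfl | rfl
  · exact le_rtCell c
  · exact le_upCell c

theorem alpha_pair_of_switches {r₁ r₂ : ℤ} (had₁ : d₁ = rtCell c₁ ∨ d₁ = upCell c₁)
    (had₂ : d₂ = rtCell c₂ ∨ d₂ = upCell c₂)
    (hT : AlphaColumnStrict T) (hT₁ : AlphaColumnStrict T₁) (hT₂ : AlphaColumnStrict T₂)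
    (h1 : T c₁ = some (MEntry.al r₁)) (h2 : T c₂ = some (MEntry.al r₂))
    (h3 : T₁ d₁ = some (MEntry.al r₁)) (h4 : T₁ c₂ = some (MEntry.al r₂))
    (h5 : T₂ c₁ = some (MEntry.al r₁)) (h6 : T₂ d₂ = some (MEntry.al r₂))
    (hcc : c₁ ≠ c₂) (hdd : d₁ ≠ d₂) (hcd : c₁ ≠ d₂) (hdc : d₁ ≠ c₂) (hle : d₁ ≤ d₂) :
    r₂ ≤ r₁ ∧ (d₁.2 = d₂.2 → d₁ ≠ d₂ → r₂ < r₁) := by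
  rw [alphaColumnStrict_iff_s14] at hT hT₁ hT₂
  have hb := hT₂ c₁ d₂ _ _ h5 h6 ((le_of_adjacent had₁).trans hle)
  refine ⟨hb.1, fun hcol _ => ?_⟩
  have hrow : d₁.1 < d₂.1 := lt_of_le_of_ne hle.1 fun e => hdd (Prod.ext e hcol)
  rcases had₁ with e₁ | e₁
  · rcases had₂ with e₂ | e₂
    · subst e₁ e₂
      refine (hT c₁ c₂ _ _ h1 h2 ⟨hle.1, ?_⟩).2 ?_ hcc <;>
        simp only [rtCell] at hcol <;> omega
    · subst e₂
      exact (hT₁ d₁ c₂ _ _ h3 h4 ⟨Nat.le_of_lt_succ hrow, hcol.le⟩).2 hcol hdc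
  · refine hb.2 ?_ hcd
    rw [← hcol, e₁, upCell_snd]

theorem beta_pair_of_switches {s₁ s₂ : ℤ} (had₁ : d₁ = rtCell c₁ ∨ d₁ = upCell c₁)
    (had₂ : d₂ = rtCell c₂ ∨ d₂ = upCell c₂)
    (hT : BetaRowStrict T) (hT₁ : BetaRowStrict T₁) (hT₂ : BetaRowStrict T₂)
    (h1 : T d₁ = some (MEntry.be s₁)) (h2 : T d₂ = some (MEntry.be s₂))
    (h3 : T₁ c₁ = some (MEntry.be s₁)) (h4 : T₁ d₂ = some (MEntry.be s₂))
    (h5 : T₂ d₁ = some (MEntry.be s₁)) (h6 : T₂ c₂ = some (MEntry.be s₂))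
    (hcc : c₁ ≠ c₂) (hdd : d₁ ≠ d₂) (hcd : c₁ ≠ d₂) (hdc : d₁ ≠ c₂) (hle : c₁ ≤ c₂) :
    s₂ ≤ s₁ ∧ (c₁.1 = c₂.1 → c₁ ≠ c₂ → s₂ < s₁) := by
  rw [betaRowStrict_iff_s14] at hT hT₁ hT₂
  have hb := hT₁ c₁ d₂ _ _ h3 h4 (hle.trans (le_of_adjacent had₂))
  refine ⟨hb.1, fun hrow _ => ?_⟩
  have hcol : c₁.2 < c₂.2 := lt_of_le_of_ne hle.2 fun e => hcc (Prod.ext hrow e)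
  rcases had₂ with e₂ | e₂
  · refine hb.2 ?_ hcd
    rw [hrow, e₂, rtCell_fst]
  · rcases had₁ with e₁ | e₁
    · subst e₁
      exact (hT₂ _ c₂ _ _ h5 h6 ⟨hrow.le, hcol⟩).2 hrow hdc
    · subst e₁ e₂
      refine (hT _ _ _ _ h1 h2 ⟨?_, hle.2⟩).2 ?_ hdd <;>
        simp only [upCell] <;> omega

theorem swapCells_comm (hcc : c₁ ≠ c₂) (hdd : d₁ ≠ d₂) (hcd : c₁ ≠ d₂) (hdc : d₁ ≠ c₂) :
    swapCells (swapCells T c₁ d₁) c₂ d₂ = swapCells (swapCells T c₂ d₂) c₁ d₁ := by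
  funext p
  by_cases h1 : p = c₁
  · subst h1
    rw [swapCells_of_ne_s14 hcc hcd, swapCells_left, swapCells_left, swapCells_of_ne_s14 hdc hdd]
  by_cases h2 : p = d₁
  · subst h2
    rw [swapCells_of_ne_s14 hdc hdd, swapCells_right, swapCells_right, swapCells_of_ne_s14 hcc hcd]
  by_cases h3 : p = c₂
  · subst h3
    rw [swapCells_left, swapCells_of_ne_s14 hcd.symm hdd.symm, swapCells_of_ne_s14 h1 h2,
      swapCells_left]
  by_cases h4 : p = d₂
  · subst h4
    rw [swapCells_right, swapCells_of_ne_s14 hcc.symm hdc.symm, swapCells_of_ne_s14 h1 h2,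
      swapCells_right]
  rw [swapCells_of_ne_s14 h3 h4, swapCells_of_ne_s14 h1 h2, swapCells_of_ne_s14 h1 h2, swapCells_of_ne_s14 h3 h4]

/-- Performing two disjoint switches one after the other preserves the strictness conditions. -/
theorem valid_swapCells_swapCells {r₁ r₂ s₁ s₂ : ℤ} (had₁ : d₁ = rtCell c₁ ∨ d₁ = upCell c₁)
    (had₂ : d₂ = rtCell c₂ ∨ d₂ = upCell c₂)
    (hr₁ : T c₁ = some (MEntry.al r₁)) (hs₁ : T d₁ = some (MEntry.be s₁))
    (hr₂ : T c₂ = some (MEntry.al r₂)) (hs₂ : T d₂ = some (MEntry.be s₂))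
    (hα : AlphaColumnStrict T) (hβ : BetaRowStrict T)
    (hα₁ : AlphaColumnStrict (swapCells T c₁ d₁)) (hβ₁ : BetaRowStrict (swapCells T c₁ d₁))
    (hα₂ : AlphaColumnStrict (swapCells T c₂ d₂)) (hβ₂ : BetaRowStrict (swapCells T c₂ d₂))
    (hcc : c₁ ≠ c₂) (hdd : d₁ ≠ d₂) (hcd : c₁ ≠ d₂) (hdc : d₁ ≠ c₂) :
    AlphaColumnStrict (swapCells (swapCells T c₁ d₁) c₂ d₂) ∧
      BetaRowStrict (swapCells (swapCells T c₁ d₁) c₂ d₂) := by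
  have hcomm := swapCells_comm (T := T) hcc hdd hcd hdc
  have k1 : swapCells T c₁ d₁ c₁ = some (MEntry.be s₁) := by rw [swapCells_left, hs₁]
  have k2 : swapCells T c₁ d₁ d₁ = some (MEntry.al r₁) := by rw [swapCells_right, hr₁]
  have k3 : swapCells T c₁ d₁ c₂ = some (MEntry.al r₂) := by
    rw [swapCells_of_ne_s14 hcc.symm hdc.symm, hr₂]
  have k4 : swapCells T c₁ d₁ d₂ = some (MEntry.be s₂) := by
    rw [swapCells_of_ne_s14 hcd.symm hdd.symm, hs₂]
  have l1 : swapCells T c₂ d₂ c₂ = some (MEntry.be s₂) := by rw [swapCells_left, hs₂]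
  have l2 : swapCells T c₂ d₂ d₂ = some (MEntry.al r₂) := by rw [swapCells_right, hr₂]
  have l3 : swapCells T c₂ d₂ c₁ = some (MEntry.al r₁) := by rw [swapCells_of_ne_s14 hcc hcd, hr₁]
  have l4 : swapCells T c₂ d₂ d₁ = some (MEntry.be s₁) := by rw [swapCells_of_ne_s14 hdc hdd, hs₁]
  set T₃ := swapCells (swapCells T c₁ d₁) c₂ d₂ with hT₃
  have m1 : T₃ c₁ = some (MEntry.be s₁) := by rw [hT₃, swapCells_of_ne_s14 hcc hcd, k1]
  have m2 : T₃ d₁ = some (MEntry.al r₁) := by rw [hT₃, swapCells_of_ne_s14 hdc hdd, k2]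
  have m3 : T₃ c₂ = some (MEntry.be s₂) := by rw [hT₃, swapCells_left, k4]
  have m4 : T₃ d₂ = some (MEntry.al r₂) := by rw [hT₃, swapCells_right, k3]
  have e1 : ∀ p, p ≠ c₂ → p ≠ d₂ → T₃ p = swapCells T c₁ d₁ p := fun p h1 h2 =>
    swapCells_of_ne_s14 h1 h2
  have e2 : ∀ p, p ≠ c₁ → p ≠ d₁ → T₃ p = swapCells T c₂ d₂ p := fun p h1 h2 => by
    rw [hcomm]
    exact swapCells_of_ne_s14 h1 h2
  have pα := alpha_pair_of_switches had₁ had₂ hα hα₁ hα₂ hr₁ hr₂ k2 k3 l3 l2 hcc hdd hcd hdc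
  have pα' := alpha_pair_of_switches had₂ had₁ hα hα₂ hα₁ hr₂ hr₁ l2 l3 k3 k2 hcc.symm hdd.symm
    hdc.symm hcd.symm
  have pβ := beta_pair_of_switches had₁ had₂ hβ hβ₁ hβ₂ hs₁ hs₂ k1 k4 l4 l1 hcc hdd hcd hdc
  have pβ' := beta_pair_of_switches had₂ had₁ hβ hβ₂ hβ₁ hs₂ hs₁ l1 l4 k4 k1 hcc.symm hdd.symm
    hdc.symm hcd.symm
  have na : ∀ {p k}, T₃ p = some (MEntry.al k) → p ≠ c₁ ∧ p ≠ c₂ := by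
    refine fun hp => ⟨?_, ?_⟩ <;> rintro rfl
    · simp [m1] at hp
    · simp [m3] at hp
  have nb : ∀ {p k}, T₃ p = some (MEntry.be k) → p ≠ d₁ ∧ p ≠ d₂ := by
    refine fun hp => ⟨?_, ?_⟩ <;> rintro rfl
    · simp [m2] at hp
    · simp [m4] at hp
  rw [alphaColumnStrict_iff_s14] at hα₁ hα₂ ⊢
  rw [betaRowStrict_iff_s14] at hβ₁ hβ₂ ⊢
  constructor
  · intro p q k l hp hq hpq
    by_cases h1 : p ≠ d₁ ∧ q ≠ d₁
    · rw [e2 p (na hp).1 h1.1] at hp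
      rw [e2 q (na hq).1 h1.2] at hq
      exact hα₂ p q k l hp hq hpq
    by_cases h2 : p ≠ d₂ ∧ q ≠ d₂
    · rw [e1 p (na hp).2 h2.1] at hp
      rw [e1 q (na hq).2 h2.2] at hq
      exact hα₁ p q k l hp hq hpq
    by_cases h3 : p = d₁
    · subst h3
      have h4 : q = d₂ := not_not.1 fun h4 => h2 ⟨hdd, h4⟩
      subst h4
      simp only [m2, m4, Option.some.injEq, MEntry.al.injEq] at hp hq
      subst hp hq
      exact pα hpq
    · have h4 : q = d₁ := not_not.1 fun h4 => h1 ⟨h3, h4⟩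
      subst h4
      have h5 : p = d₂ := not_not.1 fun h5 => h2 ⟨h5, hdd⟩
      subst h5
      simp only [m2, m4, Option.some.injEq, MEntry.al.injEq] at hp hq
      subst hp hq
      exact pα' hpq
  · intro p q k l hp hq hpq
    by_cases h1 : p ≠ c₁ ∧ q ≠ c₁
    · rw [e2 p h1.1 (nb hp).1] at hp
      rw [e2 q h1.2 (nb hq).1] at hq
      exact hβ₂ p q k l hp hq hpq
    by_cases h2 : p ≠ c₂ ∧ q ≠ c₂
    · rw [e1 p h2.1 (nb hp).2] at hp
      rw [e1 q h2.2 (nb hq).2] at hq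
      exact hβ₁ p q k l hp hq hpq
    by_cases h3 : p = c₁
    · subst h3
      have h4 : q = c₂ := not_not.1 fun h4 => h2 ⟨hcc, h4⟩
      subst h4
      simp only [m1, m3, Option.some.injEq, MEntry.be.injEq] at hp hq
      subst hp hq
      exact pβ hpq
    · have h4 : q = c₁ := not_not.1 fun h4 => h1 ⟨h3, h4⟩
      subst h4
      have h5 : p = c₂ := not_not.1 fun h5 => h2 ⟨h5, hcc⟩
      subst h5
      simp only [m1, m3, Option.some.injEq, MEntry.be.injEq] at hp hq
      subst hp hq
      exact pβ' hpq

/-- An `α` cannot be switched both to the right and upwards. -/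
theorem not_switch_right_and_up {c : Cell} {s t : ℤ}
    (hs : T (rtCell c) = some (MEntry.be s)) (ht : T (upCell c) = some (MEntry.be t))
    (h1 : BetaRowStrict (swapCells T c (rtCell c)))
    (h2 : BetaRowStrict (swapCells T c (upCell c))) : False := by
  rw [betaRowStrict_iff_s14] at h1 h2
  have hne : upCell c ≠ rtCell c := by simp [upCell, rtCell]
  have h3 := (h1 c (upCell c) s t (by rw [swapCells_left, hs])
    (by rw [swapCells_of_ne_s14 (upCell_ne c) hne, ht]) (le_upCell c)).1
  have h4 := (h2 c (rtCell c) t s (by rw [swapCells_left, ht])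
    (by rw [swapCells_of_ne_s14 (rtCell_ne c) hne.symm, hs]) (le_rtCell c)).2 rfl (rtCell_ne c).symm
  omega

/-- A `β` cannot be switched both to the left and downwards. -/
theorem not_switch_left_and_down {c c' : Cell} {a b : ℤ} (hcc : rtCell c = upCell c')
    (ha : T c = some (MEntry.al a)) (hb : T c' = some (MEntry.al b))
    (h1 : AlphaColumnStrict (swapCells T c (rtCell c)))
    (h2 : AlphaColumnStrict (swapCells T c' (upCell c'))) : False := by
  rw [alphaColumnStrict_iff_s14] at h1 h2
  have hne : c ≠ c' := by
    rintro rfl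
    simp [rtCell, upCell] at hcc
  have h3 := (h1 c' (rtCell c) b a
    (by rw [swapCells_of_ne_s14 hne.symm (by rw [hcc]; exact (upCell_ne c').symm), hb])
    (by rw [swapCells_right, ha]) (hcc ▸ le_upCell c')).2
    (by rw [hcc, upCell_snd]) (by rw [hcc]; exact (upCell_ne c').symm)
  have h4 := (h2 c (upCell c') a b
    (by rw [swapCells_of_ne_s14 hne (by rw [← hcc]; exact (rtCell_ne c).symm), ha])
    (by rw [swapCells_right, hb]) (hcc ▸ le_rtCell c)).1
  omega

theorem Switch.diamond (h₁ : Switch T T₁) (h₂ : Switch T T₂) :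
    T₁ = T₂ ∨ ∃ T₃, Switch T₁ T₃ ∧ Switch T₂ T₃ := by
  obtain ⟨hα, hβ, c₁, d₁, had₁, ⟨r₁, hr₁⟩, ⟨s₁, hs₁⟩, rfl, hα₁, hβ₁⟩ := h₁
  obtain ⟨-, -, c₂, d₂, had₂, ⟨r₂, hr₂⟩, ⟨s₂, hs₂⟩, rfl, hα₂, hβ₂⟩ := h₂
  have hcd : c₁ ≠ d₂ := by
    rintro rfl
    simp [hr₁] at hs₂
  have hdc : d₁ ≠ c₂ := by
    rintro rfl
    simp [hs₁] at hr₂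
  by_cases hcc : c₁ = c₂
  · subst hcc
    rcases had₁ with rfl | rfl <;> rcases had₂ with rfl | rfl
    · exact Or.inl rfl
    · exact (not_switch_right_and_up hs₁ hs₂ hβ₁ hβ₂).elim
    · exact (not_switch_right_and_up hs₂ hs₁ hβ₂ hβ₁).elim
    · exact Or.inl rfl
  by_cases hdd : d₁ = d₂
  · rcases had₁ with rfl | rfl <;> rcases had₂ with rfl | rfl
    · exact absurd (rtCell_inj hdd) hcc
    · exact (not_switch_left_and_down hdd hr₁ hr₂ hα₁ hα₂).elim
    · exact (not_switch_left_and_down hdd.symm hr₂ hr₁ hα₂ hα₁).elim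
    · exact absurd (upCell_inj hdd) hcc
  right
  have hv := valid_swapCells_swapCells had₁ had₂ hr₁ hs₁ hr₂ hs₂ hα hβ hα₁ hβ₁ hα₂ hβ₂ hcc hdd
    hcd hdc
  have hcomm := swapCells_comm (T := T) hcc hdd hcd hdc
  refine ⟨_, ⟨hα₁, hβ₁, c₂, d₂, had₂, ⟨r₂, ?_⟩, ⟨s₂, ?_⟩, rfl, hv⟩,
    hα₂, hβ₂, c₁, d₁, had₁, ⟨r₁, ?_⟩, ⟨s₁, ?_⟩, hcomm, hv⟩
  · rw [swapCells_of_ne_s14 (Ne.symm hcc) hdc.symm, hr₂]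
  · rw [swapCells_of_ne_s14 hcd.symm (Ne.symm hdd), hs₂]
  · rw [swapCells_of_ne_s14 hcc hcd, hr₁]
  · rw [swapCells_of_ne_s14 hdc hdd, hs₁]

theorem not_switch_of_not_pending (h : ∀ c, ¬ ShuffPending T c) : ¬ Switch T T₁ := by
  rintro ⟨-, -, c, d, rfl | rfl, hr, hs, -⟩
  · exact h c ⟨hr, Or.inr hs⟩
  · exact h c ⟨hr, Or.inl hs⟩

/-- Every sequence of switches can be continued to any fully switched result. -/
theorem switches_to_fullySwitched (h₁ : Relation.ReflTransGen Switch T T₁)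
    (h₂ : Relation.ReflTransGen Switch T T₂) (h : FullySwitched T₂) :
    Relation.ReflTransGen Switch T₁ T₂ := by
  obtain ⟨X, hX₁, hX₂⟩ := Relation.church_rosser (r := Switch) (fun a b c hab hac => by
    rcases hab.diamond hac with rfl | ⟨d, hbd, hcd⟩
    · exact ⟨b, .refl, .refl⟩
    · exact ⟨d, .single hbd, .single hcd⟩) h₁ h₂
  rcases hX₂.cases_head with rfl | ⟨Y, hY, -⟩
  · exact hX₁
  · exact absurd ⟨Y, hY⟩ h

/-! ### Effect of switches on flags -/

theorem mshape_eq_of_switches (h : Relation.ReflTransGen Switch T T₁) :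
    mshape T₁ = mshape T := by
  induction h with
  | refl => rfl
  | tail _ hstep ih =>
    rw [← ih]
    obtain ⟨-, -, c, d, -, ⟨r, hr⟩, ⟨s, hs⟩, rfl, -⟩ := hstep
    ext p
    simp only [mshape, Set.mem_ofPred_eq]
    by_cases h1 : p = d
    · subst h1
      simp [swapCells_right, hr, hs]
    · by_cases h2 : p = c
      · subst h2
        simp [swapCells_left, hr, hs]
      · rw [swapCells_of_ne_s14 h2 h1]

theorem alpha_origin_of_switches (h : Relation.ReflTransGen Switch T T₁) :
    ∀ p k, T₁ p = some (MEntry.al k) → ∃ q, T q = some (MEntry.al k) ∧ q.2 ≤ p.2 := by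
  induction h with
  | refl => exact fun p k hp => ⟨p, hp, le_rfl⟩
  | tail _ hstep ih =>
    obtain ⟨-, -, c, d, had, ⟨r, hr⟩, ⟨s, hs⟩, rfl, -⟩ := hstep
    intro p k hp
    by_cases h1 : p = d
    · subst h1
      rw [swapCells_right] at hp
      obtain ⟨q, hq, hqc⟩ := ih c k hp
      exact ⟨q, hq, hqc.trans (le_of_adjacent had).2⟩
    · by_cases h2 : p = c
      · subst h2
        simp [swapCells_left, hs] at hp
      · rw [swapCells_of_ne_s14 h2 h1] at hp
        exact ih p k hp

theorem beta_image_of_switches (h : Relation.ReflTransGen Switch T T₁) :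
    ∀ p k, T p = some (MEntry.be k) → ∃ q, T₁ q = some (MEntry.be k) ∧ q.1 ≤ p.1 := by
  induction h with
  | refl => exact fun p k hp => ⟨p, hp, le_rfl⟩
  | tail _ hstep ih =>
    obtain ⟨-, -, c, d, had, ⟨r, hr⟩, ⟨s, hs⟩, rfl, -⟩ := hstep
    intro p k hp
    obtain ⟨q, hq, hqp⟩ := ih p k hp
    by_cases h1 : q = d
    · subst h1
      exact ⟨c, by rw [swapCells_left, hq], (le_of_adjacent had).1.trans hqp⟩
    · by_cases h2 : q = c
      · subst h2
        simp [hr] at hq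
      · exact ⟨q, by rw [swapCells_of_ne_s14 h2 h1, hq], hqp⟩

end Confluence

/-- Lemma 4.18: if `Q ∈ BFT(mu/lam)` then `jdt_GG(Q) ∈ EXQ(mu/lam)`. -/
theorem ggjdt_BFT_to_EXQ (lam mu : Set Cell) (Q E : MixedTableau)
    (hQ : IsBFT lam mu Q) (hE : GGRel Q E) :
    IsEXQ lam mu E := by
  obtain ⟨⟨hfin, hpos, hapos⟩, hskew, hα, hβ, hsort, hflag, ⟨S, hS⟩, hSflag⟩ := hQ
  have hshape := hskew.2.2.2
  have hsh : (mu \ lam).OrdConnected := hskew.1.ordConnected_diff hskew.2.1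
  have hidle := fun θ => idle_of_sorted θ hskew hα hβ hsort
  have hAfin : (alphaCells Q).Finite := hfin.subset fun p ⟨k, hk⟩ => by simp [mshape, hk]
  obtain ⟨hEstate, hQE⟩ := SlideState.ggSteps hsh (Or.inl ⟨_, hAfin, hidle 0⟩) hE.1
  obtain ⟨θ, hθ⟩ := exists_shiftBound (sh := mu \ lam) (T := Q) (hshape ▸ hfin)
    fun p hp => ((hidle 0).shape p).1 hp
  obtain ⟨hQS, hpend⟩ := hS.switches hsh ⟨_, hAfin, hidle θ⟩ hθ
  have hES := switches_to_fullySwitched hQE hQS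
    fun ⟨X, hX⟩ => not_switch_of_not_pending hpend hX
  have hEshape := mshape_eq_of_switches hQE
  refine ⟨⟨hEshape ▸ hfin, hEshape ▸ hpos, fun c k hk => ?_⟩,
    ⟨hskew.1, hskew.2.1, hskew.2.2.1, hEshape.trans hshape⟩, ⟨fun c k hk => ?_, fun c k hk => ?_⟩,
    (hEstate.idle_of_ordered hsh hE.2).totallyColumnStrict⟩
  · obtain ⟨q, hq, -⟩ := alpha_origin_of_switches hQE c k hk
    exact hapos q k hq
  · obtain ⟨q, hq, hqc⟩ := alpha_origin_of_switches hQE c k hk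
    have := hflag.1 q k hq
    omega
  · obtain ⟨q, hq, hqc⟩ := beta_image_of_switches hES c k hk
    have := (hSflag S hS).2 q k hq
    omega
end
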